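/- Let Δ be a (d−1)-dimensional Buchsbaum simplicial complex over a field K. Then K[Δ] is canonically Cohen–Macaulay if and only if the reduced simplicial homology H_i(Δ; K) vanishes for all 1 ≤ i < d−1. -/

import Mathlib

open CategoryTheory Opposite MvPolynomial

/-- The Ext modules `Ext^i_R(M, N)`. -/
noncomputable def extMod (R : Type) [CommRing R] (i : ℕ) (M N : Type) [AddCommGroup M]
    [Module R M] [AddCommGroup N] [Module R N] : ModuleCat R :=
  ((Ext R (ModuleCat R) i).obj (op (ModuleCat.of R M))).obj (ModuleCat.of R N)

/-- The Krull dimension of a module: `dim M = dim R/Ann(M)`. -/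
noncomputable def moduleDim (R : Type) [CommRing R] (M : Type) [AddCommGroup M] [Module R M] :
    WithBot (WithTop ℕ) :=
  ringKrullDim (R ⧸ Module.annihilator R M)

/-- The depth of `M` with respect to the ideal `I`: the supremum of the lengths of
`M`-regular sequences contained in `I`. -/
noncomputable def moduleDepth {R : Type} [CommRing R] (I : Ideal R) (M : Type) [AddCommGroup M]
    [Module R M] : WithTop ℕ :=
  sSup {m : WithTop ℕ | ∃ rs : List R, (rs.length : WithTop ℕ) = m ∧ (∀ r ∈ rs, r ∈ I) ∧
    RingTheory.Sequence.IsRegular M rs}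

/-- `M` is a Cohen–Macaulay module (w.r.t. the distinguished ideal `I`): depth equals
Krull dimension. -/
def IsCMMod {R : Type} [CommRing R] (I : Ideal R) (M : Type) [AddCommGroup M] [Module R M] :
    Prop :=
  (moduleDepth I M : WithBot (WithTop ℕ)) = moduleDim R M

/-- The graded maximal ideal `𝔪 = (x₁, …, xₙ)` of `R = K[x₁,…,xₙ]`. -/
noncomputable def maxIdeal (K : Type) [Field K] (n : ℕ) : Ideal (MvPolynomial (Fin n) K) :=
  Ideal.span (Set.range (MvPolynomial.X : Fin n → MvPolynomial (Fin n) K))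

attribute [local instance] MvPolynomial.gradedAlgebra

open MvPolynomial

/-- `Δ` is an (abstract) simplicial complex on the vertex set `Fin n`:
a collection of finite sets closed under taking subsets. -/
def IsSimplicialComplex {n : ℕ} (Δ : Finset (Finset (Fin n))) : Prop :=
  ∀ s ∈ Δ, ∀ t ⊆ s, t ∈ Δ

/-- The Stanley–Reisner ideal `I_Δ` of `Δ`, generated by the squarefree monomials
corresponding to non-faces of `Δ`. -/
noncomputable def stanleyReisnerIdeal (K : Type) [Field K] {n : ℕ}
    (Δ : Finset (Finset (Fin n))) : Ideal (MvPolynomial (Fin n) K) :=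
  Ideal.span {m | ∃ S : Finset (Fin n), S ∉ Δ ∧ m = ∏ i ∈ S, (MvPolynomial.X i : MvPolynomial (Fin n) K)}

/-- The space of simplicial `k`-chains of `Δ` with coefficients in `K`:
functions on the `k`-dimensional faces (faces with `k+1` vertices). -/
abbrev simpChains (K : Type) [Field K] {n : ℕ} (Δ : Finset (Finset (Fin n))) (k : ℕ) : Type :=
  {s : Finset (Fin n) // s ∈ Δ ∧ s.card = k + 1} → K

/-- The simplicial boundary map `∂ : C_{k+1}(Δ; K) → C_k(Δ; K)`, with the standard signs
coming from the linear order on the vertices. -/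
noncomputable def simpBoundary (K : Type) [Field K] {n : ℕ} (Δ : Finset (Finset (Fin n)))
    (k : ℕ) : simpChains K Δ (k + 1) →ₗ[K] simpChains K Δ k where
  toFun c s := ∑ v : Fin n,
    if h : v ∉ s.1 ∧ insert v s.1 ∈ Δ ∧ (insert v s.1).card = (k + 1) + 1
      then ((-1 : K)) ^ ((s.1.filter (fun i => i < v)).card) * c ⟨insert v s.1, h.2⟩
      else 0
  map_add' c c' := by
    funext s
    rw [Pi.add_apply, ← Finset.sum_add_distrib]
    refine Finset.sum_congr rfl fun v _ => ?_
    split_ifs with h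
    · simp [mul_add]
    · simp
  map_smul' a c := by
    funext s
    simp only [RingHom.id_apply, Pi.smul_apply, Finset.smul_sum]
    refine Finset.sum_congr rfl fun v _ => ?_
    split_ifs with h
    · simp [smul_eq_mul]; ring
    · simp

/-- The reduced simplicial homology `H_{j+1}(Δ; K)` (for homological degrees `≥ 1`,
reduced and ordinary homology agree): cycles in degree `j+1` modulo boundaries. -/
noncomputable abbrev simpHomologySucc (K : Type) [Field K] {n : ℕ} (Δ : Finset (Finset (Fin n)))
    (j : ℕ) : Type :=
  ↥(LinearMap.ker (simpBoundary K Δ j)) ⧸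
    Submodule.comap (LinearMap.ker (simpBoundary K Δ j)).subtype
      (LinearMap.range (simpBoundary K Δ (j + 1)))

namespace StanleyReisner

section Koszul

variable {n : ℕ}

/-- The sign `(-1) ^ #{w ∈ A | w < v}`. -/
def incSign (v : Fin n) (A : Finset (Fin n)) : ℤ := (-1) ^ (A.filter (· < v)).card

lemma incSign_mul_self (v : Fin n) (A : Finset (Fin n)) : incSign v A * incSign v A = 1 := by
  rw [incSign, ← pow_add, Even.neg_one_pow ⟨_, rfl⟩]

lemma incSign_smul_smul {Y : Type*} [AddCommGroup Y] (v : Fin n) (A : Finset (Fin n)) (y : Y) :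
    incSign v A • incSign v A • y = y := by
  rw [smul_smul, incSign_mul_self, one_smul]

lemma incSign_erase_self (v : Fin n) (A : Finset (Fin n)) :
    incSign v (A.erase v) = incSign v A := by
  unfold incSign
  congr 2
  ext w
  simp only [Finset.mem_filter, Finset.mem_erase]
  exact ⟨fun h => ⟨h.1.2, h.2⟩, fun h => ⟨⟨h.2.ne, h.1⟩, h.2⟩⟩

lemma incSign_insert_of_le {v w : Fin n} (A : Finset (Fin n)) (h : v ≤ w) :
    incSign v (insert w A) = incSign v A := by
  unfold incSign
  rw [Finset.filter_insert, if_neg (not_lt.mpr h)]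

lemma incSign_insert_of_lt {v w : Fin n} {A : Finset (Fin n)} (h : w < v) (hw : w ∉ A) :
    incSign v (insert w A) = -incSign v A := by
  unfold incSign
  rw [Finset.filter_insert, if_pos h, Finset.card_insert_of_notMem (by simp [hw]), pow_succ]
  ring

lemma incSign_insert_self (v : Fin n) (A : Finset (Fin n)) :
    incSign v (insert v A) = incSign v A := incSign_insert_of_le A le_rfl

lemma incSign_insert_swap {v w : Fin n} {A : Finset (Fin n)} (hvw : v ≠ w) (hv : v ∉ A)
    (hw : w ∉ A) :
    incSign v (insert w A) * incSign w A = -(incSign w (insert v A) * incSign v A) := by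
  rcases lt_or_gt_of_ne hvw with h | h
  · rw [incSign_insert_of_le _ h.le, incSign_insert_of_lt h hv]; ring
  · rw [incSign_insert_of_le _ h.le, incSign_insert_of_lt h hw]; ring

lemma incSign_erase_swap {v w : Fin n} {A : Finset (Fin n)} (hvw : v ≠ w) (hv : v ∈ A)
    (hw : w ∈ A) :
    incSign v A * incSign w (A.erase v) = -(incSign w A * incSign v (A.erase w)) := by
  obtain ⟨B, hvB, hwB, rfl⟩ : ∃ B, v ∉ B ∧ w ∉ B ∧ A = insert v (insert w B) :=
    ⟨(A.erase v).erase w, by simp, by simp, by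
      rw [Finset.insert_erase (by simp [hvw.symm, hw]), Finset.insert_erase hv]⟩
  have e1 : (insert v (insert w B)).erase v = insert w B :=
    Finset.erase_insert (by simp [hvw, hvB])
  have e2 : (insert v (insert w B)).erase w = insert v B := by
    rw [Finset.insert_comm]; exact Finset.erase_insert (by simp [hvw.symm, hwB])
  rw [e1, e2, incSign_insert_self, Finset.insert_comm, incSign_insert_self, incSign_insert_self,
    incSign_insert_self]
  exact incSign_insert_swap hvw hvB hwB

lemma incSign_of_forall_lt {a : Fin n} {A : Finset (Fin n)} (h : ∀ w ∈ A, w < a) :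
    incSign a A = (-1) ^ A.card := by
  rw [incSign, Finset.filter_true_of_mem h]

/-- An alternating double sum over ordered pairs of distinct elements vanishes. -/
lemma sum_sum_erase_eq_zero {ι Y : Type*} [DecidableEq ι] [AddCommGroup Y] (A : Finset ι)
    (f : ι → ι → Y) (hf : ∀ v ∈ A, ∀ w ∈ A, v ≠ w → f v w = -f w v) :
    ∑ v ∈ A, ∑ w ∈ A.erase v, f v w = 0 := by
  rw [Finset.sum_sigma']
  refine Finset.sum_involution (fun p _ => ⟨p.2, p.1⟩) ?_ ?_ ?_ ?_
  · rintro ⟨v, w⟩ h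
    simp only [Finset.mem_sigma, Finset.mem_erase] at h
    simp only
    rw [hf v h.1 w h.2.2 (Ne.symm h.2.1), neg_add_cancel]
  · rintro ⟨v, w⟩ h _ he
    simp only [Finset.mem_sigma, Finset.mem_erase] at h
    simp only [Sigma.mk.injEq] at he
    exact h.2.1 he.1
  · rintro ⟨v, w⟩ h
    simp only [Finset.mem_sigma, Finset.mem_erase] at h ⊢
    exact ⟨h.2.2, Ne.symm h.2.1, h.1⟩
  · rintro ⟨v, w⟩ h
    rfl

variable {R : Type} [CommRing R] (x : Fin n → R)

/-- Every `x v` is a nonzerodivisor modulo the ideal generated by any set of other `x w`. -/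
def IsStronglyRegular : Prop :=
  ∀ (v : Fin n) (U : Finset (Fin n)), v ∉ U → ∀ s : R,
    x v * s ∈ Ideal.span (x '' U) → s ∈ Ideal.span (x '' U)

/-- The differential of the Koszul cochain complex. -/
def koszulD (g : Finset (Fin n) → R) (A : Finset (Fin n)) : R :=
  ∑ v ∈ A, incSign v A • (x v * g (A.erase v))

/-- The differential of the Koszul chain complex on the variables in `U`. -/
def koszulB (U : Finset (Fin n)) (h : Finset (Fin n) → R) (A : Finset (Fin n)) : R :=
  ∑ v ∈ U \ A, incSign v A • (x v * h (insert v A))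

variable {x}

lemma koszulD_mem (g : Finset (Fin n) → R) (A : Finset (Fin n)) :
    koszulD x g A ∈ Ideal.span (x '' A) :=
  Ideal.sum_mem _ fun _ hv => zsmul_mem
    (Ideal.mul_mem_right _ _ (Ideal.subset_span (Set.mem_image_of_mem x hv))) _

lemma koszulB_mem (U : Finset (Fin n)) (g : Finset (Fin n) → R) (A : Finset (Fin n)) :
    koszulB x U g A ∈ Ideal.span (x '' U) :=
  Ideal.sum_mem _ fun _ hv => zsmul_mem
    (Ideal.mul_mem_right _ _ (Ideal.subset_span (Set.mem_image_of_mem x (Finset.mem_sdiff.mp hv).1))) _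

lemma exists_sum_of_mem_span_image {U : Finset (Fin n)} {s : R}
    (hs : s ∈ Ideal.span (x '' U)) : ∃ c : Fin n → R, s = ∑ v ∈ U, x v * c v := by
  rw [Ideal.span, Finsupp.mem_span_image_iff_linearCombination] at hs
  obtain ⟨l, hl, rfl⟩ := hs
  refine ⟨l, ?_⟩
  rw [Finsupp.linearCombination_apply, Finsupp.sum_of_support_subset l
    (by simpa [Finsupp.mem_supported] using hl) _ (by simp)]
  exact Finset.sum_congr rfl fun v _ => by rw [smul_eq_mul, mul_comm]

lemma koszulD_insert {U A : Finset (Fin n)} {a : Fin n} (ha : ∀ w ∈ U, w < a) (hA : A ⊆ U)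
    (g : Finset (Fin n) → R) :
    koszulD x g (insert a A) =
      koszulD x (fun B => g (insert a B)) A + (-1) ^ A.card * (x a * g A) := by
  have haA : a ∉ A := fun h => (ha a (hA h)).false
  unfold koszulD
  rw [Finset.sum_insert haA, incSign_insert_self, incSign_of_forall_lt fun w hw => ha w (hA hw),
    Finset.erase_insert haA, add_comm]
  congr 1
  · refine Finset.sum_congr rfl fun v hv => ?_
    rw [incSign_insert_of_le _ (ha v (hA hv)).le, Finset.erase_insert_of_ne (ha v (hA hv)).ne']
  · simp [zsmul_eq_mul]

lemma koszulB_insert {U A : Finset (Fin n)} {a : Fin n} (ha : ∀ w ∈ U, w < a) (hA : A ⊆ U)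
    (h : Finset (Fin n) → R) :
    koszulB x (insert a U) h A = koszulB x U h A + (-1) ^ A.card * (x a * h (insert a A)) := by
  have haA : a ∉ A := fun h => (ha a (hA h)).false
  have haU : a ∉ U := fun h => (ha a h).false
  unfold koszulB
  rw [Finset.insert_sdiff_of_notMem _ haA, Finset.sum_insert (by simp [haU]),
    incSign_of_forall_lt fun w hw => ha w (hA hw), add_comm]
  simp [zsmul_eq_mul]

lemma koszulB_insert_insert {U A : Finset (Fin n)} {a : Fin n} (ha : ∀ w ∈ U, w < a)
    (h : Finset (Fin n) → R) :
    koszulB x (insert a U) h (insert a A) = koszulB x U (fun B => h (insert a B)) A := by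
  unfold koszulB
  have haU : a ∉ U := fun h => (ha a h).false
  rw [Finset.insert_sdiff_insert, Finset.sdiff_insert_of_notMem haU]
  refine Finset.sum_congr rfl fun v hv => ?_
  rw [incSign_insert_of_le _ (ha v (Finset.mem_sdiff.mp hv).1).le, Finset.insert_comm]

lemma koszulD_add (g g' : Finset (Fin n) → R) (A : Finset (Fin n)) :
    koszulD x (fun B => g B + g' B) A = koszulD x g A + koszulD x g' A := by
  simp [koszulD, mul_add, Finset.sum_add_distrib]

lemma koszulD_const_mul (r : R) (g : Finset (Fin n) → R) (A : Finset (Fin n)) :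
    koszulD x (fun B => r * g B) A = r * koszulD x g A := by
  simp only [koszulD, Finset.mul_sum, zsmul_eq_mul]
  exact Finset.sum_congr rfl fun v _ => by ring

lemma koszulB_add (U : Finset (Fin n)) (g g' : Finset (Fin n) → R) (A : Finset (Fin n)) :
    koszulB x U (fun B => g B + g' B) A = koszulB x U g A + koszulB x U g' A := by
  simp [koszulB, mul_add, Finset.sum_add_distrib]

lemma koszulB_const_mul (U : Finset (Fin n)) (r : R) (g : Finset (Fin n) → R)
    (A : Finset (Fin n)) :
    koszulB x U (fun B => r * g B) A = r * koszulB x U g A := by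
  simp only [koszulB, Finset.mul_sum, zsmul_eq_mul]
  exact Finset.sum_congr rfl fun v _ => by ring

lemma koszulD_congr {g g' : Finset (Fin n) → R} {A : Finset (Fin n)}
    (h : ∀ v ∈ A, g (A.erase v) = g' (A.erase v)) : koszulD x g A = koszulD x g' A :=
  Finset.sum_congr rfl fun v hv => by rw [h v hv]

lemma koszulB_congr {U : Finset (Fin n)} {g g' : Finset (Fin n) → R} {A : Finset (Fin n)}
    (h : ∀ v ∈ U \ A, g (insert v A) = g' (insert v A)) : koszulB x U g A = koszulB x U g' A :=
  Finset.sum_congr rfl fun v hv => by rw [h v hv]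

end Koszul

section KoszulExact

variable {n : ℕ} {R : Type} [CommRing R] {x : Fin n → R}

lemma exists_koszulD_eq_top {U : Finset (Fin n)} {r : R} (hr : r ∈ Ideal.span (x '' U)) :
    ∃ w : Finset (Fin n) → R, koszulD x w U = r := by
  obtain ⟨c, rfl⟩ := exists_sum_of_mem_span_image hr
  refine ⟨fun B => ∑ v ∈ U \ B, incSign v U • c v, Finset.sum_congr rfl fun v hv => ?_⟩
  have : U \ U.erase v = {v} := by
    ext w; simp only [Finset.mem_sdiff, Finset.mem_erase, Finset.mem_singleton]
    constructor
    · rintro ⟨h1, h2⟩; by_contra h; exact h2 ⟨h, h1⟩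
    · rintro rfl; exact ⟨hv, fun h => h.1 rfl⟩
  simp only [this, Finset.sum_singleton, mul_smul_comm, incSign_smul_smul]

/-- Exactness of the Koszul cochain complex, including its top degree. -/
lemma exists_koszulD_eq (hx : IsStronglyRegular x) (U : Finset (Fin n)) :
    ∀ (p : ℕ) (g : Finset (Fin n) → R), (∀ A ⊆ U, A.card = p + 1 → koszulD x g A = 0) →
      (p < U.card ∨ g U ∈ Ideal.span (x '' U)) →
      ∃ w : Finset (Fin n) → R, ∀ A ⊆ U, A.card = p → koszulD x w A = g A := by
  induction U using Finset.induction_on_max with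
  | empty =>
    intro p g _ h
    refine ⟨0, fun A hA _ => ?_⟩
    obtain rfl := Finset.subset_empty.mp hA
    rcases h with h | h
    · simp at h
    · simp at h; simp [koszulD, h]
  | insert a U ha ih =>
    intro p g hg h
    have haU : a ∉ U := fun h => (ha a h).false
    rcases lt_or_ge p (insert a U).card with hp | hp
    swap
    · obtain ⟨w, hw⟩ := exists_koszulD_eq_top (h.resolve_left (not_lt.mpr hp))
      refine ⟨w, fun A hA hAp => ?_⟩
      rw [Finset.eq_of_subset_of_card_le hA (hAp ▸ hp), hw]
    clear h
    rcases p with _ | q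
    · refine ⟨0, fun A hA h0 => ?_⟩
      obtain rfl := Finset.card_eq_zero.mp h0
      have := hg {a} (by simp) (by simp)
      rw [koszulD, Finset.sum_singleton, Finset.erase_singleton] at this
      have h2 : x a * g ∅ = 0 := by
        rw [← incSign_smul_smul a {a} (x a * g ∅), this, smul_zero]
      have := hx a ∅ (by simp) (g ∅) (by simp [h2])
      simp at this
      simp [koszulD, this]
    · rw [Finset.card_insert_of_notMem haU] at hp
      have key : ∀ A ⊆ U, A.card = q + 1 →
          koszulD x (fun B => g (insert a B)) A + (-1) ^ A.card * (x a * g A) = 0 := by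
        intro A hA hAq
        rw [← koszulD_insert ha hA]
        refine hg _ (Finset.insert_subset_insert _ hA) ?_
        rw [Finset.card_insert_of_notMem (fun h => haU (hA h)), hAq]
      obtain ⟨w0, hw0⟩ := ih (q + 1) g (fun A hA => hg A (hA.trans (Finset.subset_insert _ _))) (by
        rcases Nat.lt_or_ge (q + 1) U.card with h | h
        · exact Or.inl h
        · right
          refine hx a U haU _ ?_
          have := key U subset_rfl (by omega)
          have h3 : x a * g U = (-1) ^ (U.card + 1) * koszulD x (fun B => g (insert a B)) U := by
            have e : ((-1 : R) ^ U.card) * (-1) ^ U.card = 1 := by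
              rw [← pow_add, Even.neg_one_pow ⟨_, rfl⟩]
            linear_combination (-1) ^ U.card * this - (x a * g U) * e
          rw [h3]
          exact Ideal.mul_mem_left _ _ (koszulD_mem _ _))
      obtain ⟨w1, hw1⟩ := ih q (fun B => g (insert a B) + (-1) ^ (q + 1) * x a * w0 B) (by
        intro A hA hAq
        rw [koszulD_add, koszulD_const_mul, hw0 A hA hAq, ← key A hA hAq, hAq]
        ring) (Or.inl (by omega))
      refine ⟨fun B => if a ∈ B then w1 (B.erase a) else w0 B, fun A hA hAq => ?_⟩
      by_cases haA : a ∈ A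
      · obtain ⟨B, haB, rfl⟩ : ∃ B, a ∉ B ∧ A = insert a B :=
          ⟨A.erase a, by simp, (Finset.insert_erase haA).symm⟩
        have hB : B ⊆ U := (Finset.insert_subset_insert_iff haB).mp hA
        have hBq : B.card = q := by
          rw [Finset.card_insert_of_notMem haB] at hAq; omega
        rw [koszulD_insert ha hB, if_neg haB, koszulD_congr (g' := w1), hw1 B hB hBq, hBq]
        · ring
        · intro v hv
          simp only [Finset.mem_insert_self, if_true]
          rw [Finset.erase_insert (fun h => haB (Finset.mem_of_mem_erase h))]
      · have hAU : A ⊆ U := (Finset.subset_insert_iff_of_notMem haA).mp hA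
        rw [← hw0 A hAU hAq]
        exact koszulD_congr fun v hv => if_neg fun h => haA (Finset.mem_of_mem_erase h)

/-- Exactness of the Koszul chain complex in positive degrees. -/
lemma exists_koszulB_eq (hx : IsStronglyRegular x) (U : Finset (Fin n)) :
    ∀ (p : ℕ) (h : Finset (Fin n) → R), (∀ A ⊆ U, A.card = p → koszulB x U h A = 0) →
      ∃ w : Finset (Fin n) → R, ∀ A ⊆ U, A.card = p + 1 → koszulB x U w A = h A := by
  induction U using Finset.induction_on_max with
  | empty =>
    intro p h _
    refine ⟨0, fun A hA hAp => ?_⟩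
    obtain rfl := Finset.subset_empty.mp hA
    simp at hAp
  | insert a U ha ih =>
    intro p h hh
    have haU : a ∉ U := fun h => (ha a h).false
    have key : ∀ A ⊆ U, A.card = p → koszulB x U h A + (-1) ^ A.card * (x a * h (insert a A)) = 0 := by
      intro A hA hAp
      rw [← koszulB_insert ha hA]
      exact hh _ (hA.trans (Finset.subset_insert _ _)) hAp
    obtain ⟨w1, hw1⟩ : ∃ w1 : Finset (Fin n) → R, ∀ A ⊆ U, A.card = p →
        koszulB x U w1 A = h (insert a A) := by
      rcases p with _ | q
      · have := key ∅ (by simp) (by simp)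
        have hm : h {a} ∈ Ideal.span (x '' U) := by
          refine hx a U haU _ ?_
          have e : x a * h {a} = - koszulB x U h ∅ := by
            simp at this
            linear_combination this
          rw [e]
          exact neg_mem (koszulB_mem _ _ _)
        obtain ⟨c, hc⟩ := exists_sum_of_mem_span_image hm
        refine ⟨fun A => ∑ v ∈ A, c v, fun A hA hA0 => ?_⟩
        obtain rfl := Finset.card_eq_zero.mp hA0
        simp [koszulB, incSign, hc]
      · refine ih q (fun B => h (insert a B)) fun A hA hAq => ?_
        rw [← koszulB_insert_insert ha]
        refine hh _ (Finset.insert_subset_insert _ hA) ?_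
        rw [Finset.card_insert_of_notMem (fun h => haU (hA h)), hAq]
    obtain ⟨w0, hw0⟩ := ih p (fun B => h B + (-1) ^ p * x a * w1 B) (by
      intro A hA hAp
      rw [koszulB_add, koszulB_const_mul, hw1 A hA hAp, ← key A hA hAp, hAp]
      ring)
    refine ⟨fun B => if a ∈ B then w1 (B.erase a) else w0 B, fun A hA hAq => ?_⟩
    by_cases haA : a ∈ A
    · obtain ⟨B, haB, rfl⟩ : ∃ B, a ∉ B ∧ A = insert a B :=
        ⟨A.erase a, by simp, (Finset.insert_erase haA).symm⟩
      have hB : B ⊆ U := (Finset.insert_subset_insert_iff haB).mp hA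
      have hBq : B.card = p := by
        rw [Finset.card_insert_of_notMem haB] at hAq; omega
      rw [koszulB_insert_insert ha, ← hw1 B hB hBq]
      refine koszulB_congr fun v hv => ?_
      simp only [Finset.mem_insert_self, if_true]
      rw [Finset.erase_insert]
      simp only [Finset.mem_insert, haB, or_false]
      rintro rfl
      exact haU (Finset.mem_sdiff.mp hv).1
    · have hAU : A ⊆ U := (Finset.subset_insert_iff_of_notMem haA).mp hA
      rw [koszulB_insert ha hAU, koszulB_congr (g' := w0), hw0 A hAU hAq, if_pos (by simp),
        Finset.erase_insert haA, hAq]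
      · ring
      · intro v hv
        refine if_neg ?_
        simp only [Finset.mem_insert, haA, or_false]
        rintro rfl
        exact haU (Finset.mem_sdiff.mp hv).1

end KoszulExact

section StronglyRegular

variable {n : ℕ} (K : Type) [Field K]

lemma isStronglyRegular_X_pow {t : ℕ} :
    IsStronglyRegular (fun v : Fin n => (X v : MvPolynomial (Fin n) K) ^ t) := by
  intro v U hv s hs
  have e : (fun v : Fin n => (X v : MvPolynomial (Fin n) K) ^ t) '' U =
      (fun a => monomial a (1 : K)) '' ((fun v => Finsupp.single v t) '' U) := by
    rw [Set.image_image]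
    refine Set.image_congr fun w _ => ?_
    rw [X_pow_eq_monomial]
  rw [e, mem_ideal_span_monomial_image] at hs ⊢
  intro a ha
  obtain ⟨_, ⟨w, hw, rfl⟩, h⟩ := hs (a + Finsupp.single v t) (by
    rw [mem_support_iff] at ha ⊢
    simp only [X_pow_eq_monomial]
    rwa [add_comm, coeff_monomial_mul, one_mul])
  refine ⟨_, ⟨w, hw, rfl⟩, ?_⟩
  have hwv : w ≠ v := by rintro rfl; exact hv hw
  have := h w
  simp only [Finsupp.single_eq_same, Finsupp.add_apply, Finsupp.single_eq_of_ne hwv, add_zero] at this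
  simpa using this

end StronglyRegular

section Complexes

variable {n : ℕ} {R : Type} [CommRing R] (x : Fin n → R)

/-- The total differential on chains indexed by pairs `(F, A)`. -/
def chainB (u : Finset (Fin n) → Finset (Fin n) → R) (F A : Finset (Fin n)) : R :=
  ∑ v ∈ Aᶜ, incSign v A •
    if v ∉ F then x v * u F (insert v A) else -u (F.erase v) (insert v A)

variable {x}

lemma chainB_eq (u : Finset (Fin n) → Finset (Fin n) → R) {F A : Finset (Fin n)}
    (h : Disjoint F A) :
    chainB x u F A = koszulB x Fᶜ (u F) A -
      ∑ v ∈ F, incSign v A • u (F.erase v) (insert v A) := by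
  have e : Aᶜ = (Fᶜ \ A) ∪ F := by
    ext v
    have : v ∈ F → v ∉ A := fun h' => Finset.disjoint_left.mp h h'
    simp only [Finset.mem_compl, Finset.mem_union, Finset.mem_sdiff]
    tauto
  rw [chainB, koszulB, e, Finset.sum_union, sub_eq_add_neg, ← Finset.sum_neg_distrib]
  · congr 1
    · refine Finset.sum_congr rfl fun v hv => ?_
      rw [if_pos (Finset.mem_compl.mp (Finset.mem_sdiff.mp hv).1)]
    · refine Finset.sum_congr rfl fun v hv => ?_
      rw [if_neg (by simpa using hv), smul_neg]
  · rw [Finset.disjoint_left]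
    intro v hv
    simpa using (Finset.mem_sdiff.mp hv).1

lemma chainB_sub (u w : Finset (Fin n) → Finset (Fin n) → R) (F A : Finset (Fin n)) :
    chainB x (fun F A => u F A - w F A) F A = chainB x u F A - chainB x w F A := by
  simp only [chainB, ← Finset.sum_sub_distrib, ← smul_sub]
  refine Finset.sum_congr rfl fun v _ => ?_
  split_ifs <;> ring_nf

lemma chainB_chainB (u : Finset (Fin n) → Finset (Fin n) → R) (F A : Finset (Fin n)) :
    chainB x (chainB x u) F A = 0 := by
  have e : chainB x (chainB x u) F A = ∑ v ∈ Aᶜ, ∑ w ∈ Aᶜ.erase v,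
      (incSign w (insert v A) * incSign v A) •
      (if v ∉ F then (if w ∉ F then x v * (x w * u F (insert w (insert v A)))
          else -(x v * u (F.erase w) (insert w (insert v A))))
        else (if w ∉ F then -(x w * u (F.erase v) (insert w (insert v A)))
          else u ((F.erase v).erase w) (insert w (insert v A)))) := by
    rw [chainB]
    refine Finset.sum_congr rfl fun v hv => ?_
    have hc : (insert v A)ᶜ = Aᶜ.erase v := by
      rw [Finset.compl_insert]
    by_cases hvF : v ∈ F
    · simp only [hvF, not_true_eq_false, if_false, chainB, hc, ← Finset.sum_neg_distrib,
        Finset.smul_sum]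
      refine Finset.sum_congr rfl fun w hw => ?_
      have : w ≠ v := (Finset.mem_erase.mp hw).1
      rw [mul_comm (incSign _ _), mul_smul]
      by_cases hwF : w ∈ F <;> simp [hwF, this]
    · simp only [hvF, not_false_eq_true, if_true, chainB, hc, Finset.mul_sum,
        Finset.smul_sum]
      refine Finset.sum_congr rfl fun w hw => ?_
      rw [mul_comm (incSign _ _), mul_smul, mul_smul_comm]
      by_cases hwF : w ∈ F <;> simp [hwF]
  rw [e]
  refine sum_sum_erase_eq_zero _ _ fun v hv w hw hvw => ?_
  rw [incSign_insert_swap hvw.symm (by simpa using hw) (by simpa using hv), neg_smul,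
    Finset.insert_comm w v]
  congr 2
  by_cases hvF : v ∈ F <;> by_cases hwF : w ∈ F <;> simp [hvF, hwF, Finset.erase_right_comm]
  ring

lemma exists_chainB_eq (hx : IsStronglyRegular x) (Δ : Finset (Finset (Fin n)))
    (hΔ : IsSimplicialComplex Δ) (p : ℕ) (m : ℕ) :
    ∀ u : Finset (Fin n) → Finset (Fin n) → R,
      (∀ F ∈ Δ, ∀ A, Disjoint F A → A.card = p → chainB x u F A = 0) →
      (∀ F ∈ Δ, F.card + m < n + 1 → ∀ A, Disjoint F A → A.card = p + 1 → u F A = 0) →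
      ∃ w : Finset (Fin n) → Finset (Fin n) → R,
        ∀ F ∈ Δ, ∀ A, Disjoint F A → A.card = p + 1 → chainB x w F A = u F A := by
  induction m with
  | zero =>
    intro u _ h
    refine ⟨fun _ _ => 0, fun F hF A hFA hA => ?_⟩
    rw [h F hF _ A hFA hA]
    · simp [chainB]
    · have := Finset.card_le_univ F
      simp at this; omega
  | succ m ih =>
    intro u hu h0
    have step : ∀ F : Finset (Fin n), ∃ w : Finset (Fin n) → R, F ∈ Δ → F.card + m = n →
        ∀ A ⊆ Fᶜ, A.card = p + 1 → koszulB x Fᶜ w A = u F A := by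
      intro F
      by_cases hF : F ∈ Δ ∧ F.card + m = n
      swap
      · exact ⟨0, fun h1 h2 => absurd ⟨h1, h2⟩ hF⟩
      obtain ⟨w, hw⟩ := exists_koszulB_eq hx Fᶜ p (u F) (fun A hA hAp => by
        have hd : Disjoint F A := by
          rw [Finset.disjoint_right]; exact fun v hv => Finset.mem_compl.mp (hA hv)
        have := hu F hF.1 A hd hAp
        rw [chainB_eq u hd, Finset.sum_eq_zero, sub_zero] at this
        · exact this
        intro v hv
        rw [h0 (F.erase v) (hΔ F hF.1 _ (Finset.erase_subset _ _)), smul_zero]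
        · have := Finset.card_erase_lt_of_mem hv
          omega
        · rw [Finset.disjoint_insert_right]
          exact ⟨by simp, hd.mono_left (Finset.erase_subset _ _)⟩
        · rw [Finset.card_insert_of_notMem (Finset.disjoint_left.mp hd hv), hAp])
      exact ⟨w, fun _ _ => hw⟩
    choose w hw using step
    let w' : Finset (Fin n) → Finset (Fin n) → R := fun F A => if F.card + m = n then w F A else 0
    have hw' : ∀ F ∈ Δ, F.card + m < n + 1 → ∀ A, Disjoint F A → A.card = p + 1 →
        chainB x w' F A = u F A := by
      intro F hF hFm A hd hA
      rw [chainB_eq _ hd, Finset.sum_eq_zero, sub_zero]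
      · rcases Nat.lt_or_ge (F.card + m) n with h | h
        · rw [h0 F hF (by omega) A hd hA]
          have : w' F = fun _ => 0 := by
            funext B; exact if_neg (by omega)
          rw [this]; simp [koszulB]
        · have : w' F = w F := by
            funext B; exact if_pos (by omega)
          rw [this]
          refine hw F hF (by omega) A ?_ hA
          intro v hv
          exact Finset.mem_compl.mpr (Finset.disjoint_right.mp hd hv)
      · intro v hv
        have := Finset.card_erase_lt_of_mem hv
        rw [show w' (F.erase v) (insert v A) = 0 from if_neg (by omega), smul_zero]
    obtain ⟨w2, hw2⟩ := ih (fun F A => u F A - chainB x w' F A)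
      (fun F hF A hd hA => by
        have := chainB_sub (x := x) u (chainB x w') F A
        rw [this, chainB_chainB, hu F hF A hd hA, sub_zero])
      (fun F hF hFm A hd hA => by
        simp only [hw' F hF hFm A hd hA, sub_self])
    refine ⟨fun F A => w2 F A - (-w' F A), fun F hF A hd hA => ?_⟩
    have h1 := chainB_sub (x := x) w2 (fun F A => - w' F A) F A
    have h2 := chainB_sub (x := x) (fun _ _ => 0) w' F A
    have h3 : chainB x (fun _ _ => 0) F A = 0 := by simp [chainB]
    simp only [zero_sub, h3] at h2
    rw [h1, h2, hw2 F hF A hd hA]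
    ring

variable (x)

/-- The total differential on cochains indexed by pairs `(F, A)` with values in a module. -/
def cochainD {Y : Type*} [AddCommGroup Y] [Module R Y] (g : Finset (Fin n) → Finset (Fin n) → Y)
    (F A : Finset (Fin n)) : Y :=
  ∑ v ∈ A, incSign v A • (x v • g F (A.erase v) - g (insert v F) (A.erase v))

variable {x}

lemma cochainD_cochainD {Y : Type*} [AddCommGroup Y] [Module R Y]
    (g : Finset (Fin n) → Finset (Fin n) → Y) (F A : Finset (Fin n)) :
    cochainD x (cochainD x g) F A = 0 := by
  have e : cochainD x (cochainD x g) F A = ∑ v ∈ A, ∑ w ∈ A.erase v,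
      (incSign v A * incSign w (A.erase v)) •
      (x v • x w • g F ((A.erase v).erase w) - x v • g (insert w F) ((A.erase v).erase w)
        - x w • g (insert v F) ((A.erase v).erase w)
        + g (insert w (insert v F)) ((A.erase v).erase w)) := by
    rw [cochainD]
    refine Finset.sum_congr rfl fun v hv => ?_
    simp only [cochainD, Finset.smul_sum, ← Finset.sum_sub_distrib]
    refine Finset.sum_congr rfl fun w hw => ?_
    rw [mul_smul, smul_comm (x v) (incSign w _), ← smul_sub, smul_sub (x v)]
    congr 2
    abel
  rw [e]
  refine sum_sum_erase_eq_zero _ _ fun v hv w hw hvw => ?_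
  rw [incSign_erase_swap hvw hv hw, neg_smul, Finset.erase_right_comm, smul_comm (x v) (x w),
    Finset.insert_comm w v]
  congr 2
  abel

lemma map_cochainD {Y Z : Type*} [AddCommGroup Y] [Module R Y] [AddCommGroup Z] [Module R Z]
    (f : Y →ₗ[R] Z) (g : Finset (Fin n) → Finset (Fin n) → Y) (F A : Finset (Fin n)) :
    f (cochainD x g F A) = cochainD x (fun F A => f (g F A)) F A := by
  simp [cochainD, map_sum, map_zsmul]

/-- Index set of the basis in degree `p`. -/
abbrev ResIdx (Δ : Finset (Finset (Fin n))) (p : ℕ) : Type :=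
  {q : Finset (Fin n) × Finset (Fin n) // q.1 ∈ Δ ∧ Disjoint q.1 q.2 ∧ q.2.card = p}

variable (R) in
/-- The basis elements, extended by zero. -/
noncomputable def resBasis (Δ : Finset (Finset (Fin n))) (p : ℕ) (F A : Finset (Fin n)) :
    ResIdx Δ p →₀ R :=
  if h : F ∈ Δ ∧ Disjoint F A ∧ A.card = p then Finsupp.single ⟨(F, A), h⟩ 1 else 0

variable (x) in
/-- The differential of the resolution. -/
noncomputable def resD (Δ : Finset (Finset (Fin n))) (p : ℕ) :
    (ResIdx Δ (p + 1) →₀ R) →ₗ[R] (ResIdx Δ p →₀ R) :=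
  Finsupp.linearCombination R fun q => cochainD x (resBasis R Δ p) q.1.1 q.1.2

lemma resBasis_of {Δ : Finset (Finset (Fin n))} {p : ℕ} (q : ResIdx Δ p) :
    resBasis R Δ p q.1.1 q.1.2 = Finsupp.single q 1 := dif_pos q.2

lemma resBasis_of_notMem {Δ : Finset (Finset (Fin n))} {p : ℕ} {F A : Finset (Fin n)}
    (h : F ∉ Δ) : resBasis R Δ p F A = 0 := dif_neg fun h' => h h'.1

lemma cochainD_eq_zero_of_notMem {Y : Type*} [AddCommGroup Y] [Module R Y]
    {Δ : Finset (Finset (Fin n))} (hΔ : IsSimplicialComplex Δ)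
    {g : Finset (Fin n) → Finset (Fin n) → Y} (hg : ∀ F ∉ Δ, ∀ A, g F A = 0)
    {F : Finset (Fin n)} (hF : F ∉ Δ) (A : Finset (Fin n)) : cochainD x g F A = 0 := by
  refine Finset.sum_eq_zero fun v _ => ?_
  rw [hg F hF, hg _ (fun h => hF (hΔ _ h _ (Finset.subset_insert _ _)))]
  simp

lemma resD_single {Δ : Finset (Finset (Fin n))} {p : ℕ} (q : ResIdx Δ (p + 1)) :
    resD x Δ p (Finsupp.single q 1) = cochainD x (resBasis R Δ p) q.1.1 q.1.2 := by
  simp [resD]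

lemma resD_resBasis {Δ : Finset (Finset (Fin n))} (hΔ : IsSimplicialComplex Δ) {p : ℕ}
    {F A : Finset (Fin n)} (hd : Disjoint F A) (hA : A.card = p + 1) :
    resD x Δ p (resBasis R Δ (p + 1) F A) = cochainD x (resBasis R Δ p) F A := by
  by_cases hF : F ∈ Δ
  · rw [resBasis, dif_pos ⟨hF, hd, hA⟩, resD_single]
  · rw [resBasis_of_notMem hF, map_zero,
      cochainD_eq_zero_of_notMem hΔ (fun F hF A => resBasis_of_notMem hF) hF]

lemma cochainD_congr {Y : Type*} [AddCommGroup Y] [Module R Y]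
    {g g' : Finset (Fin n) → Finset (Fin n) → Y} {F A : Finset (Fin n)} (hd : Disjoint F A)
    (h : ∀ G B, Disjoint G B → B.card + 1 = A.card → g G B = g' G B) :
    cochainD x g F A = cochainD x g' F A := by
  refine Finset.sum_congr rfl fun v hv => ?_
  have hc : (A.erase v).card + 1 = A.card := Finset.card_erase_add_one hv
  have hd' : Disjoint F (A.erase v) := hd.mono_right (Finset.erase_subset _ _)
  rw [h _ _ hd' hc, h _ _ (Finset.disjoint_insert_left.mpr ⟨by simp, hd'⟩) hc]

lemma resD_comp {Δ : Finset (Finset (Fin n))} (hΔ : IsSimplicialComplex Δ) (p : ℕ) :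
    resD x Δ p ∘ₗ resD x Δ (p + 1) = 0 := by
  refine Finsupp.lhom_ext' fun q => LinearMap.ext_ring ?_
  simp only [LinearMap.comp_apply, Finsupp.lsingle_apply, LinearMap.zero_apply]
  rw [resD_single, map_cochainD, ← cochainD_cochainD (x := x) (resBasis R Δ p) q.1.1 q.1.2]
  refine cochainD_congr q.2.2.1 fun G B hd hB => ?_
  rw [q.2.2.2] at hB
  exact resD_resBasis hΔ hd (by omega)

/-- Extension by zero of a chain. -/
noncomputable def resExt {Δ : Finset (Finset (Fin n))} {p : ℕ} (u : ResIdx Δ p →₀ R)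
    (F A : Finset (Fin n)) : R :=
  if h : F ∈ Δ ∧ Disjoint F A ∧ A.card = p then u ⟨(F, A), h⟩ else 0

lemma resBasis_apply {Δ : Finset (Finset (Fin n))} {p : ℕ} (F A : Finset (Fin n))
    (q : ResIdx Δ p) : resBasis R Δ p F A q = if q.1.1 = F ∧ q.1.2 = A then 1 else 0 := by
  obtain ⟨⟨G, B⟩, hq⟩ := q
  by_cases h : F ∈ Δ ∧ Disjoint F A ∧ A.card = p
  · rw [resBasis, dif_pos h, Finsupp.single_apply]
    simp only [Subtype.mk.injEq, Prod.mk.injEq]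
    exact if_congr ⟨fun h => ⟨h.1.symm, h.2.symm⟩, fun h => ⟨h.1.symm, h.2.symm⟩⟩ rfl rfl
  · rw [resBasis, dif_neg h, if_neg]
    · rfl
    · rintro ⟨rfl, rfl⟩; exact h hq

lemma resExt_single {Δ : Finset (Finset (Fin n))} {p : ℕ} (F A : Finset (Fin n))
    (q : ResIdx Δ p) (a : R) :
    resExt (Finsupp.single q a) F A = if q.1.1 = F ∧ q.1.2 = A then a else 0 := by
  obtain ⟨⟨G, B⟩, hq⟩ := q
  by_cases h : F ∈ Δ ∧ Disjoint F A ∧ A.card = p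
  · rw [resExt, dif_pos h, Finsupp.single_apply]
    simp only [Subtype.mk.injEq, Prod.mk.injEq]
  · rw [resExt, dif_neg h, if_neg]
    rintro ⟨rfl, rfl⟩; exact h hq

lemma resD_apply {Δ : Finset (Finset (Fin n))} {p : ℕ}
    (u : ResIdx Δ (p + 1) →₀ R) (q : ResIdx Δ p) :
    resD x Δ p u q = chainB x (resExt u) q.1.1 q.1.2 := by
  induction u using Finsupp.induction_linear with
  | zero => simp [resExt, chainB]
  | add u w hu hw =>
    rw [map_add, Finsupp.add_apply, hu, hw]
    simp only [chainB, ← Finset.sum_add_distrib, ← smul_add]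
    have e : ∀ F A, resExt (u + w) F A = resExt u F A + resExt w F A := by
      intro F A
      simp only [resExt]
      split_ifs <;> simp
    refine Finset.sum_congr rfl fun v _ => ?_
    split_ifs
    · rw [e, neg_add]
    · rw [e, mul_add]
  | single r a =>
    obtain ⟨⟨G, B⟩, hG, hGB, hB⟩ := r
    obtain ⟨⟨F, A⟩, hF, hFA, hA⟩ := q
    simp only [resD, Finsupp.linearCombination_single, cochainD, chainB, Finsupp.smul_apply,
      Finsupp.finsetSum_apply, Finsupp.sub_apply, resBasis_apply, resExt_single]
    rw [smul_eq_mul, Finset.mul_sum]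
    have e (s : Finset (Fin n)) (f : Fin n → R) :
        ∑ v ∈ s, f v = ∑ v, if v ∈ s then f v else 0 := by simp [Finset.sum_ite_mem]
    refine (e B _).trans (Eq.trans ?_ (e Aᶜ _).symm)
    refine Finset.sum_congr rfl fun v _ => ?_
    have d1 : v ∈ G → v ∉ B := fun h => Finset.disjoint_left.mp hGB h
    have d2 : v ∈ F → v ∉ A := fun h => Finset.disjoint_left.mp hFA h
    by_cases hvB : v ∈ B
    · by_cases hvA : v ∈ A
      · have h1 : A ≠ B.erase v := by rintro rfl; simp at hvA
        simp [hvA, h1]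
      · have hs : A = B.erase v ↔ B = insert v A := by
          constructor
          · rintro rfl; rw [Finset.insert_erase hvB]
          · rintro rfl; rw [Finset.erase_insert hvA]
        by_cases hBA : B = insert v A
        swap
        · simp [hvB, hvA, hs, hBA]
        have hs' : incSign v B = incSign v A := by rw [hBA, incSign_insert_self]
        by_cases hvF : v ∈ F
        · have h1 : F ≠ G := by rintro rfl; exact d1 hvF hvB
          have h2 : F = insert v G ↔ G = F.erase v := by
            constructor
            · rintro rfl; rw [Finset.erase_insert (fun h => d1 h hvB)]
            · rintro rfl; rw [Finset.insert_erase hvF]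
          simp only [hvB, hvA, hs, ← hBA, hvF, h1, h2, hs', Finset.mem_compl, not_true_eq_false,
            not_false_eq_true, if_true, if_false, and_true, smul_zero, zero_sub]
          split_ifs
          · simp [mul_comm]
          · simp
        · have h1 : F ≠ insert v G := by rintro rfl; simp at hvF
          have h2 : F = G ↔ G = F := eq_comm
          simp only [hvB, hvA, hs, ← hBA, hvF, h1, h2, hs', Finset.mem_compl,
            not_false_eq_true, if_true, if_false, and_true, sub_zero]
          split_ifs
          · simp only [smul_eq_mul, zsmul_eq_mul]; ring
          · simp
    · by_cases hvA : v ∈ A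
      · simp [hvB, hvA]
      · have h1 : B ≠ insert v A := by rintro rfl; simp at hvB
        simp [hvB, hvA, h1]

lemma resExt_of {Δ : Finset (Finset (Fin n))} {p : ℕ} (u : ResIdx Δ p →₀ R) (q : ResIdx Δ p) :
    resExt u q.1.1 q.1.2 = u q := dif_pos q.2

lemma resD_exact (hx : IsStronglyRegular x) {Δ : Finset (Finset (Fin n))}
    (hΔ : IsSimplicialComplex Δ) (p : ℕ) (u : ResIdx Δ (p + 1) →₀ R) (hu : resD x Δ p u = 0) :
    ∃ w, resD x Δ (p + 1) w = u := by
  obtain ⟨w, hw⟩ := exists_chainB_eq hx Δ hΔ p (n + 1) (resExt u)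
    (fun F hF A hd hA => by
      rw [← resD_apply u ⟨(F, A), hF, hd, hA⟩, hu]; rfl)
    (fun F hF h => absurd h (by omega))
  refine ⟨Finsupp.equivFunOnFinite.symm fun q => w q.1.1 q.1.2, Finsupp.ext fun q => ?_⟩
  obtain ⟨⟨F, A⟩, hF, hd, hA⟩ := q
  have e : ∀ G B, G ∈ Δ → Disjoint G B → B.card = p + 1 + 1 →
      resExt (Finsupp.equivFunOnFinite.symm fun q : ResIdx Δ (p + 1 + 1) => w q.1.1 q.1.2) G B =
        w G B := fun G B h1 h2 h3 => dif_pos ⟨h1, h2, h3⟩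
  rw [resD_apply, ← resExt_of, ← hw F hF A hd hA]
  refine Finset.sum_congr rfl fun v hv => ?_
  have hvA : v ∉ A := Finset.mem_compl.mp hv
  have hc : (insert v A).card = p + 1 + 1 := by rw [Finset.card_insert_of_notMem hvA, hA]
  split_ifs with hvF
  · rw [e _ _ (hΔ F hF _ (Finset.erase_subset _ _)) ?_ hc]
    exact Finset.disjoint_insert_right.mpr ⟨by simp, hd.mono_left (Finset.erase_subset _ _)⟩
  · rw [e _ _ hF (Finset.disjoint_insert_right.mpr ⟨hvF, hd⟩) hc]

variable (x) in
/-- The ideal generated by the products of `x` over nonfaces. -/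
def faceIdeal (Δ : Finset (Finset (Fin n))) : Ideal R :=
  Ideal.span {m | ∃ F : Finset (Fin n), F ∉ Δ ∧ m = ∏ i ∈ F, x i}

variable (x) in
/-- The augmentation of the resolution. -/
noncomputable def resAug (Δ : Finset (Finset (Fin n))) :
    (ResIdx Δ 0 →₀ R) →ₗ[R] R ⧸ faceIdeal x Δ :=
  Finsupp.linearCombination R fun q => Ideal.Quotient.mk _ (∏ i ∈ q.1.1, x i)

lemma resAug_resBasis (Δ : Finset (Finset (Fin n))) (F : Finset (Fin n)) :
    resAug x Δ (resBasis R Δ 0 F ∅) = Ideal.Quotient.mk _ (∏ i ∈ F, x i) := by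
  by_cases h : F ∈ Δ
  · rw [resBasis, dif_pos ⟨h, by simp⟩]
    simp [resAug]
  · rw [resBasis_of_notMem h, map_zero, eq_comm, Ideal.Quotient.eq_zero_iff_mem]
    exact Ideal.subset_span ⟨F, h, rfl⟩

lemma resAug_surjective (Δ : Finset (Finset (Fin n))) : Function.Surjective (resAug x Δ) := by
  intro y
  obtain ⟨r, rfl⟩ := Ideal.Quotient.mk_surjective y
  refine ⟨r • resBasis R Δ 0 ∅ ∅, ?_⟩
  rw [map_smul, resAug_resBasis, Finset.prod_empty, Algebra.smul_def, map_one, mul_one]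
  rfl

lemma cochainD_singleton {Y : Type*} [AddCommGroup Y] [Module R Y]
    (g : Finset (Fin n) → Finset (Fin n) → Y) (F : Finset (Fin n)) (v : Fin n) :
    cochainD x g F {v} = x v • g F ∅ - g (insert v F) ∅ := by
  simp [cochainD, incSign, Finset.filter_singleton]

lemma resAug_comp (Δ : Finset (Finset (Fin n))) : resAug x Δ ∘ₗ resD x Δ 0 = 0 := by
  refine Finsupp.lhom_ext' fun q => LinearMap.ext_ring ?_
  obtain ⟨⟨F, A⟩, hF, hd, hA⟩ := q
  simp only [LinearMap.comp_apply, Finsupp.lsingle_apply, LinearMap.zero_apply]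
  obtain ⟨v, rfl⟩ := Finset.card_eq_one.mp hA
  rw [resD_single, map_cochainD, cochainD_singleton, resAug_resBasis, resAug_resBasis,
    Finset.prod_insert (by simpa using hd), Algebra.smul_def]
  exact sub_eq_zero.mpr (map_mul _ _ _).symm

lemma resAug_exact {Δ : Finset (Finset (Fin n))} (hΔ : IsSimplicialComplex Δ)
    (u : ResIdx Δ 0 →₀ R) (hu : resAug x Δ u = 0) :
    ∃ w, resD x Δ 0 w = u := by
  change u ∈ LinearMap.range (resD x Δ 0)
  set N := LinearMap.range (resD x Δ 0)
  have h1 : ∀ F, N.mkQ (resBasis R Δ 0 F ∅) = (∏ i ∈ F, x i) • N.mkQ (resBasis R Δ 0 ∅ ∅) := by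
    intro F
    induction F using Finset.induction_on with
    | empty => simp
    | insert v F hv ih =>
      rw [Finset.prod_insert hv, mul_smul, ← ih, ← map_smul, ← sub_eq_zero, ← map_sub,
        ← LinearMap.mem_ker, Submodule.ker_mkQ, ← neg_mem_iff, neg_sub,
        ← cochainD_singleton (x := x), ← resD_resBasis hΔ (by simpa using hv) (by simp)]
      exact LinearMap.mem_range_self _ _
  have h2 : faceIdeal x Δ ≤ LinearMap.ker (LinearMap.toSpanSingleton R _
      (N.mkQ (resBasis R Δ 0 ∅ ∅))) := by
    refine Ideal.span_le.mpr ?_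
    rintro _ ⟨F, hF, rfl⟩
    rw [SetLike.mem_coe, LinearMap.mem_ker, LinearMap.toSpanSingleton_apply, ← h1,
      resBasis_of_notMem hF, map_zero]
  have h3 : N.mkQ = (Submodule.liftQ (faceIdeal x Δ) _ h2) ∘ₗ resAug x Δ := by
    refine Finsupp.lhom_ext' fun q => LinearMap.ext_ring ?_
    obtain ⟨⟨F, A⟩, hF, hd, hA⟩ := q
    obtain rfl := Finset.card_eq_zero.mp hA
    have e : Finsupp.single (⟨(F, ∅), hF, hd, hA⟩ : ResIdx Δ 0) (1 : R) = resBasis R Δ 0 F ∅ :=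
      (resBasis_of (⟨(F, ∅), hF, hd, hA⟩ : ResIdx Δ 0)).symm
    simp only [LinearMap.comp_apply, Finsupp.lsingle_apply]
    rw [e, h1, resAug_resBasis]
    exact (Submodule.liftQ_apply (faceIdeal x Δ) _ (h := h2) _).symm
  rw [← Submodule.ker_mkQ N, LinearMap.mem_ker, h3, LinearMap.comp_apply, hu, map_zero]

end Complexes

section ExtRepresentatives

variable {R : Type} [CommRing R]

/-- The contravariant functor `Hom(-, Y)` as a functor to the opposite category. -/
noncomputable abbrev homOp (Y : ModuleCat.{0} R) : ModuleCat.{0} R ⥤ (ModuleCat.{0} R)ᵒᵖ :=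
  ((linearYoneda R (ModuleCat.{0} R)).obj Y).rightOp

variable {X : ModuleCat.{0} R} (P : ProjectiveResolution X) (Y : ModuleCat.{0} R) (i : ℕ)

/-- The complex `Hom(P, Y)`, as a chain complex in the opposite category. -/
noncomputable abbrev homOpComplex : ChainComplex (ModuleCat.{0} R)ᵒᵖ ℕ :=
  ((homOp Y).mapHomologicalComplex _).obj P.complex

/-- The module of cocycles. -/
noncomputable abbrev cocycles : ModuleCat.{0} R := ((homOpComplex P Y).opcycles i).unop

/-- The inclusion of cocycles into cochains. -/
noncomputable def cocyclesι : cocycles P Y i →ₗ[R] (P.complex.X i ⟶ Y) :=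
  ((homOpComplex P Y).pOpcycles i).unop.hom

/-- The projection from cocycles to `Ext`. -/
noncomputable def cocyclesToExt :
    cocycles P Y i →ₗ[R] ((Ext R (ModuleCat.{0} R) i).obj (op X)).obj Y :=
  (((homOpComplex P Y).homologyι i).unop ≫ (P.isoLeftDerivedObj (homOp Y) i).hom.unop).hom

lemma cocyclesι_injective : Function.Injective (cocyclesι P Y i) := by
  have : Mono ((homOpComplex P Y).pOpcycles i).unop := inferInstance
  exact (ModuleCat.mono_iff_injective _).mp this

lemma cocyclesToExt_surjective : Function.Surjective (cocyclesToExt P Y i) := by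
  have : Epi (((homOpComplex P Y).homologyι i).unop ≫
    (P.isoLeftDerivedObj (homOp Y) i).hom.unop) := by
    have h1 : Epi ((homOpComplex P Y).homologyι i).unop := unop_epi_of_mono _
    have h2 : Epi (P.isoLeftDerivedObj (homOp Y) i).hom.unop := unop_epi_of_mono _
    exact epi_comp' h1 h2
  exact (ModuleCat.epi_iff_surjective _).mp this

lemma mem_range_cocyclesι (f : P.complex.X i ⟶ Y) :
    f ∈ LinearMap.range (cocyclesι P Y i) ↔ P.complex.d (i + 1) i ≫ f = 0 := by
  have h := ShortComplex.exact_of_g_is_cokernel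
    (ShortComplex.mk ((homOpComplex P Y).d (i + 1) i) ((homOpComplex P Y).pOpcycles i)
      ((homOpComplex P Y).d_pOpcycles _ _))
    ((homOpComplex P Y).opcyclesIsCokernel (i + 1) i (by simp))
  have h2 := (ShortComplex.moduleCat_exact_iff_range_eq_ker _).mp h.unop
  exact (congrArg (f ∈ ·) h2).to_iff

lemma cocyclesToExt_eq_zero (z : cocycles P Y i) :
    cocyclesToExt P Y i z = 0 ↔ ∃ w : P.complex.X ((ComplexShape.down ℕ).next i) ⟶ Y,
      P.complex.d i _ ≫ w = cocyclesι P Y i z := by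
  have h := ShortComplex.exact_of_f_is_kernel
    (ShortComplex.mk ((homOpComplex P Y).homologyι i) ((homOpComplex P Y).fromOpcycles i _)
      ((homOpComplex P Y).homologyι_comp_fromOpcycles _ _))
    ((homOpComplex P Y).homologyIsKernel i _ rfl)
  have h2 := (ShortComplex.moduleCat_exact_iff_range_eq_ker _).mp h.unop
  have h3 : cocyclesToExt P Y i z = 0 ↔ ((homOpComplex P Y).homologyι i).unop z = 0 := by
    have : Mono (P.isoLeftDerivedObj (homOp Y) i).hom.unop := inferInstance
    exact map_eq_zero_iff (P.isoLeftDerivedObj (homOp Y) i).hom.unop.hom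
      ((ModuleCat.mono_iff_injective _).mp this)
  have h4 : z ∈ LinearMap.range ((homOpComplex P Y).fromOpcycles i
      ((ComplexShape.down ℕ).next i)).unop.hom ↔ ((homOpComplex P Y).homologyι i).unop z = 0 :=
    (congrArg (z ∈ ·) h2).to_iff
  rw [h3, ← h4]
  have h5 : ∀ w : P.complex.X ((ComplexShape.down ℕ).next i) ⟶ Y,
      cocyclesι P Y i (((homOpComplex P Y).fromOpcycles i _).unop.hom w) = P.complex.d i _ ≫ w := by
    intro w
    have := congrArg (fun φ => φ.unop.hom w) ((homOpComplex P Y).p_fromOpcycles i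
      ((ComplexShape.down ℕ).next i))
    exact this
  constructor
  · rintro ⟨w, rfl⟩
    exact ⟨w, (h5 w).symm⟩
  · rintro ⟨w, hw⟩
    exact ⟨w, cocyclesι_injective P Y i ((h5 w).trans hw)⟩

variable {P Y i} in
/-- The cochain `f` is a cocycle representing the class `e`. -/
def Represents (f : P.complex.X i ⟶ Y) (e : ((Ext R (ModuleCat.{0} R) i).obj (op X)).obj Y) :
    Prop :=
  ∃ z, cocyclesι P Y i z = f ∧ cocyclesToExt P Y i z = e

variable {P Y i}

lemma exists_represents (f : P.complex.X i ⟶ Y) (hf : P.complex.d (i + 1) i ≫ f = 0) :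
    ∃ e, Represents f e := by
  obtain ⟨z, hz⟩ := (mem_range_cocyclesι P Y i f).mpr hf
  exact ⟨_, z, hz, rfl⟩

lemma exists_represents' (e : ((Ext R (ModuleCat.{0} R) i).obj (op X)).obj Y) :
    ∃ f : P.complex.X i ⟶ Y, Represents f e := by
  obtain ⟨z, hz⟩ := cocyclesToExt_surjective P Y i e
  exact ⟨_, z, rfl, hz⟩

lemma Represents.unique {f : P.complex.X i ⟶ Y} {e e'} (h : Represents f e)
    (h' : Represents f e') : e = e' := by
  obtain ⟨z, hz, rfl⟩ := h
  obtain ⟨z', hz', rfl⟩ := h'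
  rw [cocyclesι_injective P Y i (hz.trans hz'.symm)]

lemma Represents.smul {f : P.complex.X i ⟶ Y} {e} (h : Represents f e) (r : R) :
    Represents (r • f) (r • e) := by
  obtain ⟨z, rfl, rfl⟩ := h
  exact ⟨r • z, map_smul _ _ _, map_smul _ _ _⟩

lemma represents_zero : Represents (0 : P.complex.X i ⟶ Y) 0 := ⟨0, map_zero _, map_zero _⟩

lemma Represents.eq_zero_iff {f : P.complex.X i ⟶ Y} {e} (h : Represents f e) :
    e = 0 ↔ ∃ w : P.complex.X ((ComplexShape.down ℕ).next i) ⟶ Y, P.complex.d i _ ≫ w = f := by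
  obtain ⟨z, rfl, rfl⟩ := h
  exact cocyclesToExt_eq_zero P Y i z

lemma Represents.map {X' : ModuleCat.{0} R} {Q : ProjectiveResolution X'} {f : P.complex.X i ⟶ Y}
    {e} (h : Represents f e) (a : X' ⟶ X) (φ : Q.complex ⟶ P.complex)
    (hφ : φ.f 0 ≫ P.π.f 0 = Q.π.f 0 ≫ ((ChainComplex.single₀ (ModuleCat R)).map a).f 0) :
    Represents (φ.f i ≫ f) (((Ext R (ModuleCat.{0} R) i).map a.op).app Y e) := by
  obtain ⟨z, rfl, rfl⟩ := h
  let ψ := ((homOp Y).mapHomologicalComplex _).map φ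
  refine ⟨(HomologicalComplex.opcyclesMap ψ i).unop z, ?_, ?_⟩
  · have := congrArg (fun φ => φ.unop.hom z) (HomologicalComplex.p_opcyclesMap ψ i)
    exact this
  · have h1 := congrArg (fun φ => φ.unop.hom z) (HomologicalComplex.homologyι_naturality ψ i)
    have h2 := ProjectiveResolution.isoLeftDerivedObj_hom_naturality a Q P φ hφ (homOp Y) i
    have h3 := congrArg (fun φ => φ.unop.hom (((homOpComplex P Y).homologyι i).unop z)) h2
    refine Eq.trans ?_ h3.symm
    change (Q.isoLeftDerivedObj (homOp Y) i).hom.unop _ = (Q.isoLeftDerivedObj (homOp Y) i).hom.unop _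
    congr 1
    exact h1.symm

/-- Computing an `Ext` module from a description of cocycles modulo coboundaries. -/
lemma nonempty_ext_equiv {V : Type} [AddCommGroup V] [Module R V] (W : Submodule R V)
    (Φ : (P.complex.X i ⟶ Y) →ₗ[R] V)
    (hW : ∀ w, w ∈ W ↔ ∃ f : P.complex.X i ⟶ Y, P.complex.d (i + 1) i ≫ f = 0 ∧ Φ f = w)
    (hk : ∀ f : P.complex.X i ⟶ Y, P.complex.d (i + 1) i ≫ f = 0 → (Φ f = 0 ↔
      ∃ w : P.complex.X ((ComplexShape.down ℕ).next i) ⟶ Y, P.complex.d i _ ≫ w = f)) :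
    Nonempty (((Ext R (ModuleCat.{0} R) i).obj (op X)).obj Y ≃ₗ[R] W) := by
  have e1 := (cocyclesToExt P Y i).quotKerEquivOfSurjective (cocyclesToExt_surjective P Y i)
  have e2 := (Φ ∘ₗ cocyclesι P Y i).quotKerEquivRange
  have e3 : LinearMap.range (Φ ∘ₗ cocyclesι P Y i) = W := by
    ext w
    rw [hW, LinearMap.mem_range]
    constructor
    · rintro ⟨z, rfl⟩
      exact ⟨_, (mem_range_cocyclesι P Y i _).mp ⟨z, rfl⟩, rfl⟩
    · rintro ⟨f, hf, rfl⟩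
      obtain ⟨z, rfl⟩ := (mem_range_cocyclesι P Y i f).mpr hf
      exact ⟨z, rfl⟩
  refine ⟨e1.symm ≪≫ₗ Submodule.quotEquivOfEq _ _ ?_ ≪≫ₗ e2 ≪≫ₗ LinearEquiv.ofEq _ _ e3⟩
  ext z
  rw [LinearMap.mem_ker, LinearMap.mem_ker, cocyclesToExt_eq_zero, LinearMap.comp_apply, hk]
  exact (mem_range_cocyclesι P Y i _).mp ⟨z, rfl⟩

/-- Scalars killing `X` kill `Ext(X, Y)`. -/
lemma ext_smul_eq_zero (r : R) (hr : ∀ m : X, r • m = 0)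
    (e : ((Ext R (ModuleCat.{0} R) i).obj (op X)).obj Y) : r • e = 0 := by
  let P := ProjectiveResolution.of X
  obtain ⟨f, hf⟩ := exists_represents' (P := P) e
  have h1 := hf.map (Q := P) 0 (r • 𝟙 P.complex) (by
    rw [HomologicalComplex.smul_f_apply, HomologicalComplex.id_f, Linear.smul_comp,
      Category.id_comp, ChainComplex.single₀_map_f_zero]
    refine Eq.trans ?_ (Limits.comp_zero (f := P.π.f 0)).symm
    ext m
    exact hr _)
  have h2 := hf.map (Q := P) 0 (0 : P.complex ⟶ P.complex) (by
    rw [HomologicalComplex.zero_f, ChainComplex.single₀_map_f_zero]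
    exact Limits.zero_comp.trans (Limits.comp_zero (f := P.π.f 0)).symm)
  have h3 := hf.smul r
  have h4 : (r • 𝟙 P.complex : P.complex ⟶ P.complex).f i ≫ f = r • f := by
    simp
  rw [h4] at h1
  rw [h3.unique h1]
  refine h2.unique ?_
  simpa using represents_zero

end ExtRepresentatives

section Resolution

variable {n : ℕ} {R : Type} [CommRing R] (x : Fin n → R) {Δ : Finset (Finset (Fin n))}

/-- The complex of free modules with differentials `resD`. -/
noncomputable def resComplex (hΔ : IsSimplicialComplex Δ) : ChainComplex (ModuleCat.{0} R) ℕ :=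
  ChainComplex.of (fun p => ModuleCat.of R (ResIdx Δ p →₀ R))
    (fun p => ModuleCat.ofHom (resD x Δ p)) (fun p => by
      rw [← ModuleCat.ofHom_comp, resD_comp hΔ]; rfl)

lemma resComplex_d (hΔ : IsSimplicialComplex Δ) (p : ℕ) :
    (resComplex x hΔ).d (p + 1) p = ModuleCat.ofHom (resD x Δ p) :=
  ChainComplex.of_d (fun p => ModuleCat.of R (ResIdx Δ p →₀ R))
    (fun p => ModuleCat.ofHom (resD x Δ p)) p

variable {x}

lemma resComplex_exactAt (hx : IsStronglyRegular x) (hΔ : IsSimplicialComplex Δ) (p : ℕ) :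
    (resComplex x hΔ).ExactAt (p + 1) := by
  rw [HomologicalComplex.exactAt_iff' _ (p + 1 + 1) (p + 1) p (by simp) (by simp),
    ShortComplex.moduleCat_exact_iff]
  intro u hu
  change (resComplex x hΔ).d (p + 1) p u = 0 at hu
  change ∃ w, (resComplex x hΔ).d (p + 1 + 1) (p + 1) w = u
  rw [resComplex_d] at hu ⊢
  exact resD_exact hx hΔ p u hu

variable (x) in
/-- The augmentation, as a morphism out of the complex. -/
noncomputable def resAugHom (hΔ : IsSimplicialComplex Δ) :
    (resComplex x hΔ).X 0 ⟶ ModuleCat.of R (R ⧸ faceIdeal x Δ) :=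
  ModuleCat.ofHom (resAug x Δ)

variable (x) in
lemma d_resAugHom (hΔ : IsSimplicialComplex Δ) :
    (resComplex x hΔ).d 1 0 ≫ resAugHom x hΔ = 0 := by
  rw [resComplex_d]
  ext1
  exact resAug_comp Δ

/-- The free resolution of the quotient by the face ideal. -/
noncomputable def resolution (hx : IsStronglyRegular x) (hΔ : IsSimplicialComplex Δ) :
    ProjectiveResolution (ModuleCat.of R (R ⧸ faceIdeal x Δ)) where
  complex := resComplex x hΔ
  projective p := by
    change Projective (ModuleCat.of R (ResIdx Δ p →₀ R))
    infer_instance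
  π := (ChainComplex.toSingle₀Equiv _ _).symm ⟨resAugHom x hΔ, d_resAugHom x hΔ⟩
  quasiIso := ⟨fun p => by
    cases p
    · rw [ChainComplex.quasiIsoAt₀_iff, ShortComplex.quasiIso_iff_of_zeros']
      · refine (ShortComplex.exact_and_epi_g_iff_of_iso (S₁ := ShortComplex.mk
          ((resComplex x hΔ).d 1 0) (resAugHom x hΔ) (d_resAugHom x hΔ)) ?_).1 ⟨?_, ?_⟩
        · exact ShortComplex.isoMk (Iso.refl _) (Iso.refl _) (Iso.refl _)
            ((Category.id_comp _).trans (Category.comp_id _).symm)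
            ((Category.id_comp _).trans (Category.comp_id _).symm)
        · rw [ShortComplex.moduleCat_exact_iff]
          intro u hu
          change ∃ w, (resComplex x hΔ).d 1 0 w = u
          rw [resComplex_d]
          exact resAug_exact hΔ u hu
        · exact (ModuleCat.epi_iff_surjective _).mpr (resAug_surjective Δ)
      all_goals rfl
    · rw [quasiIsoAt_iff_exactAt']
      · apply resComplex_exactAt hx
      · apply ChainComplex.exactAt_succ_single_obj⟩

variable {Y : ModuleCat.{0} R}

/-- The homomorphism out of the resolution attached to a cochain. -/
noncomputable def homOf (hΔ : IsSimplicialComplex Δ) (p : ℕ)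
    (g : Finset (Fin n) → Finset (Fin n) → Y) : (resComplex x hΔ).X p ⟶ Y :=
  ModuleCat.ofHom (Y := Y) (Finsupp.linearCombination R fun q : ResIdx Δ p => g q.1.1 q.1.2)

variable {hΔ : IsSimplicialComplex Δ} {p : ℕ}

lemma homOf_resBasis {g : Finset (Fin n) → Finset (Fin n) → Y} (hg : ∀ F ∉ Δ, ∀ A, g F A = 0)
    {F A : Finset (Fin n)} (hd : Disjoint F A) (hA : A.card = p) :
    (homOf (x := x) hΔ p g).hom (resBasis R Δ p F A) = g F A := by
  by_cases hF : F ∈ Δ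
  · rw [resBasis, dif_pos ⟨hF, hd, hA⟩]
    exact (Finsupp.linearCombination_single _ _ _).trans (one_smul _ _)
  · rw [resBasis_of_notMem hF, hg F hF]
    exact map_zero _

lemma hom_ext_resBasis {f f' : (resComplex x hΔ).X p ⟶ Y}
    (h : ∀ F ∈ Δ, ∀ A, Disjoint F A → A.card = p →
      f.hom (resBasis R Δ p F A) = f'.hom (resBasis R Δ p F A)) : f = f' := by
  ext1
  refine Finsupp.lhom_ext' fun q => LinearMap.ext_ring ?_
  have := h _ q.2.1 _ q.2.2.1 q.2.2.2
  rw [resBasis_of] at this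
  exact this

lemma exists_homOf (f : (resComplex x hΔ).X p ⟶ Y) :
    ∃ g : Finset (Fin n) → Finset (Fin n) → Y, (∀ F ∉ Δ, ∀ A, g F A = 0) ∧ homOf hΔ p g = f := by
  have h0 : ∀ F ∉ Δ, ∀ A, f.hom (resBasis R Δ p F A) = 0 := fun F hF A => by
    rw [resBasis_of_notMem hF]; exact map_zero _
  exact ⟨fun F A => f.hom (resBasis R Δ p F A), h0,
    hom_ext_resBasis fun F hF A hd hA => homOf_resBasis h0 hd hA⟩

lemma homOf_congr {g g' : Finset (Fin n) → Finset (Fin n) → Y}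
    (h : ∀ F ∈ Δ, ∀ A, Disjoint F A → A.card = p → g F A = g' F A) :
    homOf (x := x) hΔ p g = homOf hΔ p g' := by
  have : (fun q : ResIdx Δ p => g q.1.1 q.1.2) = fun q : ResIdx Δ p => g' q.1.1 q.1.2 :=
    funext fun q => h _ q.2.1 _ q.2.2.1 q.2.2.2
  rw [homOf, this, homOf]

lemma d_homOf {g : Finset (Fin n) → Finset (Fin n) → Y} (hg : ∀ F ∉ Δ, ∀ A, g F A = 0) :
    (resComplex x hΔ).d (p + 1) p ≫ homOf hΔ p g = homOf hΔ (p + 1) (cochainD x g) := by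
  refine hom_ext_resBasis fun F hF A hd hA => ?_
  rw [homOf_resBasis (fun F hF A => cochainD_eq_zero_of_notMem hΔ hg hF A) hd hA, resComplex_d]
  change (homOf (x := x) (Y := Y) hΔ p g).hom (resD x Δ p (resBasis R Δ (p + 1) F A)) = _
  rw [resD_resBasis hΔ hd hA]
  refine (map_cochainD _ _ _ _).trans ?_
  exact cochainD_congr hd fun G B hd' hB => homOf_resBasis hg hd' (by omega)

lemma homOf_eq_iff {g g' : Finset (Fin n) → Finset (Fin n) → Y} (hg : ∀ F ∉ Δ, ∀ A, g F A = 0)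
    (hg' : ∀ F ∉ Δ, ∀ A, g' F A = 0) :
    homOf (x := x) hΔ p g = homOf hΔ p g' ↔
      ∀ F ∈ Δ, ∀ A, Disjoint F A → A.card = p → g F A = g' F A := by
  refine ⟨fun h F hF A hd hA => ?_, homOf_congr⟩
  rw [← homOf_resBasis (x := x) (hΔ := hΔ) hg hd hA, h, homOf_resBasis hg' hd hA]

lemma homOf_zero : homOf (x := x) hΔ p (fun _ _ => (0 : Y)) = 0 := by
  refine hom_ext_resBasis fun F hF A hd hA => ?_
  rw [homOf_resBasis (fun _ _ _ => rfl) hd hA]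
  rfl

/-- Coboundary criterion in all degrees. -/
lemma exists_d_comp_eq_homOf_iff {g : Finset (Fin n) → Finset (Fin n) → Y}
    (hg : ∀ F ∉ Δ, ∀ A, g F A = 0) :
    (∃ w : (resComplex x hΔ).X ((ComplexShape.down ℕ).next p) ⟶ Y,
        (resComplex x hΔ).d p _ ≫ w = homOf hΔ p g) ↔
      ∃ w : Finset (Fin n) → Finset (Fin n) → Y, (∀ F ∉ Δ, ∀ A, w F A = 0) ∧
        ∀ F ∈ Δ, ∀ A, Disjoint F A → A.card = p → cochainD x w F A = g F A := by
  rcases p with _ | p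
  · have e : ∀ w, (resComplex x hΔ).d 0 ((ComplexShape.down ℕ).next 0) ≫ w =
        (0 : (resComplex x hΔ).X 0 ⟶ Y) := by
      intro w
      rw [(resComplex x hΔ).shape _ _ (by simp)]
      exact Limits.zero_comp
    constructor
    · rintro ⟨w, hw⟩
      rw [e, ← homOf_zero, homOf_eq_iff (fun _ _ _ => rfl) hg] at hw
      refine ⟨fun _ _ => 0, fun _ _ _ => rfl, fun F hF A hd hA => ?_⟩
      rw [← hw F hF A hd hA, Finset.card_eq_zero.mp hA]
      simp [cochainD]
    · rintro ⟨w, -, hw⟩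
      refine ⟨0, ?_⟩
      rw [e, ← homOf_zero, homOf_eq_iff (fun _ _ _ => rfl) hg]
      intro F hF A hd hA
      rw [← hw F hF A hd hA, Finset.card_eq_zero.mp hA]
      simp [cochainD]
  · rw [ChainComplex.next_nat_succ]
    constructor
    · rintro ⟨f, hf⟩
      obtain ⟨w, hw0, rfl⟩ := exists_homOf f
      refine ⟨w, hw0, ?_⟩
      rwa [d_homOf hw0, homOf_eq_iff (fun F hF A => cochainD_eq_zero_of_notMem hΔ hw0 hF A) hg] at hf
    · rintro ⟨w, hw0, hw⟩
      refine ⟨homOf hΔ p w, ?_⟩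
      rwa [d_homOf hw0, homOf_eq_iff (fun F hF A => cochainD_eq_zero_of_notMem hΔ hw0 hF A) hg]

lemma d_homOf_eq_zero_iff {g : Finset (Fin n) → Finset (Fin n) → Y}
    (hg : ∀ F ∉ Δ, ∀ A, g F A = 0) :
    (resComplex x hΔ).d (p + 1) p ≫ homOf hΔ p g = 0 ↔
      ∀ F ∈ Δ, ∀ A, Disjoint F A → A.card = p + 1 → cochainD x g F A = 0 := by
  rw [d_homOf hg, ← homOf_zero,
    homOf_eq_iff (fun F hF A => cochainD_eq_zero_of_notMem hΔ hg hF A) (fun _ _ _ => rfl)]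

end Resolution

section Comparison

variable {n : ℕ} {R : Type} [CommRing R] {x y s : Fin n → R} {Δ : Finset (Finset (Fin n))}

lemma scale_cochainD {Y : Type*} [AddCommGroup Y] [Module R Y] (hy : ∀ v, y v = s v * x v)
    (g : Finset (Fin n) → Finset (Fin n) → Y) {F A : Finset (Fin n)} (hd : Disjoint F A) :
    cochainD y (fun F A => ((∏ v ∈ F, s v) * ∏ v ∈ A, s v) • g F A) F A =
      ((∏ v ∈ F, s v) * ∏ v ∈ A, s v) • cochainD x g F A := by
  simp only [cochainD, Finset.smul_sum]
  refine Finset.sum_congr rfl fun v hv => ?_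
  have hvF : v ∉ F := fun h => Finset.disjoint_left.mp hd h hv
  have e : ∏ w ∈ A, s w = s v * ∏ w ∈ A.erase v, s w := (Finset.mul_prod_erase A s hv).symm
  rw [smul_comm _ (incSign v A)]
  congr 1
  rw [Finset.prod_insert hvF, hy, e, smul_sub, smul_smul, smul_smul]
  congr 2
  · ring
  · ring

/-- The basis elements, as elements of the complex. -/
noncomputable def resElt (hΔ : IsSimplicialComplex Δ) (p : ℕ) (F A : Finset (Fin n)) :
    (resComplex x hΔ).X p := resBasis R Δ p F A

lemma resElt_of_notMem {hΔ : IsSimplicialComplex Δ} {p : ℕ} {F : Finset (Fin n)} (hF : F ∉ Δ)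
    (A : Finset (Fin n)) : resElt (x := x) hΔ p F A = 0 := resBasis_of_notMem hF

lemma d_resElt {hΔ : IsSimplicialComplex Δ} {p : ℕ} {F A : Finset (Fin n)} (hd : Disjoint F A)
    (hA : A.card = p + 1) :
    ((resComplex x hΔ).d (p + 1) p).hom (resElt hΔ (p + 1) F A) = cochainD x (resElt hΔ p) F A := by
  rw [resComplex_d]
  exact resD_resBasis hΔ hd hA

/-- The scaled basis elements. -/
noncomputable def resScale (s : Fin n → R) (hΔ : IsSimplicialComplex Δ) (p : ℕ)
    (F A : Finset (Fin n)) : (resComplex x hΔ).X p :=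
  ((∏ v ∈ F, s v) * ∏ v ∈ A, s v) • resElt hΔ p F A

lemma resScale_of_notMem {hΔ : IsSimplicialComplex Δ} {p : ℕ} :
    ∀ F ∉ Δ, ∀ A, resScale (x := x) s hΔ p F A = 0 := fun F hF A => by
  rw [resScale, resElt_of_notMem hF, smul_zero]

lemma homOf_resElt {hΔ : IsSimplicialComplex Δ} {p : ℕ} {Y : ModuleCat.{0} R}
    {g : Finset (Fin n) → Finset (Fin n) → Y} (hg : ∀ F ∉ Δ, ∀ A, g F A = 0)
    {F A : Finset (Fin n)} (hd : Disjoint F A) (hA : A.card = p) :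
    (homOf (x := x) hΔ p g).hom (resElt hΔ p F A) = g F A :=
  homOf_resBasis hg hd hA

lemma hom_ext_resElt {hΔ : IsSimplicialComplex Δ} {p : ℕ} {Y : ModuleCat.{0} R}
    {f f' : (resComplex x hΔ).X p ⟶ Y}
    (h : ∀ F ∈ Δ, ∀ A, Disjoint F A → A.card = p →
      f.hom (resElt hΔ p F A) = f'.hom (resElt hΔ p F A)) : f = f' :=
  hom_ext_resBasis h

/-- The comparison map between the resolutions for `y = s x` and `x`. -/
noncomputable def resMap (hy : ∀ v, y v = s v * x v) (hΔ : IsSimplicialComplex Δ) :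
    resComplex y hΔ ⟶ resComplex x hΔ where
  f p := homOf hΔ p (resScale s hΔ p)
  comm' i j hij := by
    obtain rfl : j + 1 = i := hij
    rw [d_homOf resScale_of_notMem]
    refine hom_ext_resElt fun F hF A hd hA => ?_
    rw [homOf_resElt
      (fun F hF A => cochainD_eq_zero_of_notMem hΔ resScale_of_notMem hF A) hd hA,
      ModuleCat.comp_apply, homOf_resElt resScale_of_notMem hd hA, resScale, map_smul, d_resElt hd hA]
    exact (scale_cochainD hy _ hd).symm

lemma resMap_resElt (hy : ∀ v, y v = s v * x v) (hΔ : IsSimplicialComplex Δ) {p : ℕ}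
    {F A : Finset (Fin n)} (hd : Disjoint F A) (hA : A.card = p) :
    ((resMap hy hΔ).f p).hom (resElt hΔ p F A) = resScale s hΔ p F A :=
  homOf_resElt resScale_of_notMem hd hA

lemma resMap_comp_homOf (hy : ∀ v, y v = s v * x v) (hΔ : IsSimplicialComplex Δ) {p : ℕ}
    {Y : ModuleCat.{0} R} {g : Finset (Fin n) → Finset (Fin n) → Y}
    (hg : ∀ F ∉ Δ, ∀ A, g F A = 0) :
    (resMap hy hΔ).f p ≫ homOf (x := x) hΔ p g =
      homOf hΔ p (fun F A => ((∏ v ∈ F, s v) * ∏ v ∈ A, s v) • g F A) := by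
  refine hom_ext_resElt fun F hF A hd hA => ?_
  rw [homOf_resElt (fun F hF A => by rw [hg F hF, smul_zero]) hd hA, ModuleCat.comp_apply,
    resMap_resElt hy hΔ hd hA, resScale, map_smul, homOf_resElt hg hd hA]

lemma faceIdeal_mono (hy : ∀ v, y v = s v * x v) (Δ : Finset (Finset (Fin n))) :
    faceIdeal y Δ ≤ faceIdeal x Δ := by
  rw [faceIdeal, Ideal.span_le]
  rintro _ ⟨F, hF, rfl⟩
  simp only [hy, Finset.prod_mul_distrib]
  exact Ideal.mul_mem_left _ _ (Ideal.subset_span ⟨F, hF, rfl⟩)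

/-- The canonical surjection between quotients. -/
noncomputable def quotMap {I J : Ideal R} (h : I ≤ J) :
    ModuleCat.of R (R ⧸ I) ⟶ ModuleCat.of R (R ⧸ J) :=
  ModuleCat.ofHom (Submodule.mapQ I J LinearMap.id h)

lemma quotMap_comp {I J L : Ideal R} (h : I ≤ J) (h' : J ≤ L) :
    quotMap h ≫ quotMap h' = quotMap (h.trans h') := by
  ext1
  refine Submodule.linearMap_qext _ ?_
  rfl

lemma resolution_π (hx : IsStronglyRegular x) (hΔ : IsSimplicialComplex Δ) :
    (resolution hx hΔ).π.f 0 = resAugHom x hΔ :=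
  ChainComplex.toSingle₀Equiv_symm_apply_f_zero _ _

lemma Represents.quotMap {hx : IsStronglyRegular x} {hx' : IsStronglyRegular y}
    (hy : ∀ v, y v = s v * x v) {hΔ : IsSimplicialComplex Δ} {p : ℕ}
    {Y : ModuleCat.{0} R} {g : Finset (Fin n) → Finset (Fin n) → Y}
    (hg : ∀ F ∉ Δ, ∀ A, g F A = 0) {e}
    (h : Represents (P := resolution hx hΔ) (homOf hΔ p g) e) :
    Represents (P := resolution hx' hΔ)
      (homOf hΔ p (fun F A => ((∏ v ∈ F, s v) * ∏ v ∈ A, s v) • g F A))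
      (((Ext R (ModuleCat.{0} R) p).map (quotMap (faceIdeal_mono hy Δ)).op).app Y e) := by
  have := h.map (Q := resolution hx' hΔ) (StanleyReisner.quotMap (faceIdeal_mono hy Δ))
    (resMap hy hΔ) ?_
  · have e := resMap_comp_homOf (x := x) hy hΔ hg (p := p)
    rw [← e]
    exact this
  · rw [resolution_π, resolution_π, ChainComplex.single₀_map_f_zero]
    refine hom_ext_resElt (hΔ := hΔ) fun F hF A hd hA => ?_
    have h1 : ((resMap hy hΔ).f 0 ≫ resAugHom x hΔ).hom (resElt hΔ 0 F A) =
        (resAugHom x hΔ).hom (resScale s hΔ 0 F A) := by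
      rw [ModuleCat.comp_apply, resMap_resElt hy hΔ hd hA]
    refine h1.trans ?_
    obtain rfl := Finset.card_eq_zero.mp hA
    change resAug x Δ (_ • resBasis R Δ 0 F ∅) =
      Submodule.mapQ _ _ LinearMap.id (faceIdeal_mono hy Δ) (resAug y Δ (resBasis R Δ 0 F ∅))
    refine (map_smul (resAug x Δ) _ (resBasis R Δ 0 F ∅)).trans ?_
    rw [resAug_resBasis, resAug_resBasis]
    change Ideal.Quotient.mk _ _ = Ideal.Quotient.mk _ _
    congr 1
    simp [hy, Finset.prod_mul_distrib]

end Comparison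

section Koszul

variable {n : ℕ} {R : Type} [CommRing R] (x : Fin n → R) {Y : Type*} [AddCommGroup Y] [Module R Y]

/-- The Koszul cochain differential with coefficients in a module. -/
def koszulC (z : Finset (Fin n) → Y) (A : Finset (Fin n)) : Y :=
  ∑ v ∈ A, incSign v A • x v • z (A.erase v)

/-- Extension of a Koszul cochain by zero. -/
def koszulExt (z : Finset (Fin n) → Y) (F A : Finset (Fin n)) : Y := if F = ∅ then z A else 0

variable {x}

lemma koszulExt_eq_zero (z : Finset (Fin n) → Y) :
    ∀ F ∉ ({∅} : Finset (Finset (Fin n))), ∀ A, koszulExt z F A = 0 :=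
  fun F hF A => if_neg (by simpa using hF)

lemma cochainD_empty (g : Finset (Fin n) → Finset (Fin n) → Y)
    (hg : ∀ F ∉ ({∅} : Finset (Finset (Fin n))), ∀ A, g F A = 0) (A : Finset (Fin n)) :
    cochainD x g ∅ A = koszulC x (g ∅) A := by
  refine Finset.sum_congr rfl fun v hv => ?_
  rw [hg (insert v ∅) (by simp), sub_zero]

end Koszul

section LocalCohomology

variable {R : Type} [CommRing R] (J : Ideal R) (i : ℕ) (Y : ModuleCat.{0} R)

/-- The system of modules `Ext(R/J^k, Y)`. -/
noncomputable abbrev extSystem : (ℕᵒᵖ)ᵒᵖ ⥤ ModuleCat.{0} R :=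
  localCohomology.diagram (localCohomology.idealPowersDiagram J) i ⋙ (evaluation _ _).obj Y

/-- Local cohomology, as a cocone over the system of modules `Ext(R/J^k, Y)`. -/
noncomputable abbrev extCocone : Limits.Cocone (extSystem J i Y) :=
  ((evaluation _ _).obj Y).mapCocone
    (Limits.colimit.cocone (localCohomology.diagram (localCohomology.idealPowersDiagram J) i))

/-- Local cohomology is the colimit. -/
noncomputable def extCoconeIsColimit : Limits.IsColimit (extCocone J i Y) :=
  Limits.isColimitOfPreserves _ (Limits.colimit.isColimit _)

lemma exists_pow_smul_localCohomology_eq_zero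
    (hfin : Module.Finite R ((localCohomology J i).obj Y)) {r : R} (hr : r ∈ J) :
    ∃ N : ℕ, ∀ e : (localCohomology J i).obj Y, r ^ N • e = 0 := by
  have h1 : ∀ e : (localCohomology J i).obj Y, ∃ N : ℕ, r ^ N • e = 0 := by
    intro e
    obtain ⟨j, y, hy⟩ := Limits.Concrete.isColimit_exists_rep (extSystem J i Y)
      (extCoconeIsColimit J i Y) e
    refine ⟨j.unop.unop, ?_⟩
    have h2 : r ^ j.unop.unop • y = 0 := by
      refine ext_smul_eq_zero (X := ModuleCat.of R (R ⧸ J ^ j.unop.unop)) (Y := Y) (i := i)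
        (r ^ j.unop.unop) ?_ y
      intro m
      obtain ⟨m, rfl⟩ := Ideal.Quotient.mk_surjective m
      refine Ideal.Quotient.eq_zero_iff_mem.mpr ?_
      exact Ideal.mul_mem_right _ _ (Ideal.pow_mem_pow hr _)
    have h3 := map_smul ((extCocone J i Y).ι.app j).hom (r ^ j.unop.unop) y
    rw [h2, map_zero] at h3
    refine Eq.trans ?_ h3.symm
    exact congrArg _ hy.symm
  obtain ⟨s, hs⟩ := hfin.fg_top
  choose N hN using h1
  refine ⟨s.sup N, fun e => ?_⟩
  have : (⊤ : Submodule R ((localCohomology J i).obj Y)) ≤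
      LinearMap.ker (LinearMap.lsmul R _ (r ^ s.sup N)) := by
    rw [← hs, Submodule.span_le]
    intro g hg
    have hle : N g ≤ s.sup N := Finset.le_sup hg
    change r ^ s.sup N • g = 0
    rw [← Nat.sub_add_cancel hle, pow_add, mul_smul, hN, smul_zero]
  exact this (Submodule.mem_top (x := e))

lemma exists_ext_map_eq_zero {k : ℕ} (e : ((Ext R (ModuleCat.{0} R) i).obj
      (op (ModuleCat.of R (R ⧸ J ^ k)))).obj Y) {r : R}
    (h : ∀ e : (localCohomology J i).obj Y, r • e = 0) :
    ∃ (k' : ℕ) (hk : k ≤ k'), ((Ext R (ModuleCat.{0} R) i).map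
      (quotMap (Ideal.pow_le_pow_right (I := J) hk)).op).app Y (r • e) = 0 := by
  let y : (extSystem J i Y).obj (op (op k)) := e
  have h3 := map_smul ((extCocone J i Y).ι.app (op (op k))).hom r y
  have h4 : ((extCocone J i Y).ι.app (op (op k))).hom (r • y) =
      ((extCocone J i Y).ι.app (op (op k))).hom 0 := by
    rw [h3, map_zero]
    exact h _
  obtain ⟨j, f, g, hfg⟩ := Limits.Concrete.isColimit_exists_of_rep_eq (extSystem J i Y)
    (extCoconeIsColimit J i Y) (r • y) 0 h4
  refine ⟨j.unop.unop, f.unop.unop.down.down, ?_⟩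
  exact hfg.trans (map_zero ((extSystem J i Y).map g).hom)

end LocalCohomology

section KoszulBound

variable {n : ℕ} {K : Type} [Field K]

lemma exists_koszulC_of_isFiniteLength {Y : Type} [AddCommGroup Y] [Module (MvPolynomial (Fin n) K) Y]
    {i : ℕ} (hfl : IsFiniteLength (MvPolynomial (Fin n) K)
      ((localCohomology (maxIdeal K n) i).obj (ModuleCat.of _ Y))) (v : Fin n) :
    ∃ N : ℕ, ∀ (t : ℕ) (z : Finset (Fin n) → Y),
      (∀ A, A.card = i + 1 → koszulC (fun w => (X w : MvPolynomial (Fin n) K) ^ t) z A = 0) →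
      ∃ (s : ℕ) (u : Finset (Fin n) → Y), ∀ A, A.card = i →
        koszulC (fun w => (X w : MvPolynomial (Fin n) K) ^ (s + t)) u A =
          (∏ w ∈ A, (X w : MvPolynomial (Fin n) K) ^ s) • (X v : MvPolynomial (Fin n) K) ^ N • z A := by
  classical
  let R := MvPolynomial (Fin n) K
  have hΔ : IsSimplicialComplex ({∅} : Finset (Finset (Fin n))) := by
    intro s hs t ht
    simp only [Finset.mem_singleton] at hs ⊢
    subst hs
    exact Finset.subset_empty.mp ht
  have hfin := (isFiniteLength_iff_isNoetherian_isArtinian.mp hfl).1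
  obtain ⟨N, hN⟩ := exists_pow_smul_localCohomology_eq_zero (maxIdeal K n) i (ModuleCat.of R Y)
    inferInstance (r := X v) (Ideal.subset_span ⟨v, rfl⟩)
  refine ⟨N, fun t z hz => ?_⟩
  let P : ∀ t, ProjectiveResolution _ :=
    fun t => resolution (isStronglyRegular_X_pow (n := n) K (t := t)) hΔ
  have hcoc : (resComplex (fun w => (X w : R) ^ t) hΔ).d (i + 1) i ≫ homOf (Y := ModuleCat.of R Y) hΔ i (koszulExt z) = 0 := by
    rw [d_homOf_eq_zero_iff (x := fun w => (X w : MvPolynomial (Fin n) K) ^ t)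
      (koszulExt_eq_zero z)]
    intro F hF A hd hA
    obtain rfl := Finset.mem_singleton.mp hF
    rw [cochainD_empty _ (koszulExt_eq_zero z)]
    exact hz A hA
  obtain ⟨e, he⟩ := exists_represents (P := P t) (Y := ModuleCat.of R Y) _ hcoc
  have hmem : ∀ s w, (X w : R) ^ s ∈ faceIdeal (fun w => (X w : R) ^ s) ({∅} : Finset (Finset (Fin n))) :=
    fun s w => Ideal.subset_span ⟨{w}, by simp, by simp⟩
  obtain ⟨k, hk⟩ : ∃ k, maxIdeal K n ^ k ≤ faceIdeal (fun w => (X w : R) ^ t) {∅} := by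
    refine Ideal.exists_pow_le_of_le_radical_of_fg ?_ (IsNoetherian.noetherian _)
    rw [maxIdeal, Ideal.span_le]
    rintro _ ⟨w, rfl⟩
    exact ⟨t, hmem t w⟩
  obtain ⟨k', hkk, hk'⟩ := exists_ext_map_eq_zero (maxIdeal K n) i (ModuleCat.of R Y)
    (((Ext R (ModuleCat.{0} R) i).map (quotMap hk).op).app (ModuleCat.of R Y) e) hN
  have hy : ∀ w : Fin n, (X w : R) ^ (k' + t) = X w ^ k' * X w ^ t := fun w => pow_add _ _ _
  have hle : faceIdeal (fun w => (X w : R) ^ (k' + t)) {∅} ≤ maxIdeal K n ^ k' := by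
    rw [faceIdeal, Ideal.span_le]
    rintro _ ⟨F, hF, rfl⟩
    obtain ⟨w, hw⟩ := Finset.nonempty_iff_ne_empty.mpr (by simpa using hF)
    refine Ideal.mem_of_dvd _ (Finset.dvd_prod_of_mem _ hw) ?_
    rw [hy]
    have hw' : (X w : R) ∈ maxIdeal K n := Ideal.subset_span ⟨w, rfl⟩
    exact Ideal.mul_mem_right _ _ (Ideal.pow_mem_pow hw' _)
  have hq : quotMap (faceIdeal_mono (x := fun w => (X w : R) ^ t) hy {∅}) =
      quotMap hle ≫ quotMap (Ideal.pow_le_pow_right (I := maxIdeal K n) hkk) ≫ quotMap hk := by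
    rw [quotMap_comp, quotMap_comp]
  have h0 : ((Ext R (ModuleCat.{0} R) i).map
      (quotMap (faceIdeal_mono (x := fun w => (X w : R) ^ t) hy {∅})).op).app (ModuleCat.of R Y)
      ((X v : R) ^ N • e) = 0 := by
    rw [hq, op_comp, op_comp, Functor.map_comp, Functor.map_comp, NatTrans.comp_app,
      NatTrans.comp_app, ModuleCat.comp_apply, ModuleCat.comp_apply, map_smul]
    refine (congrArg _ hk').trans (map_zero _)
  have hs := he.smul ((X v : R) ^ N)
  have hg : ∀ F ∉ ({∅} : Finset (Finset (Fin n))), ∀ A,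
      (X v : R) ^ N • (koszulExt z F A : ModuleCat.of R Y) = 0 := fun F hF A => by
    rw [koszulExt_eq_zero z F hF]; exact smul_zero _
  have hs' : (X v : R) ^ N • homOf (x := fun w => (X w : R) ^ t) (Y := ModuleCat.of R Y) hΔ i
      (koszulExt z) = homOf hΔ i (fun F A => (X v : R) ^ N • koszulExt z F A) := by
    refine hom_ext_resElt fun F hF A hd hA => ?_
    rw [homOf_resElt hg hd hA]
    exact congrArg _ (homOf_resElt (koszulExt_eq_zero z) hd hA)
  have hs2 : Represents (P := P t) (homOf (Y := ModuleCat.of R Y) hΔ i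
      (fun F A => (X v : R) ^ N • koszulExt z F A)) ((X v : R) ^ N • e) := by
    rw [← hs']
    exact hs
  have h5 := hs2.quotMap (hx' := isStronglyRegular_X_pow K) hy hg
  obtain ⟨w, hw⟩ := h5.eq_zero_iff.mp h0
  obtain ⟨w, hw0, hw⟩ := (exists_d_comp_eq_homOf_iff (x := fun w => (X w : R) ^ (k' + t))
    (fun F hF A => by rw [hg F hF A]; exact smul_zero _)).mp ⟨w, hw⟩
  refine ⟨k', w ∅, fun A hA => ?_⟩
  have := hw ∅ (by simp) A (by simp) hA
  rw [cochainD_empty _ hw0] at this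
  refine this.trans ?_
  simp only [koszulExt, Finset.prod_empty, one_mul, if_true]

end KoszulBound

section Boundary

variable {n : ℕ} {Y : Type*} [AddCommGroup Y]

/-- The simplicial boundary, on total functions. -/
def bdry (z : Finset (Fin n) → Y) (B : Finset (Fin n)) : Y :=
  ∑ v ∈ Bᶜ, incSign v B • z (insert v B)

/-- The simplicial coboundary, on total functions. -/
def cobdry (z : Finset (Fin n) → Y) (A : Finset (Fin n)) : Y :=
  ∑ v ∈ A, incSign v A • z (A.erase v)

lemma bdry_congr {z z' : Finset (Fin n) → Y} {B : Finset (Fin n)}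
    (h : ∀ v ∉ B, z (insert v B) = z' (insert v B)) : bdry z B = bdry z' B :=
  Finset.sum_congr rfl fun v hv => by rw [h v (Finset.mem_compl.mp hv)]

lemma bdry_zero (B : Finset (Fin n)) : bdry (fun _ => (0 : Y)) B = 0 := by simp [bdry]

lemma map_bdry {Z F : Type*} [AddCommGroup Z] [FunLike F Y Z] [AddMonoidHomClass F Y Z] (f : F)
    (z : Finset (Fin n) → Y) (B : Finset (Fin n)) :
    f (bdry z B) = bdry (fun A => f (z A)) B := by
  simp [bdry, map_sum, map_zsmul]

lemma bdry_add (z z' : Finset (Fin n) → Y) (B : Finset (Fin n)) :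
    bdry (fun A => z A + z' A) B = bdry z B + bdry z' B := by
  simp [bdry, smul_add, Finset.sum_add_distrib]

lemma bdry_bdry (z : Finset (Fin n) → Y) (B : Finset (Fin n)) : bdry (bdry z) B = 0 := by
  have e : bdry (bdry z) B = ∑ v ∈ Bᶜ, ∑ w ∈ Bᶜ.erase v,
      (incSign v B * incSign w (insert v B)) • z (insert w (insert v B)) := by
    refine Finset.sum_congr rfl fun v hv => ?_
    rw [bdry, Finset.smul_sum, Finset.compl_insert]
    exact Finset.sum_congr rfl fun w _ => smul_smul _ _ _
  rw [e]
  refine sum_sum_erase_eq_zero _ _ fun v hv w hw hvw => ?_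
  rw [mul_comm, incSign_insert_swap hvw.symm (Finset.mem_compl.mp hw) (Finset.mem_compl.mp hv),
    neg_smul, Finset.insert_comm, mul_comm]

lemma sum_mul_cobdry {K : Type*} [CommRing K] (c z : Finset (Fin n) → K) :
    ∑ A, c A * cobdry z A = ∑ B, bdry c B * z B := by
  simp only [cobdry, bdry, Finset.mul_sum, Finset.sum_mul]
  rw [Finset.sum_sigma', Finset.sum_sigma']
  refine Finset.sum_bij' (fun p _ => ⟨p.1.erase p.2, p.2⟩) (fun p _ => ⟨insert p.2 p.1, p.2⟩)
    ?_ ?_ ?_ ?_ ?_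
  · rintro ⟨A, v⟩ h
    simp
  · rintro ⟨A, v⟩ h
    simp
  · rintro ⟨A, v⟩ h
    simp only [Finset.mem_sigma, Finset.mem_univ, true_and] at h
    simp [Finset.insert_erase h]
  · rintro ⟨A, v⟩ h
    simp only [Finset.mem_sigma, Finset.mem_univ, true_and, Finset.mem_compl] at h
    simp [Finset.erase_insert h]
  · rintro ⟨A, v⟩ h
    simp only [Finset.mem_sigma, Finset.mem_univ, true_and] at h
    simp only [Finset.insert_erase h, incSign_erase_self, zsmul_eq_mul]
    ring

end Boundary

section Link

variable (K : Type) [Field K] {n : ℕ} (Δ : Finset (Finset (Fin n)))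

/-- Exactness of the complex of chains on the faces with `i` vertices containing `G`. -/
def LinkExact (G : Finset (Fin n)) (i : ℕ) : Prop :=
  ∀ c : Finset (Fin n) → K, (∀ A, c A ≠ 0 → A ∈ Δ ∧ A.card = i ∧ G ⊆ A) →
    (∀ B, G ⊆ B → bdry c B = 0) →
    ∃ b : Finset (Fin n) → K, (∀ A, b A ≠ 0 → A ∈ Δ ∧ A.card = i + 1 ∧ G ⊆ A) ∧
      ∀ B, G ⊆ B → bdry b B = c B

/-- Exactness of the complex of cochains on the faces with `i` vertices containing `G`. -/
def LinkCoexact (G : Finset (Fin n)) (i : ℕ) : Prop :=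
  ∀ z : Finset (Fin n) → K, (∀ A, z A ≠ 0 → G ⊆ A) →
    (∀ A ∈ Δ, G ⊆ A → A.card = i + 1 → cobdry z A = 0) →
    ∃ y : Finset (Fin n) → K, (∀ A, y A ≠ 0 → G ⊆ A) ∧
      ∀ A ∈ Δ, G ⊆ A → A.card = i → cobdry y A = z A

variable {K Δ}

lemma LinkCoexact.linkExact {G : Finset (Fin n)} {i : ℕ}
    (h : LinkCoexact K Δ G i) : LinkExact K Δ G i := by
  classical
  intro c hc hcyc
  let T : Finset (Finset (Fin n)) := {A ∈ Δ | A.card = i + 1 ∧ G ⊆ A}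
  let f : (Finset (Fin n) → K) →ₗ[K] (Finset (Fin n) → K) :=
    { toFun := fun b B => if G ⊆ B then bdry (fun A => if A ∈ T then b A else 0) B else 0
      map_add' := fun b b' => by
        funext B
        simp only [Pi.add_apply]
        split_ifs
        · rw [← bdry_add]
          exact bdry_congr fun v _ => by split_ifs <;> simp
        · simp
      map_smul' := fun r b => by
        funext B
        simp only [Pi.smul_apply, RingHom.id_apply]
        split_ifs
        · rw [smul_eq_mul, ← AddMonoidHom.coe_mulLeft, map_bdry]
          exact bdry_congr fun v _ => by split_ifs <;> simp
        · simp }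
  have hmem : c ∈ LinearMap.range f := by
    by_contra hcon
    obtain ⟨φ, hφc, hφ⟩ := Submodule.exists_le_ker_of_notMem hcon
    let z : Finset (Fin n) → K := fun A => if G ⊆ A then φ (Pi.single A 1) else 0
    have hφe : ∀ w : Finset (Fin n) → K, φ w = ∑ A, w A * φ (Pi.single A 1) := by
      intro w
      conv_lhs => rw [← Finset.univ_sum_single w, map_sum]
      refine Finset.sum_congr rfl fun A _ => ?_
      rw [← smul_eq_mul, ← map_smul, ← Pi.single_smul, smul_eq_mul, mul_one]
    have hz : ∀ w : Finset (Fin n) → K, (∀ A, w A ≠ 0 → G ⊆ A) → φ w = ∑ A, w A * z A := by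
      intro w hw
      rw [hφe]
      refine Finset.sum_congr rfl fun A _ => ?_
      by_cases hA : G ⊆ A
      · simp only [z, if_pos hA]
      · have : w A = 0 := by_contra fun h => hA (hw A h)
        rw [this, zero_mul, zero_mul]
    obtain ⟨y, hy0, hy⟩ := h z (fun A hA => by
      by_contra hG
      exact hA (if_neg hG)) (fun A hA hGA hcard => by
      have h1 : φ (f (Pi.single A 1)) = 0 := hφ ⟨_, rfl⟩
      rw [hz _ (fun B hB => by by_contra hG; exact hB (if_neg hG))] at h1
      have h2 : ∀ B, f (Pi.single A 1) B * z B = bdry (Pi.single A (1 : K)) B * z B := by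
        intro B
        change (if G ⊆ B then _ else 0) * z B = _
        by_cases hB : G ⊆ B
        · rw [if_pos hB]
          congr 1
          refine bdry_congr fun v _ => ?_
          by_cases hv : insert v B = A
          · rw [hv, if_pos (by simp [T, hA, hGA, hcard])]
          · simp [Pi.single_eq_of_ne hv]
        · simp only [z, if_neg hB, mul_zero]
      rw [Finset.sum_congr rfl fun B _ => h2 B, ← sum_mul_cobdry,
        Finset.sum_eq_single A (fun B _ hB => by simp [Pi.single_eq_of_ne hB]) (by simp)] at h1
      simpa using h1)
    refine hφc ?_
    rw [hz c (fun A hA => (hc A hA).2.2)]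
    have h3 : ∀ A, c A * z A = c A * cobdry y A := by
      intro A
      by_cases hA : c A = 0
      · rw [hA, zero_mul, zero_mul]
      · obtain ⟨h1, h2, h3⟩ := hc A hA
        rw [hy A h1 h3 h2]
    rw [Finset.sum_congr rfl fun A _ => h3 A, sum_mul_cobdry]
    refine Finset.sum_eq_zero fun B _ => ?_
    by_cases hB : G ⊆ B
    · rw [hcyc B hB, zero_mul]
    · have : y B = 0 := by_contra fun h => hB (hy0 B h)
      rw [this, mul_zero]
  obtain ⟨b, hb⟩ := hmem
  refine ⟨fun A => if A ∈ T then b A else 0, fun A hA => ?_, fun B hB => ?_⟩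
  · have : A ∈ T := by by_contra h; exact hA (if_neg h)
    simpa [T] using this
  · rw [← hb]
    exact (if_pos hB).symm

end Link

section Monomials

variable {K : Type} [Field K] {n : ℕ} {Δ : Finset (Finset (Fin n))}

lemma mem_stanleyReisnerIdeal_iff (f : MvPolynomial (Fin n) K) :
    f ∈ stanleyReisnerIdeal K Δ ↔ ∀ m ∈ f.support, ∃ S ∉ Δ, S ⊆ m.support := by
  have e : {m | ∃ S : Finset (Fin n), S ∉ Δ ∧ m = ∏ i ∈ S, (X i : MvPolynomial (Fin n) K)} =
      (fun s => monomial s (1 : K)) '' {s | ∃ S ∉ Δ, s = ∑ i ∈ S, Finsupp.single i 1} := by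
    ext m
    constructor
    · rintro ⟨S, hS, rfl⟩
      exact ⟨_, ⟨S, hS, rfl⟩, monomial_sum_one _ _⟩
    · rintro ⟨_, ⟨S, hS, rfl⟩, rfl⟩
      exact ⟨S, hS, monomial_sum_one _ _⟩
  rw [stanleyReisnerIdeal, e, mem_ideal_span_monomial_image]
  refine forall₂_congr fun m _ => ?_
  constructor
  · rintro ⟨_, ⟨S, hS, rfl⟩, hm⟩
    refine ⟨S, hS, fun i hi => ?_⟩
    have := hm i
    rw [Finsupp.finsetSum_apply, Finset.sum_eq_single i (fun j _ hj => by simp [hj])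
      (fun h => (h hi).elim)] at this
    simp at this ⊢
    omega
  · rintro ⟨S, hS, hm⟩
    refine ⟨_, ⟨S, hS, rfl⟩, fun i => ?_⟩
    rw [Finsupp.finsetSum_apply]
    by_cases hi : i ∈ S
    · have h1 := hm hi
      rw [Finset.sum_eq_single i (fun j _ hj => by simp [hj])
        (fun h => (h hi).elim)]
      simp at h1 ⊢
      omega
    · rw [Finset.sum_eq_zero fun j hj => Finsupp.single_eq_of_ne (by rintro rfl; exact hi hj)]
      exact Nat.zero_le _

lemma coeff_eq_zero_of_mem (hΔ : IsSimplicialComplex Δ) {f : MvPolynomial (Fin n) K}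
    (hf : f ∈ stanleyReisnerIdeal K Δ) {m : Fin n →₀ ℕ} (hm : m.support ∈ Δ) : coeff m f = 0 := by
  by_contra h
  obtain ⟨S, hS, hSm⟩ := (mem_stanleyReisnerIdeal_iff f).mp hf m (mem_support_iff.mpr h)
  exact hS (hΔ _ hm _ hSm)

lemma monomial_mem_stanleyReisnerIdeal {m : Fin n →₀ ℕ} (hm : m.support ∉ Δ) (c : K) :
    monomial m c ∈ stanleyReisnerIdeal K Δ := by
  rw [mem_stanleyReisnerIdeal_iff]
  intro m' hm'
  obtain rfl := Finset.mem_singleton.mp (support_monomial_subset hm')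
  exact ⟨_, hm, subset_rfl⟩

end Monomials

section LinkOfBuchsbaum

variable {K : Type} [Field K] {n : ℕ} {Δ : Finset (Finset (Fin n))}

/-- The exponent vector with entry `t - [u ∈ G]` at each `u ∈ A` and zero elsewhere. -/
noncomputable def linkExponent (t : ℕ) (G A : Finset (Fin n)) : Fin n →₀ ℕ :=
  Finsupp.equivFunOnFinite.symm fun u => if u ∈ A then (if u ∈ G then t - 1 else t) else 0

lemma linkExponent_apply (t : ℕ) (G A : Finset (Fin n)) (u : Fin n) :
    linkExponent t G A u = if u ∈ A then (if u ∈ G then t - 1 else t) else 0 := rfl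

lemma linkExponent_support {t : ℕ} (ht : 2 ≤ t) (G A : Finset (Fin n)) :
    (linkExponent t G A).support = A := by
  ext u
  rw [Finsupp.mem_support_iff, linkExponent_apply]
  split_ifs <;> simp_all <;> omega

/-- The exponent vector `linkExponent t G A` with the entry at `v` replaced by `1`. -/
noncomputable def linkExponentAt (t : ℕ) (G : Finset (Fin n)) (v : Fin n) (A : Finset (Fin n)) :
    Fin n →₀ ℕ :=
  (linkExponent t G (A.erase v)) + Finsupp.single v 1

lemma linkExponentAt_support {t : ℕ} (ht : 2 ≤ t) {G A : Finset (Fin n)} {v : Fin n} (hv : v ∈ A) :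
    (linkExponentAt t G v A).support = A := by
  ext u
  rw [Finsupp.mem_support_iff, linkExponentAt, Finsupp.add_apply, linkExponent_apply,
    Finsupp.single_apply]
  by_cases h : v = u
  · subst h; simp [hv]
  · have : u ≠ v := fun h' => h h'.symm
    simp only [Finset.mem_erase, this, ne_eq, not_false_eq_true, true_and, h, if_false, add_zero]
    split_ifs <;> simp_all <;> omega

lemma linkExponentAt_insert {t : ℕ} {G A : Finset (Fin n)} {v w : Fin n} (hv : v ∈ G) (hw : w ∈ A)
    (hwG : w ∉ G) :
    linkExponentAt t G v (A.erase w) + Finsupp.single w t = linkExponentAt t G v A := by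
  have hvw : v ≠ w := by rintro rfl; exact hwG hv
  ext u
  simp only [linkExponentAt, Finsupp.add_apply, linkExponent_apply, Finsupp.single_apply,
    Finset.mem_erase]
  by_cases h1 : v = u
  · subst h1
    simp [hvw.symm]
  · by_cases h2 : w = u
    · subst h2
      simp [hw, hwG, hvw, hvw.symm]
    · have h3 : u ≠ v := fun h' => h1 h'.symm
      have h4 : u ≠ w := fun h' => h2 h'.symm
      simp [h1, h2, h3, h4]

lemma linkExponentAt_add {N s : ℕ} {G A : Finset (Fin n)} {v : Fin n} (hv : v ∈ G) (hG : G ⊆ A) :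
    linkExponentAt (N + 2) G v A + Finsupp.single v N + ∑ w ∈ A, Finsupp.single w s =
      linkExponent (s + (N + 2)) G A := by
  ext u
  have e : (∑ w ∈ A, Finsupp.single w s) u = if u ∈ A then s else 0 := by
    rw [Finsupp.finsetSum_apply]
    simp [Finsupp.single_apply]
  simp only [linkExponentAt, Finsupp.add_apply, linkExponent_apply, e, Finsupp.single_apply,
    Finset.mem_erase]
  by_cases h1 : v = u
  · subst h1
    simp [hv, hG hv]; omega
  · have h3 : u ≠ v := fun h' => h1 h'.symm
    simp only [h1, h3, ne_eq, not_false_eq_true, true_and, if_false, add_zero]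
    split_ifs <;> omega

lemma linkExponent_eq_add {t : ℕ} {G A : Finset (Fin n)} {w : Fin n} (hw : w ∈ A)
    (hwG : w ∉ G) :
    linkExponent t G A = Finsupp.single w t + linkExponent t G (A.erase w) := by
  ext u
  simp only [Finsupp.add_apply, linkExponent_apply, Finsupp.single_apply, Finset.mem_erase]
  by_cases h : w = u
  · subst h; simp [hw, hwG]
  · have : u ≠ w := fun h' => h h'.symm
    simp [h, this]

lemma linkCoexact_of_isFiniteLength (hΔ : IsSimplicialComplex Δ) {i : ℕ}
    (hfl : IsFiniteLength (MvPolynomial (Fin n) K) ((localCohomology (maxIdeal K n) i).obj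
      (ModuleCat.of _ (MvPolynomial (Fin n) K ⧸ stanleyReisnerIdeal K Δ))))
    {G : Finset (Fin n)} (hG : G.Nonempty) : LinkCoexact K Δ G i := by
  classical
  obtain ⟨v, hv⟩ := hG
  obtain ⟨N, hN⟩ := exists_koszulC_of_isFiniteLength hfl v
  intro z hz0 hz
  let I := stanleyReisnerIdeal K Δ
  have hz0' : ∀ A, ¬ G ⊆ A → z A = 0 := fun A hA => by_contra fun h => hA (hz0 A h)
  obtain ⟨s, u, hu⟩ := hN (N + 2)
    (fun A => Ideal.Quotient.mk I (monomial (linkExponentAt (N + 2) G v A) (z A))) (by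
      intro A hA
      have e : ∀ w ∈ A, incSign w A • (X w : MvPolynomial (Fin n) K) ^ (N + 2) •
          Ideal.Quotient.mk I
            (monomial (linkExponentAt (N + 2) G v (A.erase w)) (z (A.erase w))) =
          Ideal.Quotient.mk I
            (monomial (linkExponentAt (N + 2) G v A) (incSign w A • z (A.erase w))) := by
        intro w hw
        rw [map_zsmul (monomial _), map_zsmul]
        congr 1
        change Ideal.Quotient.mk I (_ * _) = _
        by_cases hwG : w ∈ G
        · rw [hz0' _ fun h => by simpa using h hwG]
          simp
        · rw [X_pow_eq_monomial, monomial_mul, one_mul, add_comm, linkExponentAt_insert hv hw hwG]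
      rw [koszulC, Finset.sum_congr rfl e, ← map_sum, ← map_sum]
      change Ideal.Quotient.mk I (monomial _ (cobdry z A)) = 0
      by_cases hGA : G ⊆ A
      · by_cases hAΔ : A ∈ Δ
        · rw [hz A hAΔ hGA hA, map_zero, map_zero]
        · rw [Ideal.Quotient.eq_zero_iff_mem]
          refine monomial_mem_stanleyReisnerIdeal ?_ _
          rwa [linkExponentAt_support (by omega) (hGA hv)]
      · have : cobdry z A = 0 := Finset.sum_eq_zero fun w _ => by
          rw [hz0' _ fun h => hGA (h.trans (Finset.erase_subset _ _)), smul_zero]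
        rw [this, map_zero, map_zero])
  choose p hp using fun A => Ideal.Quotient.mk_surjective (I := I) (u A)
  let T := s + (N + 2)
  refine ⟨fun B => if G ⊆ B then coeff (linkExponent T G B) (p B) else 0,
    fun A hA => by by_contra h; exact hA (if_neg h), fun A hAΔ hGA hA => ?_⟩
  have h1 := hu A hA
  have h2 : koszulC (fun w => (X w : MvPolynomial (Fin n) K) ^ (s + (N + 2))) u A =
      Ideal.Quotient.mk I (koszulD (fun w => (X w : MvPolynomial (Fin n) K) ^ T) p A) := by
    rw [koszulD, map_sum]
    refine Finset.sum_congr rfl fun w _ => ?_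
    rw [map_zsmul, map_mul, hp]
    rfl
  have h3 : (∏ w ∈ A, (X w : MvPolynomial (Fin n) K) ^ s) • (X v : MvPolynomial (Fin n) K) ^ N •
      Ideal.Quotient.mk I (monomial (linkExponentAt (N + 2) G v A) (z A)) =
      Ideal.Quotient.mk I (monomial (linkExponent T G A) (z A)) := by
    have h4 : ∏ w ∈ A, (X w : MvPolynomial (Fin n) K) ^ s =
        monomial (∑ w ∈ A, Finsupp.single w s) 1 := by
      rw [monomial_sum_one]
      exact Finset.prod_congr rfl fun w _ => X_pow_eq_monomial
    rw [← linkExponentAt_add hv hGA, h4, X_pow_eq_monomial, smul_smul, monomial_mul]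
    change Ideal.Quotient.mk I (_ * _) = _
    rw [monomial_mul]
    congr 2
    · ac_rfl
    · ring
  rw [h2, h3, Ideal.Quotient.eq] at h1
  have h5 := coeff_eq_zero_of_mem hΔ h1 (m := linkExponent T G A)
    (by rwa [linkExponent_support (by omega)])
  rw [coeff_sub, coeff_monomial, if_pos rfl, sub_eq_zero] at h5
  rw [← h5, koszulD, coeff_sum]
  refine Finset.sum_congr rfl fun w hw => ?_
  rw [← coeffAddMonoidHom_apply, map_zsmul, coeffAddMonoidHom_apply]
  congr 1
  rw [X_pow_eq_monomial, coeff_monomial_mul']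
  beta_reduce
  by_cases hwG : w ∈ G
  · rw [if_neg (fun h : G ⊆ A.erase w => by simpa using h hwG), if_neg]
    intro h
    have := h w
    rw [linkExponent_apply, if_pos hw, if_pos hwG, Finsupp.single_eq_same] at this
    omega
  · rw [if_pos (Finset.subset_erase.mpr ⟨hGA, hwG⟩), linkExponent_eq_add hw hwG,
      if_pos (by exact le_self_add), one_mul, add_tsub_cancel_left]

end LinkOfBuchsbaum

section TopExt

variable {n : ℕ} {R : Type} [CommRing R] {x : Fin n → R} {Δ : Finset (Finset (Fin n))}

lemma cochainD_eq_koszulD_sub (g : Finset (Fin n) → Finset (Fin n) → R) (F A : Finset (Fin n)) :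
    cochainD x g F A = koszulD x (g F) A -
      ∑ v ∈ A, incSign v A • g (insert v F) (A.erase v) := by
  simp only [cochainD, koszulD, smul_sub, Finset.sum_sub_distrib, smul_eq_mul]

lemma cochainD_sub (g w : Finset (Fin n) → Finset (Fin n) → R) (F A : Finset (Fin n)) :
    cochainD x (fun F A => g F A - w F A) F A = cochainD x g F A - cochainD x w F A := by
  simp only [cochainD, ← Finset.sum_sub_distrib, ← smul_sub, smul_eq_mul]
  exact Finset.sum_congr rfl fun v _ => by ring_nf

lemma disjoint_erase_insert {F A : Finset (Fin n)} (hd : Disjoint F A) (v : Fin n) :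
    Disjoint (insert v F) (A.erase v) :=
  Finset.disjoint_insert_left.mpr ⟨by simp, hd.mono_right (Finset.erase_subset _ _)⟩

lemma subset_compl_of_disjoint {F A : Finset (Fin n)} (hd : Disjoint F A) : A ⊆ Fᶜ :=
  Finset.subset_compl_iff_disjoint_left.mpr hd

/-- A cochain vanishing on the faces with more than `m` vertices agrees with a coboundary on the
faces with at least `m` vertices. -/
lemma exists_cochainD_row (hx : IsStronglyRegular x) {c m : ℕ}
    {g : Finset (Fin n) → Finset (Fin n) → R} (hg0 : ∀ F ∉ Δ, ∀ A, g F A = 0)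
    (hgc : ∀ F ∈ Δ, F.card = m → ∀ A, Disjoint F A → A.card = c + 1 → cochainD x g F A = 0)
    (hrow : ∀ F ∈ Δ, m < F.card → ∀ A, Disjoint F A → A.card = c → g F A = 0)
    (htop : ∀ F ∈ Δ, F.card = m →
      c < (Fᶜ).card ∨ g F Fᶜ ∈ Ideal.span (x '' (Fᶜ : Finset (Fin n)))) :
    ∃ w : Finset (Fin n) → Finset (Fin n) → R, (∀ F, ¬ (F ∈ Δ ∧ F.card = m) → ∀ A, w F A = 0) ∧
      ∀ F ∈ Δ, m ≤ F.card → ∀ A, Disjoint F A → A.card = c → cochainD x w F A = g F A := by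
  have hg0' : ∀ F, m < F.card → ∀ A, Disjoint F A → A.card = c → g F A = 0 := fun F hF => by
    by_cases h : F ∈ Δ
    · exact hrow F h hF
    · exact fun A _ _ => hg0 F h A
  have key : ∀ F : Finset (Fin n), ∃ w : Finset (Fin n) → R, F ∈ Δ → F.card = m →
      ∀ A ⊆ Fᶜ, A.card = c → koszulD x w A = g F A := by
    intro F
    by_cases hF : F ∈ Δ ∧ F.card = m
    · obtain ⟨w, hw⟩ := exists_koszulD_eq hx Fᶜ c (g F) (fun A hA hAc => by
        have hd : Disjoint F A := Finset.subset_compl_iff_disjoint_left.mp hA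
        rw [← hgc F hF.1 hF.2 A hd hAc, cochainD_eq_koszulD_sub, eq_comm, sub_eq_self]
        refine Finset.sum_eq_zero fun v hv => ?_
        have hvF : v ∉ F := Finset.disjoint_right.mp hd hv
        rw [hg0' _ (by rw [Finset.card_insert_of_notMem hvF]; omega) _
          (disjoint_erase_insert hd v) (by rw [Finset.card_erase_of_mem hv]; omega), smul_zero])
        (htop F hF.1 hF.2)
      exact ⟨w, fun _ _ => hw⟩
    · exact ⟨0, fun h1 h2 => absurd ⟨h1, h2⟩ hF⟩
  choose w hw using key
  classical
  refine ⟨fun F A => if F ∈ Δ ∧ F.card = m then w F A else 0, fun F hF A => if_neg hF,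
    fun F hF hFm A hd hA => ?_⟩
  have h0 : ∀ v ∈ A, (if insert v F ∈ Δ ∧ (insert v F).card = m then
      w (insert v F) (A.erase v) else 0) = 0 := fun v hv => by
    rw [if_neg]
    rw [Finset.card_insert_of_notMem (Finset.disjoint_right.mp hd hv)]
    omega
  rw [cochainD_eq_koszulD_sub, Finset.sum_eq_zero fun v hv => by rw [h0 v hv, smul_zero], sub_zero]
  rcases hFm.eq_or_lt with h | h
  · simp only [hF, h.symm, and_self, if_true]
    exact hw F hF h.symm A (subset_compl_of_disjoint hd) hA
  · simp only [hF, h.ne', and_false, if_false]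
    rw [hg0' F h A hd hA]
    simp [koszulD]

/-- A cocycle of degree `n - d` whose components on the facets of dimension `d - 1` vanish modulo
the corresponding primes is a coboundary. -/
lemma exists_cochainD_eq (hx : IsStronglyRegular x) (hΔ : IsSimplicialComplex Δ) {d : ℕ}
    (hd : ∀ F ∈ Δ, F.card ≤ d) (hdn : d ≤ n)
    {g : Finset (Fin n) → Finset (Fin n) → R} (hg0 : ∀ F ∉ Δ, ∀ A, g F A = 0)
    (hgc : ∀ F ∈ Δ, ∀ A, Disjoint F A → A.card = n - d + 1 → cochainD x g F A = 0)
    (htop : ∀ F ∈ Δ, F.card = d → g F Fᶜ ∈ Ideal.span (x '' (Fᶜ : Finset (Fin n)))) :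
    ∃ w : Finset (Fin n) → Finset (Fin n) → R, (∀ F ∉ Δ, ∀ A, w F A = 0) ∧
      ∀ F ∈ Δ, ∀ A, Disjoint F A → A.card = n - d → cochainD x w F A = g F A := by
  suffices H : ∀ m : ℕ, m ≤ d + 1 → ∀ g : Finset (Fin n) → Finset (Fin n) → R,
      (∀ F ∉ Δ, ∀ A, g F A = 0) →
      (∀ F ∈ Δ, ∀ A, Disjoint F A → A.card = n - d + 1 → cochainD x g F A = 0) →
      (∀ F ∈ Δ, F.card = d → g F Fᶜ ∈ Ideal.span (x '' (Fᶜ : Finset (Fin n)))) →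
      (∀ F ∈ Δ, m ≤ F.card → ∀ A, Disjoint F A → A.card = n - d → g F A = 0) →
      ∃ w : Finset (Fin n) → Finset (Fin n) → R, (∀ F ∉ Δ, ∀ A, w F A = 0) ∧
        ∀ F ∈ Δ, ∀ A, Disjoint F A → A.card = n - d → cochainD x w F A = g F A from
    H (d + 1) le_rfl g hg0 hgc htop fun F hF h => absurd (hd F hF) (by omega)
  intro m
  induction m with
  | zero =>
    intro _ g _ _ _ h
    refine ⟨fun _ _ => 0, fun _ _ _ => rfl, fun F hF A hdis hA => ?_⟩
    rw [h F hF (Nat.zero_le _) A hdis hA]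
    simp [cochainD]
  | succ m ih =>
    intro hm g hg0 hgc htop hrow
    obtain ⟨w, hw0, hw⟩ := exists_cochainD_row hx hg0 (fun F hF _ => hgc F hF)
      (fun F hF h => hrow F hF h) (fun F hF hFm => by
        rcases (show m ≤ d by omega).eq_or_lt with h | h
        · exact Or.inr (htop F hF (hFm.trans h))
        · left
          rw [Finset.card_compl, Fintype.card_fin]
          omega)
    have hw0' : ∀ F ∉ Δ, ∀ A, w F A = 0 := fun F hF => hw0 F fun h => hF h.1
    have hz : ∀ F ∈ Δ, m ≤ F.card → ∀ A, Disjoint F A → A.card = n - d →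
        g F A - cochainD x w F A = 0 := fun F hF h A hdis hA => by
      rw [hw F hF h A hdis hA, sub_self]
    obtain ⟨w', hw0'', hw'⟩ := ih (by omega) (fun F A => g F A - cochainD x w F A)
      (fun F hF A => by
        rw [hg0 F hF, cochainD_eq_zero_of_notMem hΔ hw0' hF, sub_zero])
      (fun F hF A hdis hA => by
        rw [cochainD_sub, hgc F hF A hdis hA, zero_sub, neg_eq_zero]
        exact cochainD_cochainD w F A)
      (fun F hF hFd => by
        rw [hz F hF (by omega) _ disjoint_compl_right
          (by rw [Finset.card_compl, Fintype.card_fin, hFd])]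
        exact zero_mem _)
      hz
    refine ⟨fun F A => w' F A - (-w F A), fun F hF A => by
      beta_reduce; rw [hw0'' F hF, hw0' F hF]; simp,
      fun F hF A hdis hA => ?_⟩
    have hneg : cochainD x (fun F A => -w F A) F A = - cochainD x w F A := by
      have := cochainD_sub (x := x) (fun _ _ => 0) w F A
      simp only [zero_sub] at this
      rw [this]
      simp [cochainD]
    rw [cochainD_sub, hw' F hF A hdis hA, hneg]
    ring

/-- Prescribed components on the facets extend to a cocycle as soon as they satisfy the
evident congruences in codimension one. -/
lemma exists_cocycle (hx : IsStronglyRegular x) (hΔ : IsSimplicialComplex Δ) {d : ℕ} (hdn : d ≤ n)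
    {y : Finset (Fin n) → R} (hy0 : ∀ F ∉ Δ, y F = 0)
    (hy : ∀ B ∈ Δ, B.card + 1 = d → ∑ v ∈ Bᶜ, incSign v Bᶜ • y (insert v B) ∈
      Ideal.span (x '' (Bᶜ : Finset (Fin n)))) :
    ∃ g : Finset (Fin n) → Finset (Fin n) → R, (∀ F ∉ Δ, ∀ A, g F A = 0) ∧
      (∀ F ∈ Δ, ∀ A, Disjoint F A → A.card = n - d + 1 → cochainD x g F A = 0) ∧
      ∀ F ∈ Δ, F.card = d → g F Fᶜ = y F := by
  suffices H : ∀ m k : ℕ, k + m = d → ∃ g : Finset (Fin n) → Finset (Fin n) → R,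
      (∀ F, ¬ (F ∈ Δ ∧ k ≤ F.card) → ∀ A, g F A = 0) ∧
      (∀ F ∈ Δ, k ≤ F.card → ∀ A, Disjoint F A → A.card = n - d + 1 → cochainD x g F A = 0) ∧
      ∀ F ∈ Δ, F.card = d → g F Fᶜ = y F by
    obtain ⟨g, h1, h2, h3⟩ := H d 0 (zero_add d)
    exact ⟨g, fun F hF => h1 F fun h => hF h.1, fun F hF => h2 F hF (Nat.zero_le _), h3⟩
  intro m
  induction m with
  | zero =>
    intro k hk
    classical
    refine ⟨fun F _ => if F ∈ Δ ∧ k ≤ F.card then y F else 0, fun F hF A => if_neg hF,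
      fun F hF hkF A hdis hA => ?_, fun F hF hFd => if_pos ⟨hF, by omega⟩⟩
    have := Finset.card_le_univ (F ∪ A)
    rw [Finset.card_union_of_disjoint hdis, Fintype.card_fin] at this
    omega
  | succ m ih =>
    intro k hk
    obtain ⟨g, hg0, hgc, hgy⟩ := ih (k + 1) (by omega)
    have hg0' : ∀ F ∉ Δ, ∀ A, g F A = 0 := fun F hF => hg0 F fun h => hF h.1
    have hc0 : ∀ F : Finset (Fin n), k + 1 ≤ F.card → ∀ A, Disjoint F A → A.card = n - d + 1 →
        cochainD x g F A = 0 := fun F hF => by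
      by_cases h : F ∈ Δ
      · exact hgc F h hF
      · exact fun A _ _ => cochainD_eq_zero_of_notMem hΔ hg0' h A
    obtain ⟨w, hw0, hw⟩ := exists_cochainD_row (c := n - d + 1) (m := k) hx
      (g := cochainD x g) (fun F hF A => cochainD_eq_zero_of_notMem hΔ hg0' hF A)
      (fun F _ _ A _ _ => cochainD_cochainD g F A)
      (fun F _ h => hc0 F h)
      (fun F hF hFk => by
        have hcard : (Fᶜ).card = n - k := by rw [Finset.card_compl, Fintype.card_fin, hFk]
        rcases (show k + 1 ≤ d by omega).eq_or_lt with h | h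
        · right
          rw [cochainD_eq_koszulD_sub]
          refine sub_mem (koszulD_mem _ _) ?_
          convert hy F hF (by omega) using 1
          refine Finset.sum_congr rfl fun v hv => ?_
          rw [← Finset.compl_insert]
          have hvF := Finset.mem_compl.mp hv
          by_cases hF' : insert v F ∈ Δ
          · rw [hgy _ hF' (by rw [Finset.card_insert_of_notMem hvF]; omega)]
          · rw [hg0' _ hF', hy0 _ hF']
        · left; omega)
    have hw1 : ∀ F : Finset (Fin n), F.card ≠ k → ∀ A, w F A = 0 :=
      fun F h => hw0 F fun h' => h h'.2
    refine ⟨fun F A => g F A - w F A, fun F hF A => ?_, fun F hF hkF A hdis hA => ?_,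
      fun F hF hFd => ?_⟩
    · beta_reduce
      rw [hg0 F fun h => hF ⟨h.1, by omega⟩, hw0 F fun h => hF ⟨h.1, by omega⟩, sub_zero]
    · rw [cochainD_sub, hw F hF hkF A hdis hA, sub_self]
    · beta_reduce
      rw [hw1 F (by omega), hgy F hF hFd, sub_zero]

/-- The sign `(-1) ^ ∑ w ∈ F, w`. -/
def posSign (F : Finset (Fin n)) : ℤ := ∏ w ∈ F, (-1) ^ (w : ℕ)

lemma posSign_mul_self (F : Finset (Fin n)) : posSign F * posSign F = 1 := by
  rw [posSign, ← Finset.prod_mul_distrib]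
  exact Finset.prod_eq_one fun w _ => by rw [← pow_add, Even.neg_one_pow ⟨_, rfl⟩]

lemma incSign_compl (v : Fin n) (B : Finset (Fin n)) :
    incSign v Bᶜ = (-1) ^ (v : ℕ) * incSign v B := by
  have h : (Bᶜ.filter (· < v)).card + (B.filter (· < v)).card = (v : ℕ) := by
    rw [← Finset.card_union_of_disjoint (Finset.disjoint_filter_filter
      disjoint_compl_left), ← Finset.filter_union, Finset.union_comm, Finset.union_compl,
      ← Fin.card_Iio]
    congr 1
    ext w
    simp
  rw [incSign, incSign, ← h, pow_add, mul_assoc, ← pow_add _ (B.filter _).card,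
    Even.neg_one_pow ⟨(B.filter (· < v)).card, rfl⟩, mul_one]

lemma incSign_mul_posSign {v : Fin n} {B : Finset (Fin n)} (hv : v ∉ B) :
    incSign v B * posSign (insert v B) = posSign B * incSign v Bᶜ := by
  rw [posSign, Finset.prod_insert hv, ← posSign, incSign_compl]
  ring

end TopExt

section FaceComplex

variable {n : ℕ} {R : Type} [CommRing R] (x : Fin n → R) (Δ : Finset (Finset (Fin n)))

/-- The ideal generated by the elements `x v` with `v` outside of `F`. -/
def faceP (F : Finset (Fin n)) : Ideal R := Ideal.span (x '' (Fᶜ : Finset (Fin n)))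

lemma faceP_le {F G : Finset (Fin n)} (h : G ⊆ F) : faceP x F ≤ faceP x G :=
  Ideal.span_mono (Set.image_mono (Finset.coe_subset.mpr (Finset.compl_subset_compl.mpr h)))

/-- Families of elements of the quotients `R ⧸ faceP x F`. -/
abbrev FaceProd : Type := ∀ F : Finset (Fin n), R ⧸ faceP x F

/-- The projection between quotients attached to an inclusion of faces. -/
noncomputable def restr (F G : Finset (Fin n)) : (R ⧸ faceP x F) →ₗ[R] R ⧸ faceP x G :=
  if h : G ⊆ F then Submodule.factor (faceP_le x h) else 0

variable {x} in
lemma restr_mk {F G : Finset (Fin n)} (h : G ⊆ F) (r : R) :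
    restr x F G (Ideal.Quotient.mk _ r) = Ideal.Quotient.mk _ r := by
  rw [restr, dif_pos h]
  rfl

/-- The boundary map on families indexed by faces. -/
noncomputable def faceBd : FaceProd x →ₗ[R] FaceProd x :=
  LinearMap.pi fun B => ∑ v ∈ Bᶜ, incSign v B • restr x (insert v B) B ∘ₗ LinearMap.proj (insert v B)

/-- The family of residue classes of a family of ring elements. -/
def toFaceProd : (Finset (Fin n) → R) →ₗ[R] FaceProd x :=
  LinearMap.pi fun F => (faceP x F).mkQ ∘ₗ LinearMap.proj F

variable {x}

lemma toFaceProd_apply (y : Finset (Fin n) → R) (F : Finset (Fin n)) :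
    toFaceProd x y F = Ideal.Quotient.mk _ (y F) := rfl

lemma toFaceProd_surjective : Function.Surjective (toFaceProd x) := fun z => by
  choose y hy using fun F => Ideal.Quotient.mk_surjective (z F)
  exact ⟨y, funext hy⟩

lemma toFaceProd_apply_eq_zero {y : Finset (Fin n) → R} {F : Finset (Fin n)} :
    toFaceProd x y F = 0 ↔ y F ∈ faceP x F := Ideal.Quotient.eq_zero_iff_mem

lemma faceBd_apply (z : FaceProd x) (B : Finset (Fin n)) :
    faceBd x z B = ∑ v ∈ Bᶜ, incSign v B • restr x (insert v B) B (z (insert v B)) := by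
  simp [faceBd, LinearMap.sum_apply]

lemma faceBd_toFaceProd (y : Finset (Fin n) → R) :
    faceBd x (toFaceProd x y) = toFaceProd x (bdry y) := by
  ext B
  rw [faceBd_apply, toFaceProd_apply, bdry, map_sum]
  refine Finset.sum_congr rfl fun v _ => ?_
  rw [map_zsmul, toFaceProd_apply, restr_mk (Finset.subset_insert _ _)]

lemma faceBd_faceBd (z : FaceProd x) : faceBd x (faceBd x z) = 0 := by
  obtain ⟨y, rfl⟩ := toFaceProd_surjective z
  rw [faceBd_toFaceProd, faceBd_toFaceProd, (funext (bdry_bdry y) : bdry (bdry y) = 0), map_zero]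

variable (x)

/-- Families supported on the faces with `j` vertices. -/
def faceChains (j : ℕ) : Submodule R (FaceProd x) where
  carrier := {z | ∀ F, ¬ (F ∈ Δ ∧ F.card = j) → z F = 0}
  zero_mem' := fun _ _ => rfl
  add_mem' := fun ha hb F hF => by rw [Pi.add_apply, ha F hF, hb F hF, add_zero]
  smul_mem' := fun r z hz F hF => by rw [Pi.smul_apply, hz F hF, smul_zero]

/-- The cycles among the families supported on the faces with `j` vertices. -/
noncomputable def faceCycles (j : ℕ) : Submodule R (FaceProd x) :=
  faceChains x Δ j ⊓ LinearMap.ker (faceBd x)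

/-- The boundaries among the families supported on the faces with `j` vertices. -/
noncomputable def faceBoundaries (j : ℕ) : Submodule R (FaceProd x) :=
  (faceChains x Δ (j + 1)).map (faceBd x)

variable {x Δ}

lemma faceBd_mem_faceChains (hΔ : IsSimplicialComplex Δ) {j : ℕ} {z : FaceProd x}
    (hz : z ∈ faceChains x Δ (j + 1)) : faceBd x z ∈ faceChains x Δ j := by
  intro F hF
  rw [faceBd_apply]
  refine Finset.sum_eq_zero fun v hv => ?_
  have hv' := Finset.mem_compl.mp hv
  rw [hz _ fun h => hF ⟨hΔ _ h.1 _ (Finset.subset_insert _ _), by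
    have := Finset.card_insert_of_notMem hv'
    omega⟩, map_zero, smul_zero]

lemma faceBoundaries_le_faceCycles (hΔ : IsSimplicialComplex Δ) (j : ℕ) :
    faceBoundaries x Δ j ≤ faceCycles x Δ j := by
  rintro _ ⟨z, hz, rfl⟩
  exact ⟨faceBd_mem_faceChains hΔ hz, faceBd_faceBd z⟩

/-- A family supported on faces with `j` vertices lifts to such a family of ring elements. -/
lemma exists_toFaceProd_eq {j : ℕ} {z : FaceProd x} (hz : z ∈ faceChains x Δ j) :
    ∃ y : Finset (Fin n) → R, (∀ F, ¬ (F ∈ Δ ∧ F.card = j) → y F = 0) ∧ toFaceProd x y = z := by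
  classical
  obtain ⟨y, rfl⟩ := toFaceProd_surjective z
  refine ⟨fun F => if F ∈ Δ ∧ F.card = j then y F else 0, fun F hF => if_neg hF,
    funext fun F => ?_⟩
  by_cases hF : F ∈ Δ ∧ F.card = j
  · rw [toFaceProd_apply, if_pos hF, toFaceProd_apply]
  · rw [toFaceProd_apply, if_neg hF, map_zero, hz F hF]

/-- The top coefficients of a cochain. -/
noncomputable def topCoeff (hΔ : IsSimplicialComplex Δ) (d : ℕ) :
    ((resComplex x hΔ).X (n - d) ⟶ ModuleCat.of R R) →ₗ[R] FaceProd x where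
  toFun f := toFaceProd x fun F => if F ∈ Δ ∧ F.card = d then
    posSign F • f.hom (resBasis R Δ (n - d) F Fᶜ) else 0
  map_add' f f' := by
    rw [← map_add]
    congr 1
    ext F
    rw [Pi.add_apply]
    split_ifs
    · rw [← smul_add]; rfl
    · rw [add_zero]
  map_smul' r f := by
    rw [RingHom.id_apply, ← map_smul]
    congr 1
    ext F
    rw [Pi.smul_apply]
    split_ifs
    · rw [smul_comm]; rfl
    · rw [smul_zero]

/-- `Ext` of the face ring into the ambient ring, as the top cycle module. -/
lemma nonempty_ext_equiv_faceCycles (hx : IsStronglyRegular x) (hΔ : IsSimplicialComplex Δ)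
    {d : ℕ} (hd : ∀ F ∈ Δ, F.card ≤ d) (hdn : d ≤ n) :
    Nonempty (((Ext R (ModuleCat.{0} R) (n - d)).obj
      (op (ModuleCat.of R (R ⧸ faceIdeal x Δ)))).obj (ModuleCat.of R R) ≃ₗ[R]
        faceCycles x Δ d) := by
  have hcompl : ∀ {F : Finset (Fin n)}, F.card = d → (Fᶜ).card = n - d := fun h => by
    rw [Finset.card_compl, Fintype.card_fin, h]
  have htop : ∀ {g : Finset (Fin n) → Finset (Fin n) → R}, (∀ F ∉ Δ, ∀ A, g F A = 0) →
      topCoeff hΔ d (homOf (x := x) (Y := ModuleCat.of R R) hΔ (n - d) g) =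
      toFaceProd x fun F => if F ∈ Δ ∧ F.card = d then posSign F • g F Fᶜ else 0 := by
    intro g hg
    refine congrArg (toFaceProd x) (funext fun F => ?_)
    refine if_ctx_congr Iff.rfl (fun h => ?_) fun _ => rfl
    rw [homOf_resBasis hg disjoint_compl_right (hcompl h.2)]
  refine nonempty_ext_equiv (P := resolution hx hΔ) (faceCycles x Δ d) (topCoeff hΔ d) ?_ ?_
  · intro z
    constructor
    · rintro ⟨hz, hz'⟩
      obtain ⟨y, hy0, rfl⟩ := exists_toFaceProd_eq hz
      rw [SetLike.mem_coe, LinearMap.mem_ker, faceBd_toFaceProd] at hz'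
      obtain ⟨g, hg0, hgc, hgy⟩ := exists_cocycle hx hΔ hdn (y := fun F => posSign F • y F)
        (fun F hF => by rw [hy0 F fun h => hF h.1, smul_zero]) (fun B hB hBd => by
          have h1 := congrFun hz' B
          rw [Pi.zero_apply, toFaceProd_apply_eq_zero] at h1
          have h2 : ∑ v ∈ Bᶜ, incSign v Bᶜ • posSign (insert v B) • y (insert v B) =
              posSign B • bdry y B := by
            rw [bdry, Finset.smul_sum]
            refine Finset.sum_congr rfl fun v hv => ?_
            rw [smul_smul, smul_smul]
            congr 1
            have h3 := incSign_mul_posSign (Finset.mem_compl.mp hv)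
            calc incSign v Bᶜ * posSign (insert v B)
                = incSign v Bᶜ * posSign (insert v B) * (incSign v B * incSign v B) := by
                  rw [incSign_mul_self, mul_one]
              _ = incSign v Bᶜ * (incSign v B * posSign (insert v B)) * incSign v B := by ring
              _ = (incSign v Bᶜ * incSign v Bᶜ) * (posSign B * incSign v B) := by rw [h3]; ring
              _ = posSign B * incSign v B := by rw [incSign_mul_self, one_mul]
          rw [h2]
          exact zsmul_mem h1 _)
      refine ⟨homOf hΔ (n - d) g, (d_homOf_eq_zero_iff hg0).mpr hgc, (htop hg0).trans ?_⟩
      congr 1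
      ext F
      by_cases hF : F ∈ Δ ∧ F.card = d
      · rw [if_pos hF, hgy F hF.1 hF.2, smul_smul, posSign_mul_self, one_smul]
      · rw [if_neg hF, hy0 F hF]
    · rintro ⟨f, hf, rfl⟩
      obtain ⟨g, hg0, rfl⟩ := exists_homOf (hΔ := hΔ) f
      replace hf := (d_homOf_eq_zero_iff hg0).mp hf
      change topCoeff (x := x) hΔ d (homOf (x := x) (Y := ModuleCat.of R R) hΔ (n - d) g) ∈ _
      rw [htop hg0]
      refine ⟨fun F hF => ?_, ?_⟩
      · rw [toFaceProd_apply, if_neg hF, map_zero]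
      · rw [SetLike.mem_coe, LinearMap.mem_ker, faceBd_toFaceProd]
        ext B
        rw [Pi.zero_apply, toFaceProd_apply_eq_zero]
        by_cases hB : B ∈ Δ ∧ B.card + 1 = d
        · have h1 := hf B hB.1 Bᶜ disjoint_compl_right (by
            rw [Finset.card_compl, Fintype.card_fin]; omega)
          rw [cochainD_eq_koszulD_sub, sub_eq_zero] at h1
          have h2 := koszulD_mem (x := x) (g B) Bᶜ
          rw [h1] at h2
          have h3 : _ ∈ faceP x B := zsmul_mem h2 (posSign B)
          convert h3 using 1
          rw [bdry, Finset.smul_sum]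
          refine Finset.sum_congr rfl fun v hv => ?_
          have hvB := Finset.mem_compl.mp hv
          rw [← Finset.compl_insert, smul_smul, ← incSign_mul_posSign hvB, ← smul_smul]
          congr 1
          split_ifs with h
          · rfl
          · rw [hg0 _ fun h' => h ⟨h', by rw [Finset.card_insert_of_notMem hvB, hB.2]⟩, smul_zero]
        · convert zero_mem (faceP x B)
          refine Finset.sum_eq_zero fun v hv => ?_
          have hvB := Finset.mem_compl.mp hv
          beta_reduce
          rw [if_neg, smul_zero]
          rintro ⟨h1, h2⟩
          rw [Finset.card_insert_of_notMem hvB] at h2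
          exact hB ⟨hΔ _ h1 _ (Finset.subset_insert _ _), h2⟩
  · intro f hf
    obtain ⟨g, hg0, rfl⟩ := exists_homOf (hΔ := hΔ) f
    replace hf := (d_homOf_eq_zero_iff hg0).mp hf
    refine Iff.trans ?_ (exists_d_comp_eq_homOf_iff hg0).symm
    change topCoeff (x := x) hΔ d (homOf (x := x) (Y := ModuleCat.of R R) hΔ (n - d) g) = 0 ↔ _
    rw [htop hg0]
    constructor
    · intro h
      refine exists_cochainD_eq hx hΔ hd hdn hg0 hf fun F hF hFd => ?_
      have h1 := congrFun h F
      rw [Pi.zero_apply, toFaceProd_apply_eq_zero, if_pos ⟨hF, hFd⟩] at h1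
      have h2 := zsmul_mem h1 (posSign F)
      rwa [smul_smul, posSign_mul_self, one_smul] at h2
    · rintro ⟨w, hw0, hw⟩
      ext F
      rw [Pi.zero_apply, toFaceProd_apply_eq_zero]
      split_ifs with hF
      · refine zsmul_mem ?_ _
        rw [← hw F hF.1 Fᶜ disjoint_compl_right (hcompl hF.2)]
        have : cochainD x w F Fᶜ = koszulD x (w F) Fᶜ := by
          rw [cochainD_eq_koszulD_sub, sub_eq_self]
          refine Finset.sum_eq_zero fun v hv => ?_
          rw [hw0 _ fun h => ?_, smul_zero]
          have := hd _ h
          rw [Finset.card_insert_of_notMem (Finset.mem_compl.mp hv)] at this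
          omega
        exact this ▸ koszulD_mem _ _
      · exact zero_mem _

end FaceComplex

section Graded

variable {K : Type} [Field K] {n : ℕ} {Δ : Finset (Finset (Fin n))}

lemma mem_faceP_X_iff {F : Finset (Fin n)} {p : MvPolynomial (Fin n) K} :
    p ∈ faceP X F ↔ ∀ m : Fin n →₀ ℕ, m.support ⊆ F → coeff m p = 0 := by
  rw [faceP, mem_ideal_span_X_image]
  constructor
  · intro h m hm
    by_contra hc
    obtain ⟨v, hv, hv'⟩ := h m (mem_support_iff.mpr hc)
    exact Finset.mem_compl.mp (Finset.mem_coe.mp hv) (hm (Finsupp.mem_support_iff.mpr hv'))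
  · intro h m hm
    by_contra! hc
    refine mem_support_iff.mp hm (h m fun v hv => ?_)
    by_contra hvF
    exact Finsupp.mem_support_iff.mp hv (hc v (by simpa using hvF))

lemma coeff_bdry (m : Fin n →₀ ℕ) (y : Finset (Fin n) → MvPolynomial (Fin n) K)
    (B : Finset (Fin n)) : coeff m (bdry y B) = bdry (fun A => coeff m (y A)) B :=
  map_bdry (coeffAddMonoidHom m) y B

lemma toFaceProd_X_eq_iff {y y' : Finset (Fin n) → MvPolynomial (Fin n) K} :
    toFaceProd X y = toFaceProd X y' ↔
      ∀ (m : Fin n →₀ ℕ) (B : Finset (Fin n)), m.support ⊆ B →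
        coeff m (y B) = coeff m (y' B) := by
  rw [funext_iff]
  simp only [toFaceProd_apply, Ideal.Quotient.eq, mem_faceP_X_iff, coeff_sub, sub_eq_zero]
  exact ⟨fun h m B hm => h B m hm, fun h B m hm => h m B hm⟩

/-- A family is a boundary as soon as its homogeneous components are. -/
lemma toFaceProd_mem_faceBoundaries {j : ℕ} {y : Finset (Fin n) → MvPolynomial (Fin n) K}
    (h : ∀ m : Fin n →₀ ℕ, ∃ b : Finset (Fin n) → K, (∀ A, b A ≠ 0 → A ∈ Δ ∧ A.card = j + 1) ∧
      ∀ B, m.support ⊆ B → bdry b B = coeff m (y B)) :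
    toFaceProd X y ∈ faceBoundaries X Δ j := by
  classical
  choose b hb hby using h
  let M : Finset (Fin n →₀ ℕ) := Finset.univ.biUnion fun A => (y A).support
  let u : Finset (Fin n) → MvPolynomial (Fin n) K := fun A => ∑ m ∈ M, monomial m (b m A)
  have hu : ∀ m A, coeff m (u A) = if m ∈ M then b m A else 0 := fun m A => by
    simp only [u, coeff_sum, coeff_monomial]
    exact Finset.sum_ite_eq' M m _
  refine ⟨toFaceProd X u, fun F hF => ?_, ?_⟩
  · rw [toFaceProd_apply]
    have : u F = 0 := Finset.sum_eq_zero fun m _ => by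
      rw [by_contra fun hc => hF (hb m F hc), map_zero]
    rw [this, map_zero]
  · rw [faceBd_toFaceProd, toFaceProd_X_eq_iff]
    intro m B hm
    rw [coeff_bdry]
    simp only [hu]
    by_cases hM : m ∈ M
    · simp only [hM, if_true]
      exact hby m B hm
    · simp only [hM, if_false]
      rw [bdry_zero]
      by_contra hc
      exact hM (Finset.mem_biUnion.mpr ⟨B, Finset.mem_univ _, mem_support_iff.mpr (Ne.symm hc)⟩)

lemma faceCycles_le_faceBoundaries {j : ℕ} (h : ∀ G : Finset (Fin n), LinkExact K Δ G j) :
    faceCycles (X : Fin n → MvPolynomial (Fin n) K) Δ j ≤ faceBoundaries X Δ j := by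
  classical
  rintro z ⟨hz, hz'⟩
  obtain ⟨y, hy0, rfl⟩ := exists_toFaceProd_eq hz
  rw [SetLike.mem_coe, LinearMap.mem_ker, faceBd_toFaceProd,
    ← map_zero (toFaceProd X), toFaceProd_X_eq_iff] at hz'
  refine toFaceProd_mem_faceBoundaries fun m => ?_
  obtain ⟨b, hb, hby⟩ := h m.support (fun A => if m.support ⊆ A then coeff m (y A) else 0)
    (fun A hA => by
      by_cases hm : m.support ⊆ A
      · rw [if_pos hm] at hA
        have := by_contra fun hc => hA (by rw [hy0 A hc, coeff_zero])
        exact ⟨this.1, this.2, hm⟩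
      · rw [if_neg hm] at hA
        exact absurd rfl hA)
    (fun B hB => by
      rw [← (hz' m B hB).trans (coeff_zero m), coeff_bdry]
      exact bdry_congr fun v _ => if_pos (hB.trans (Finset.subset_insert _ _)))
  exact ⟨b, fun A hA => ⟨(hb A hA).1, (hb A hA).2.1⟩, fun B hB => by rw [hby B hB, if_pos hB]⟩

/-- The constant family attached to a chain with coefficients in the field. -/
noncomputable def constFamily (c : Finset (Fin n) → K) :
    FaceProd (X : Fin n → MvPolynomial (Fin n) K) := toFaceProd X fun A => C (c A)

lemma constFamily_mem_faceCycles {j : ℕ} {c : Finset (Fin n) → K}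
    (hc0 : ∀ A, c A ≠ 0 → A ∈ Δ ∧ A.card = j) (hc : ∀ B, bdry c B = 0) :
    constFamily c ∈ faceCycles X Δ j := by
  refine ⟨fun F hF => ?_, ?_⟩
  · rw [constFamily, toFaceProd_apply, by_contra fun h => hF (hc0 F h), C_0, map_zero]
  · rw [SetLike.mem_coe, LinearMap.mem_ker, constFamily, faceBd_toFaceProd,
      ← map_zero (toFaceProd X)]
    congr 1
    ext1 B
    rw [← map_bdry (C : K →+* MvPolynomial (Fin n) K) c B, hc, C_0]
    rfl

lemma X_smul_constFamily_mem {j : ℕ} {v : Fin n} (hv : LinkExact K Δ {v} j)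
    {c : Finset (Fin n) → K} (hc0 : ∀ A, c A ≠ 0 → A ∈ Δ ∧ A.card = j)
    (hc : ∀ B, bdry c B = 0) :
    (X v : MvPolynomial (Fin n) K) • constFamily c ∈ faceBoundaries X Δ j := by
  classical
  rw [constFamily, ← map_smul]
  refine toFaceProd_mem_faceBoundaries fun m => ?_
  have hcoeff : ∀ B, coeff m (((X v : MvPolynomial (Fin n) K) •
      fun A : Finset (Fin n) => (C (c A) : MvPolynomial (Fin n) K)) B) =
      if m = Finsupp.single v 1 then c B else 0 := fun B => by
    rw [Pi.smul_apply, smul_eq_mul, mul_comm, coeff_C_mul, coeff_X]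
    simp [eq_comm]
  simp only [hcoeff]
  by_cases hm : m = Finsupp.single v 1
  · subst hm
    obtain ⟨b, hb, hbc⟩ := hv (fun A => if v ∈ A then c A else 0)
      (fun A hA => by
        by_cases hvA : v ∈ A
        · rw [if_pos hvA] at hA
          exact ⟨(hc0 A hA).1, (hc0 A hA).2, by simpa using hvA⟩
        · rw [if_neg hvA] at hA
          exact absurd rfl hA)
      (fun B hB => by
        rw [← hc B]
        exact bdry_congr fun w _ => if_pos (Finset.mem_insert_of_mem (by simpa using hB)))
    refine ⟨b, fun A hA => ⟨(hb A hA).1, (hb A hA).2.1⟩, fun B hB => ?_⟩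
    have hvB : v ∈ B := hB (by simp)
    rw [hbc B (by simpa using hvB), if_pos hvB, if_pos rfl]
  · refine ⟨fun _ => 0, fun A hA => absurd rfl hA, fun B _ => ?_⟩
    rw [bdry_zero, if_neg hm]

lemma linkExact_empty {j : ℕ}
    (h : ∀ c : Finset (Fin n) → K, (∀ A, c A ≠ 0 → A ∈ Δ ∧ A.card = j) → (∀ B, bdry c B = 0) →
      constFamily c ∈ faceBoundaries X Δ j) : LinkExact K Δ ∅ j := by
  intro c hc0 hc
  obtain ⟨z, hz, hzc⟩ := h c (fun A hA => ⟨(hc0 A hA).1, (hc0 A hA).2.1⟩)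
    (fun B => hc B (Finset.empty_subset _))
  obtain ⟨u, hu0, rfl⟩ := exists_toFaceProd_eq hz
  rw [faceBd_toFaceProd, constFamily, toFaceProd_X_eq_iff] at hzc
  refine ⟨fun A => coeff 0 (u A), fun A hA => ?_, fun B _ => ?_⟩
  · have := by_contra fun hc => hA (by beta_reduce; rw [hu0 A hc, coeff_zero])
    exact ⟨this.1, this.2, Finset.empty_subset _⟩
  · rw [← coeff_bdry, hzc 0 B (by simp), coeff_zero_C]

lemma bdry_eq_zero_of_support (hΔ : IsSimplicialComplex Δ) {j : ℕ} {b : Finset (Fin n) → K}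
    (hb : ∀ A, b A ≠ 0 → A ∈ Δ ∧ A.card = j + 1) {B : Finset (Fin n)}
    (hB : ¬(B ∈ Δ ∧ B.card = j)) : bdry b B = 0 := by
  refine Finset.sum_eq_zero fun v hv => ?_
  have : b (insert v B) = 0 := by
    by_contra h
    obtain ⟨h1, h2⟩ := hb _ h
    rw [Finset.card_insert_of_notMem (Finset.mem_compl.mp hv)] at h2
    exact hB ⟨hΔ _ h1 _ (Finset.subset_insert _ _), by omega⟩
  rw [this, smul_zero]

/-- Vanishing of simplicial homology in terms of total functions. -/
lemma subsingleton_simpHomologySucc_iff (hΔ : IsSimplicialComplex Δ) (k : ℕ) :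
    Subsingleton (simpHomologySucc K Δ k) ↔ LinkExact K Δ ∅ (k + 2) := by
  classical
  have ext_bdry : ∀ (j : ℕ) (c : simpChains K Δ (j + 1)) (s : {s // s ∈ Δ ∧ s.card = j + 1}),
      simpBoundary K Δ j c s =
      bdry (fun A => if h : A ∈ Δ ∧ A.card = (j + 1) + 1 then c ⟨A, h⟩ else 0) s.1 := by
    intro j c s
    rw [bdry, simpBoundary, LinearMap.coe_mk, AddHom.coe_mk,
      ← Finset.sum_subset (Finset.subset_univ (s.1ᶜ)) (fun v _ hv => dif_neg fun h => hv (by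
        simpa using h.1))]
    refine Finset.sum_congr rfl fun v hv => ?_
    have hv' := Finset.mem_compl.mp hv
    by_cases h : insert v s.1 ∈ Δ ∧ (insert v s.1).card = (j + 1) + 1
    · rw [dif_pos ⟨hv', h⟩, dif_pos h, incSign, zsmul_eq_mul]
      push_cast
      rfl
    · rw [dif_neg fun h' => h h'.2, dif_neg h, smul_zero]
  rw [Submodule.Quotient.subsingleton_iff, Submodule.comap_subtype_eq_top]
  constructor
  · intro h c hc0 hc
    let c' : simpChains K Δ (k + 1) := fun s => c s.1
    have hcc : (fun A => if h : A ∈ Δ ∧ A.card = (k + 1) + 1 then c' ⟨A, h⟩ else 0) = c := by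
      ext A
      split_ifs with hA
      · rfl
      · by_contra hA'
        have := hc0 A (Ne.symm hA')
        exact hA ⟨this.1, this.2.1⟩
    obtain ⟨b, hb⟩ := h (show c' ∈ LinearMap.ker (simpBoundary K Δ k) from
      LinearMap.mem_ker.mpr (funext fun s => by
        rw [ext_bdry, hcc]
        exact hc _ (Finset.empty_subset _)))
    refine ⟨fun A => if h : A ∈ Δ ∧ A.card = (k + 1 + 1) + 1 then b ⟨A, h⟩ else 0,
      fun A hA => ?_, fun B _ => ?_⟩
    · have := by_contra fun h => hA (dif_neg h)
      exact ⟨this.1, this.2, Finset.empty_subset _⟩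
    · by_cases hB : B ∈ Δ ∧ B.card = k + 1 + 1
      · rw [← ext_bdry _ b ⟨B, hB⟩, hb]
      · rw [bdry_eq_zero_of_support hΔ (fun A hA => by_contra fun h => hA (dif_neg h)) hB]
        by_contra hA
        have := hc0 B (Ne.symm hA)
        exact hB ⟨this.1, this.2.1⟩
  · intro h c hc
    obtain ⟨b, hb0, hb⟩ := h
      (fun A => if h : A ∈ Δ ∧ A.card = (k + 1) + 1 then c ⟨A, h⟩ else 0)
      (fun A hA => by
        have := by_contra fun h => hA (dif_neg h)
        exact ⟨this.1, this.2, Finset.empty_subset _⟩)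
      (fun B _ => by
        by_cases hB : B ∈ Δ ∧ B.card = k + 1
        · rw [← ext_bdry _ c ⟨B, hB⟩, hc]
          rfl
        · exact bdry_eq_zero_of_support hΔ (fun A hA => by_contra fun h => hA (dif_neg h)) hB)
    refine ⟨fun s => b s.1, funext fun s => ?_⟩
    rw [ext_bdry, ← (hb s.1 (Finset.empty_subset _)).trans (dif_pos s.2)]
    refine bdry_congr fun v _ => ?_
    split_ifs with h'
    · rfl
    · by_contra hA
      have := hb0 _ (Ne.symm hA)
      exact h' ⟨this.1, this.2.1⟩

end Graded

section ExtVanishing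

variable {R : Type} [CommRing R] (N : ModuleCat.{0} R)

/-- Vanishing of the groups `Ext(N, M)` in degrees below `a`. -/
def ExtVanishes (a : ℕ) (M : Type) [AddCommGroup M] [Module R M] : Prop :=
  ∀ l < a, Subsingleton (Abelian.Ext N (ModuleCat.of R M) l)

variable {N} {M₁ M₂ M₃ : Type} [AddCommGroup M₁] [Module R M₁] [AddCommGroup M₂] [Module R M₂]
  [AddCommGroup M₃] [Module R M₃]

lemma ExtVanishes.mono {a b : ℕ} (h : ExtVanishes N b M₁) (hab : a ≤ b) : ExtVanishes N a M₁ :=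
  fun l hl => h l (hl.trans_le hab)

lemma extVanishes_of_sum_comp_eq_id {ι : Type} [Fintype ι] {P : ι → Type}
    [∀ i, AddCommGroup (P i)] [∀ i, Module R (P i)] (f : ∀ i, M₁ →ₗ[R] P i)
    (g : ∀ i, P i →ₗ[R] M₁) (hfg : ∑ i, g i ∘ₗ f i = LinearMap.id) {a : ℕ}
    (h : ∀ i, ExtVanishes N a (P i)) : ExtVanishes N a M₁ := by
  intro l hl
  refine subsingleton_of_forall_eq 0 fun e => ?_
  have hid : 𝟙 (ModuleCat.of R M₁) = ∑ i, ModuleCat.ofHom (f i) ≫ ModuleCat.ofHom (g i) := by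
    ext x
    simpa [ModuleCat.hom_sum] using (LinearMap.congr_fun hfg x).symm
  rw [← e.comp_mk₀_id, hid, Abelian.Ext.mk₀_sum, Abelian.Ext.comp_sum]
  refine Finset.sum_eq_zero fun i _ => ?_
  have := h i l hl
  rw [← Abelian.Ext.mk₀_comp_mk₀, ← Abelian.Ext.comp_assoc_of_third_deg_zero,
    Subsingleton.elim (e.comp (Abelian.Ext.mk₀ (ModuleCat.ofHom (f i))) (add_zero l)) 0,
    Abelian.Ext.zero_comp]

variable {f : M₁ →ₗ[R] M₂} {g : M₂ →ₗ[R] M₃}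

lemma shortExact_of_linearMap (hf : Function.Injective f) (hfg : Function.Exact f g)
    (hg : Function.Surjective g) :
    (ShortComplex.mk (ModuleCat.ofHom f) (ModuleCat.ofHom g)
      (ModuleCat.hom_ext hfg.linearMap_comp_eq_zero)).ShortExact where
  exact := ModuleCat.shortComplex_exact _ hfg
  mono_f := (ModuleCat.mono_iff_injective _).mpr hf
  epi_g := (ModuleCat.epi_iff_surjective _).mpr hg

lemma ExtVanishes.left {a : ℕ} (h₂ : ExtVanishes N (a + 1) M₂) (h₃ : ExtVanishes N a M₃)
    (hf : Function.Injective f) (hfg : Function.Exact f g) (hg : Function.Surjective g) :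
    ExtVanishes N (a + 1) M₁ := by
  intro l hl
  have hS := shortExact_of_linearMap hf hfg hg
  refine subsingleton_of_forall_eq 0 fun e => ?_
  have he : e.comp (Abelian.Ext.mk₀ (ModuleCat.ofHom f)) (add_zero l) = 0 :=
    (h₂ l hl).elim _ _
  rcases l with _ | l
  · have := hS.mono_f
    refine Abelian.Ext.postcomp_mk₀_injective_of_mono N (ModuleCat.ofHom f) ?_
    rw [map_zero]
    exact he
  · obtain ⟨e', rfl⟩ := Abelian.Ext.covariant_sequence_exact₁ N hS e he rfl
    have := h₃ l (by omega)
    rw [Subsingleton.elim e' 0, Abelian.Ext.zero_comp]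

lemma ExtVanishes.right {a : ℕ} (h₁ : ExtVanishes N (a + 1) M₁) (h₂ : ExtVanishes N a M₂)
    (hf : Function.Injective f) (hfg : Function.Exact f g) (hg : Function.Surjective g) :
    ExtVanishes N a M₃ := by
  intro l hl
  have hS := shortExact_of_linearMap hf hfg hg
  have zero1 := AddCommGrpCat.isZero_of_iff_subsingleton.mpr (h₂ l hl)
  have zero2 := AddCommGrpCat.isZero_of_iff_subsingleton.mpr (h₁ (l + 1) (by omega))
  exact AddCommGrpCat.subsingleton_of_isZero <| ShortComplex.Exact.isZero_of_both_zeros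
    (Abelian.Ext.covariant_sequence_exact₃' N hS l (l + 1) rfl)
    (zero1.eq_zero_of_src _) (zero2.eq_zero_of_tgt _)

lemma ExtVanishes.one_of_injective (h : ExtVanishes N 1 M₂) (hf : Function.Injective f) :
    ExtVanishes N 1 M₁ :=
  ExtVanishes.left (M₃ := M₂ ⧸ LinearMap.range f) (f := f) (g := (LinearMap.range f).mkQ) h
    (fun _ hl => absurd hl (Nat.not_lt_zero _)) hf (LinearMap.exact_map_mkQ_range f)
    (Submodule.mkQ_surjective _)

lemma ExtVanishes.subsingleton_linearMap {a : ℕ} (h : ExtVanishes N (a + 1) M₁) :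
    Subsingleton (N →ₗ[R] M₁) := by
  have := h 0 (Nat.succ_pos a)
  have : Subsingleton (N ⟶ ModuleCat.of R M₁) :=
    Abelian.Ext.addEquiv₀.subsingleton_congr.mp this
  exact (ModuleCat.homAddEquiv (M := N) (N := ModuleCat.of R M₁)).symm.toEquiv.subsingleton

/-- An element killed by an ideal vanishes when there are no maps from the residue ring. -/
lemma ExtVanishes.eq_zero {I : Ideal R} {a : ℕ}
    (h : ExtVanishes (ModuleCat.of R (R ⧸ I)) (a + 1) M₁) {z : M₁} (hz : ∀ r ∈ I, r • z = 0) :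
    z = 0 := by
  have := h.subsingleton_linearMap
  have hφ : Submodule.liftQ I (LinearMap.toSpanSingleton R M₁ z) (fun r hr => by
      simpa using hz r hr) = 0 := this.elim _ _
  have h1 := LinearMap.congr_fun hφ (Submodule.Quotient.mk 1)
  rwa [Submodule.liftQ_apply, LinearMap.toSpanSingleton_apply, one_smul] at h1

lemma extVanishes_iff_exists_isRegular [IsNoetherianRing R] (I : Ideal R) (a : ℕ)
    [Module.Finite R M₁] (hI : I • (⊤ : Submodule R M₁) < ⊤) :
    ExtVanishes (ModuleCat.of R (R ⧸ I)) a M₁ ↔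
      ∃ rs : List R, rs.length = a ∧ (∀ r ∈ rs, r ∈ I) ∧ RingTheory.Sequence.IsRegular M₁ rs := by
  have hsupp : Module.support R (R ⧸ I) = PrimeSpectrum.zeroLocus I := by
    rw [Module.support_eq_zeroLocus, Ideal.annihilator_quotient]
  have : Module.Finite R (ModuleCat.of R M₁) := ‹_›
  constructor
  · exact fun h => ModuleCat.exists_isRegular_of_exists_subsingleton_ext I a (ModuleCat.of R M₁) hI
      (ModuleCat.of R (R ⧸ I)) hsupp h
  · rintro ⟨rs, rfl, hrs, hreg⟩
    exact ModuleCat.subsingleton_ext_of_exists_isRegular I (ModuleCat.of R (R ⧸ I)) hsupp.subset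
      (ModuleCat.of R M₁) hI rs hrs hreg

end ExtVanishing

section Depth

variable {K : Type} [Field K] {n : ℕ} {Δ : Finset (Finset (Fin n))}

lemma smul_quotient_faceP_ne_top (F : Finset (Fin n)) :
    maxIdeal K n • (⊤ : Submodule (MvPolynomial (Fin n) K)
      (MvPolynomial (Fin n) K ⧸ faceP (X : Fin n → MvPolynomial (Fin n) K) F)) ≠ ⊤ := by
  intro h
  have h1 : maxIdeal K n = faceP X ∅ := by
    rw [maxIdeal, faceP, Finset.compl_empty, Finset.coe_univ, Set.image_univ]
  have h2 := congrArg (Submodule.comap (Submodule.mkQ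
    (faceP (X : Fin n → MvPolynomial (Fin n) K) F))) h
  rw [Submodule.comap_smul_top_of_surjective _ _ (Submodule.mkQ_surjective _),
    Submodule.ker_mkQ, Submodule.comap_top, smul_eq_mul, Ideal.mul_top, h1,
    sup_eq_left.mpr (faceP_le X (Finset.empty_subset F))] at h2
  have h3 := (Ideal.eq_top_iff_one _).mp h2
  exact one_ne_zero ((coeff_zero_one (σ := Fin n) (R := K)).symm.trans
    (mem_faceP_X_iff.mp h3 0 (by simp)))

lemma isSMulRegular_X {F : Finset (Fin n)} {v : Fin n} (hv : v ∈ F) :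
    IsSMulRegular (MvPolynomial (Fin n) K ⧸ faceP (X : Fin n → MvPolynomial (Fin n) K) F)
      (X v : MvPolynomial (Fin n) K) := by
  rw [isSMulRegular_iff_right_eq_zero_of_smul]
  intro z hz
  obtain ⟨p, rfl⟩ := Ideal.Quotient.mk_surjective z
  have hz' : Ideal.Quotient.mk (faceP X F) (X v * p) = 0 := hz
  rw [Ideal.Quotient.eq_zero_iff_mem, mem_faceP_X_iff] at hz' ⊢
  intro m hm
  rw [← hz' (Finsupp.single v 1 + m) (Finsupp.support_add.trans (Finset.union_subset
    (Finsupp.support_single_subset.trans (Finset.singleton_subset_iff.mpr hv)) hm)),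
    coeff_X_mul]

lemma faceP_eq_sup {F : Finset (Fin n)} {v : Fin n} (hv : v ∉ F) :
    faceP (X : Fin n → MvPolynomial (Fin n) K) F = faceP X (insert v F) ⊔ Ideal.span {X v} := by
  have : Fᶜ = (insert v F)ᶜ ∪ {v} := by
    ext w
    by_cases hw : w = v <;> simp [hw, hv]
  rw [faceP, this, Finset.coe_union, Set.image_union, Ideal.span_union, Finset.coe_singleton,
    Set.image_singleton, faceP]

open scoped Pointwise in
lemma nonempty_quotSMulTop_equiv {F : Finset (Fin n)} {v : Fin n} (hv : v ∉ F) :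
    Nonempty (QuotSMulTop (X v : MvPolynomial (Fin n) K)
      (MvPolynomial (Fin n) K ⧸ faceP (X : Fin n → MvPolynomial (Fin n) K) (insert v F)) ≃ₗ[
        MvPolynomial (Fin n) K] MvPolynomial (Fin n) K ⧸ faceP X F) := by
  set f := Submodule.factor (faceP_le (X : Fin n → MvPolynomial (Fin n) K)
    (Finset.subset_insert v F)) with hf
  have hker : (X v : MvPolynomial (Fin n) K) • (⊤ : Submodule (MvPolynomial (Fin n) K)
      (MvPolynomial (Fin n) K ⧸ faceP (X : Fin n → MvPolynomial (Fin n) K) (insert v F))) =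
      LinearMap.ker f := by
    ext z
    obtain ⟨p, rfl⟩ := Ideal.Quotient.mk_surjective z
    have h1 : f (Ideal.Quotient.mk _ p) = Ideal.Quotient.mk _ p := rfl
    rw [LinearMap.mem_ker, h1, Ideal.Quotient.eq_zero_iff_mem, faceP_eq_sup hv,
      Submodule.mem_smul_pointwise_iff_exists]
    constructor
    · rintro ⟨z, -, hz⟩
      obtain ⟨q, rfl⟩ := Ideal.Quotient.mk_surjective z
      have hz' : Ideal.Quotient.mk (faceP X (insert v F)) (X v * q) = Ideal.Quotient.mk _ p := hz
      rw [eq_comm, Ideal.Quotient.eq] at hz'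
      exact Submodule.mem_sup.mpr ⟨_, hz', _,
        Ideal.mul_mem_right _ _ (Ideal.mem_span_singleton_self _), sub_add_cancel _ _⟩
    · intro hp
      obtain ⟨a, ha, b, hb, rfl⟩ := Submodule.mem_sup.mp hp
      obtain ⟨q, rfl⟩ := Ideal.mem_span_singleton.mp hb
      refine ⟨Ideal.Quotient.mk _ q, trivial, ?_⟩
      rw [map_add, Ideal.Quotient.eq_zero_iff_mem.mpr ha, zero_add]
      rfl
  exact ⟨(Submodule.quotEquivOfEq _ _ hker).trans
    (LinearMap.quotKerEquivOfSurjective f (Submodule.factor_surjective _))⟩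

lemma exists_isRegular_quotient_faceP (F : Finset (Fin n)) :
    ∃ rs : List (MvPolynomial (Fin n) K), rs.length = F.card ∧ (∀ r ∈ rs, r ∈ maxIdeal K n) ∧
      RingTheory.Sequence.IsRegular
        (MvPolynomial (Fin n) K ⧸ faceP (X : Fin n → MvPolynomial (Fin n) K) F) rs := by
  induction F using Finset.induction with
  | empty =>
    refine ⟨[], rfl, by simp, ?_⟩
    have : Nontrivial (MvPolynomial (Fin n) K ⧸ faceP (X : Fin n → MvPolynomial (Fin n) K) ∅) :=
      (Submodule.nontrivial_iff _).mp
        (nontrivial_of_lt _ _ (smul_quotient_faceP_ne_top ∅).lt_top)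
    exact RingTheory.Sequence.IsRegular.nil _ _
  | insert v F hv ih =>
    obtain ⟨rs, hlen, hrs, hreg⟩ := ih
    obtain ⟨e⟩ := nonempty_quotSMulTop_equiv (K := K) hv
    refine ⟨X v :: rs, by rw [List.length_cons, hlen, Finset.card_insert_of_notMem hv], ?_, ?_⟩
    · simp only [List.mem_cons, forall_eq_or_imp]
      exact ⟨Ideal.subset_span ⟨v, rfl⟩, hrs⟩
    · rw [RingTheory.Sequence.isRegular_cons_iff]
      exact ⟨isSMulRegular_X (Finset.mem_insert_self v F), (e.isRegular_congr rs).mpr hreg⟩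

/-- Vanishing of `Ext` out of the residue field in degrees below `a`. -/
abbrev ResidueExtVanishes (K : Type) [Field K] (n a : ℕ) (M : Type) [AddCommGroup M]
    [Module (MvPolynomial (Fin n) K) M] : Prop :=
  ExtVanishes (ModuleCat.of (MvPolynomial (Fin n) K) (MvPolynomial (Fin n) K ⧸ maxIdeal K n)) a M

lemma extVanishes_quotient_faceP (F : Finset (Fin n)) :
    ResidueExtVanishes K n F.card
      (MvPolynomial (Fin n) K ⧸ faceP (X : Fin n → MvPolynomial (Fin n) K) F) :=
  (extVanishes_iff_exists_isRegular (maxIdeal K n) F.card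
    (smul_quotient_faceP_ne_top F).lt_top).mpr (exists_isRegular_quotient_faceP F)

lemma extVanishes_faceChains (j : ℕ) :
    ResidueExtVanishes K n j (faceChains (X : Fin n → MvPolynomial (Fin n) K) Δ j) := by
  classical
  let ι := {F : Finset (Fin n) // F ∈ Δ ∧ F.card = j}
  have hmem : ∀ (F : ι) (z : MvPolynomial (Fin n) K ⧸ faceP X F.1),
      LinearMap.single (MvPolynomial (Fin n) K)
        (fun F => MvPolynomial (Fin n) K ⧸ faceP (X : Fin n → MvPolynomial (Fin n) K) F) F.1 z ∈
        faceChains X Δ j := fun F z G hG => by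
    rw [LinearMap.single_apply, Pi.single_eq_of_ne]
    exact fun h : G = F.1 => hG (h ▸ F.2)
  refine extVanishes_of_sum_comp_eq_id (ι := ι)
    (P := fun F => MvPolynomial (Fin n) K ⧸ faceP (X : Fin n → MvPolynomial (Fin n) K) F.1)
    (fun F => LinearMap.proj F.1 ∘ₗ Submodule.subtype _)
    (fun F => LinearMap.codRestrict (faceChains X Δ j) (LinearMap.single _
      (fun F => MvPolynomial (Fin n) K ⧸ faceP (X : Fin n → MvPolynomial (Fin n) K) F) F.1)
      (hmem F)) ?_ fun F => ?_
  · ext1 z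
    refine Subtype.ext (funext fun G => ?_)
    simp only [LinearMap.sum_apply, LinearMap.comp_apply, Submodule.coe_sum, Finset.sum_apply,
      LinearMap.codRestrict_apply, LinearMap.single_apply, LinearMap.id_apply, LinearMap.proj_apply,
      Submodule.subtype_apply]
    by_cases hG : G ∈ Δ ∧ G.card = j
    · rw [Finset.sum_eq_single (⟨G, hG⟩ : ι), Pi.single_eq_same]
      · exact fun F _ hF => Pi.single_eq_of_ne (fun h => hF (Subtype.ext h.symm)) _
      · exact fun h => absurd (Finset.mem_univ _) h
    · rw [z.2 G hG]
      exact Finset.sum_eq_zero fun F _ => Pi.single_eq_of_ne (fun h : G = F.1 => hG (h ▸ F.2)) _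
  · have := extVanishes_quotient_faceP (K := K) F.1
    rwa [F.2.2] at this

section Step

variable {R : Type} [CommRing R] {x : Fin n → R} (Δ)

/-- The inclusion of cycles into chains. -/
noncomputable def cyclesInclusion (j : ℕ) : faceCycles x Δ j →ₗ[R] faceChains x Δ j :=
  Submodule.inclusion inf_le_left

/-- The boundary map onto boundaries. -/
noncomputable def toBoundaries (j : ℕ) : faceChains x Δ (j + 1) →ₗ[R] faceBoundaries x Δ j :=
  (faceBd x).restrict fun z hz => ⟨z, hz, rfl⟩

lemma cyclesInclusion_injective (j : ℕ) : Function.Injective (cyclesInclusion (x := x) Δ j) :=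
  Submodule.inclusion_injective _

lemma toBoundaries_surjective (j : ℕ) : Function.Surjective (toBoundaries (x := x) Δ j) := by
  rintro ⟨_, z, hz, rfl⟩
  exact ⟨⟨z, hz⟩, rfl⟩

lemma exact_cyclesInclusion_toBoundaries (j : ℕ) :
    Function.Exact (cyclesInclusion (x := x) Δ (j + 1)) (toBoundaries (x := x) Δ j) := by
  intro z
  constructor
  · exact fun h => ⟨⟨z.1, z.2, LinearMap.mem_ker.mpr (congrArg Subtype.val h)⟩, rfl⟩
  · rintro ⟨y, rfl⟩
    exact Subtype.ext (LinearMap.mem_ker.mp y.2.2)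

end Step

lemma extVanishes_faceCycles_succ {j : ℕ}
    (h : ResidueExtVanishes K n j (faceBoundaries (X : Fin n → MvPolynomial (Fin n) K) Δ j)) :
    ResidueExtVanishes K n (j + 1)
      (faceCycles (X : Fin n → MvPolynomial (Fin n) K) Δ (j + 1)) :=
  ExtVanishes.left (extVanishes_faceChains (j + 1)) h (cyclesInclusion_injective Δ (j + 1))
    (exact_cyclesInclusion_toBoundaries Δ j) (toBoundaries_surjective Δ j)

lemma extVanishes_faceBoundaries {j : ℕ}
    (h : ResidueExtVanishes K n (j + 1)
      (faceCycles (X : Fin n → MvPolynomial (Fin n) K) Δ (j + 1))) :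
    ResidueExtVanishes K n j (faceBoundaries (X : Fin n → MvPolynomial (Fin n) K) Δ j) :=
  ExtVanishes.right h ((extVanishes_faceChains (j + 1)).mono (Nat.le_succ j))
    (cyclesInclusion_injective Δ (j + 1)) (exact_cyclesInclusion_toBoundaries Δ j)
    (toBoundaries_surjective Δ j)

lemma faceCycles_eq_faceBoundaries (hΔ : IsSimplicialComplex Δ) {j : ℕ}
    (h : ∀ G : Finset (Fin n), G.Nonempty → LinkExact K Δ G j) (h0 : LinkExact K Δ ∅ j) :
    faceCycles (X : Fin n → MvPolynomial (Fin n) K) Δ j = faceBoundaries X Δ j :=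
  le_antisymm (faceCycles_le_faceBoundaries fun G => G.eq_empty_or_nonempty.elim
    (fun hG => hG ▸ h0) (h G)) (faceBoundaries_le_faceCycles hΔ j)

lemma extVanishes_faceCycles_of_linkExact (hΔ : IsSimplicialComplex Δ) {d : ℕ}
    (h : ∀ j < d, ∀ G : Finset (Fin n), G.Nonempty → LinkExact K Δ G j)
    (h0 : ∀ j, 2 ≤ j → j < d → LinkExact K Δ ∅ j) {j : ℕ} (hj : j ≤ d) :
    ResidueExtVanishes K n j (faceCycles (X : Fin n → MvPolynomial (Fin n) K) Δ j) := by
  induction j with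
  | zero => exact fun l hl => absurd hl (Nat.not_lt_zero l)
  | succ j ih =>
    refine extVanishes_faceCycles_succ ?_
    match j with
    | 0 => exact fun l hl => absurd hl (Nat.not_lt_zero l)
    | 1 =>
      exact (extVanishes_faceChains 1).one_of_injective (f := Submodule.inclusion
        ((faceBoundaries_le_faceCycles hΔ 1).trans inf_le_left)) (Submodule.inclusion_injective _)
    | j + 2 =>
      rw [← faceCycles_eq_faceBoundaries hΔ (h _ hj) (h0 _ (by omega) hj)]
      exact ih (by omega)

lemma linkExact_empty_of_extVanishes (hΔ : IsSimplicialComplex Δ) {j : ℕ}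
    (h : ∀ G : Finset (Fin n), G.Nonempty → LinkExact K Δ G (j + 2))
    (hB : ResidueExtVanishes K n (j + 2)
      (faceBoundaries (X : Fin n → MvPolynomial (Fin n) K) Δ (j + 2))) :
    LinkExact K Δ ∅ (j + 2) := by
  refine linkExact_empty fun c hc0 hc => ?_
  have hle := faceBoundaries_le_faceCycles (x := (X : Fin n → MvPolynomial (Fin n) K)) hΔ (j + 2)
  let ι := Submodule.inclusion hle
  have hZ : ResidueExtVanishes K n 1
      (faceCycles (X : Fin n → MvPolynomial (Fin n) K) Δ (j + 2)) :=
    ((extVanishes_faceChains (j + 2)).mono (by omega)).one_of_injective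
      (cyclesInclusion_injective Δ (j + 2))
  have hQ := ExtVanishes.right (hB.mono (by omega)) hZ (Submodule.inclusion_injective hle)
    (LinearMap.exact_map_mkQ_range ι) (Submodule.mkQ_surjective _)
  let z : faceCycles (X : Fin n → MvPolynomial (Fin n) K) Δ (j + 2) :=
    ⟨constFamily c, constFamily_mem_faceCycles hc0 hc⟩
  have hz : (LinearMap.range ι).mkQ z = 0 := by
    refine hQ.eq_zero fun r hr => ?_
    induction hr using Submodule.span_induction with
    | mem r hr =>
      obtain ⟨v, rfl⟩ := hr
      rw [← map_smul, Submodule.mkQ_apply, Submodule.Quotient.mk_eq_zero]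
      exact ⟨⟨_, X_smul_constFamily_mem (h {v} (Finset.singleton_nonempty v)) hc0 hc⟩, rfl⟩
    | zero => exact zero_smul _ _
    | add r s _ _ hr hs => rw [add_smul, hr, hs, add_zero]
    | smul a r _ hr => rw [smul_eq_mul, mul_smul, hr, smul_zero]
  rw [Submodule.mkQ_apply, Submodule.Quotient.mk_eq_zero] at hz
  obtain ⟨y, hy⟩ := hz
  have hy' : y.1 = constFamily c := congrArg Subtype.val hy
  exact hy' ▸ y.2

lemma linkExact_empty_of_extVanishes_faceCycles (hΔ : IsSimplicialComplex Δ) {d : ℕ}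
    (h : ∀ j < d, ∀ G : Finset (Fin n), G.Nonempty → LinkExact K Δ G j)
    (hd : ResidueExtVanishes K n d (faceCycles (X : Fin n → MvPolynomial (Fin n) K) Δ d))
    {j : ℕ} (hj : j + 2 < d) : LinkExact K Δ ∅ (j + 2) := by
  have key : ∀ k j, j + 3 + k = d → ResidueExtVanishes K n (j + 3)
      (faceCycles (X : Fin n → MvPolynomial (Fin n) K) Δ (j + 3)) := by
    intro k
    induction k with
    | zero =>
      rintro j rfl
      exact hd
    | succ k ih =>
      intro j hj
      have hB := extVanishes_faceBoundaries (ih (j + 1) (by omega))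
      rwa [← faceCycles_eq_faceBoundaries hΔ (h _ (by omega))
        (linkExact_empty_of_extVanishes hΔ (h _ (by omega)) hB)] at hB
  exact linkExact_empty_of_extVanishes hΔ (h _ hj)
    (extVanishes_faceBoundaries (key (d - (j + 3)) j (by omega)))

end Depth

section DepthDim

variable {R : Type} [CommRing R] {M M' : Type} [AddCommGroup M] [Module R M]
  [AddCommGroup M'] [Module R M']

lemma isCMMod_congr (I : Ideal R) (e : M ≃ₗ[R] M') : IsCMMod I M ↔ IsCMMod I M' := by
  have h : moduleDepth I M = moduleDepth I M' := by
    simp only [moduleDepth, e.isRegular_congr]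
  rw [IsCMMod, IsCMMod, h, moduleDim, moduleDim, e.annihilator_eq]

lemma length_le_supportDim_of_isRegular [IsNoetherianRing R] [Module.Finite R M] {rs : List R}
    (h : RingTheory.Sequence.IsRegular M rs) : (rs.length : WithBot ℕ∞) ≤ Module.supportDim R M := by
  induction rs generalizing M with
  | nil =>
    have := h.nontrivial
    have hne := (Module.supportDim_ne_bot_iff_nontrivial R M).mpr this
    obtain ⟨a, ha⟩ := WithBot.ne_bot_iff_exists.mp hne
    rw [← ha]
    exact WithBot.coe_le_coe.mpr zero_le
  | cons x rs ih =>
    rw [RingTheory.Sequence.isRegular_cons_iff] at h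
    refine le_trans ?_ (Module.supportDim_quotSMulTop_succ_le_of_notMem_minimalPrimes
      fun p hp => h.1.notMem_of_mem_minimalPrimes hp)
    rw [List.length_cons, Nat.cast_add, Nat.cast_one]
    gcongr
    exact ih h.2

lemma smul_top_lt_top_of_annihilator_le [Module.Finite R M] {I : Ideal R} (hI : I ≠ ⊤)
    (h : Module.annihilator R M ≤ I) : I • (⊤ : Submodule R M) < ⊤ := by
  refine lt_top_iff_ne_top.mpr fun htop => hI ((Ideal.eq_top_iff_one I).mpr ?_)
  obtain ⟨r, hr, hr0⟩ := Submodule.exists_sub_one_mem_and_smul_eq_zero_of_fg_of_le_smul I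
    (⊤ : Submodule R M) Module.Finite.fg_top htop.ge
  have hrI := h (Module.mem_annihilator.mpr fun m => hr0 m trivial)
  simpa using I.sub_mem hrI hr

/-- A module of dimension `d` is Cohen–Macaulay exactly when it has a regular sequence of
length `d` in the given ideal. -/
lemma isCMMod_iff_exists_isRegular [IsNoetherianRing R] [Module.Finite R M] [Nontrivial M]
    (I : Ideal R) {d : ℕ} (hd : moduleDim R M = ((d : WithTop ℕ) : WithBot (WithTop ℕ))) :
    IsCMMod I M ↔ ∃ rs : List R, rs.length = d ∧ (∀ r ∈ rs, r ∈ I) ∧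
      RingTheory.Sequence.IsRegular M rs := by
  have hle : ∀ rs : List R, RingTheory.Sequence.IsRegular M rs → rs.length ≤ d := fun rs hrs => by
    have h := length_le_supportDim_of_isRegular hrs
    rw [Module.supportDim_eq_ringKrullDim_quotient_annihilator] at h
    exact WithTop.coe_le_coe.mp (WithBot.coe_le_coe.mp (h.trans_eq hd))
  have hlub : IsLUB {m : WithTop ℕ | ∃ rs : List R, (rs.length : WithTop ℕ) = m ∧
      (∀ r ∈ rs, r ∈ I) ∧ RingTheory.Sequence.IsRegular M rs} (moduleDepth I M) :=
    WithTop.isLUB_sSup _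
  rw [IsCMMod, hd, WithBot.coe_inj]
  constructor
  · intro h
    rw [h] at hlub
    by_contra hc
    rcases d with _ | d
    · exact hc ⟨[], rfl, by simp, RingTheory.Sequence.IsRegular.nil R M⟩
    · have hub : ((d + 1 : ℕ) : WithTop ℕ) ≤ (d : ℕ) := hlub.2 (by
        rintro _ ⟨rs, rfl, hrs, hreg⟩
        have h1 := hle rs hreg
        have h2 : rs.length ≠ d + 1 := fun h2 => hc ⟨rs, h2, hrs, hreg⟩
        exact WithTop.coe_le_coe.mpr (Nat.le_of_lt_succ (lt_of_le_of_ne h1 h2)))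
      exact absurd (WithTop.coe_le_coe.mp hub) (by simp)
  · rintro ⟨rs, hlen, hrs, hreg⟩
    refine hlub.unique ⟨?_, fun b hb => hb ⟨rs, by rw [hlen], hrs, hreg⟩⟩
    rintro _ ⟨rs', rfl, -, hreg'⟩
    exact WithTop.coe_le_coe.mpr (hle rs' hreg')

end DepthDim

section Dimension

variable {K : Type} [Field K] {n : ℕ} {Δ : Finset (Finset (Fin n))}

lemma ringKrullDim_quotient_faceP (F : Finset (Fin n)) :
    ringKrullDim (MvPolynomial (Fin n) K ⧸ faceP (X : Fin n → MvPolynomial (Fin n) K) F) =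
      (F.card : WithBot ℕ∞) := by
  refine le_antisymm ?_ ?_
  · let φ : MvPolynomial F K →ₐ[K]
        MvPolynomial (Fin n) K ⧸ faceP (X : Fin n → MvPolynomial (Fin n) K) F :=
      aeval fun v => Ideal.Quotient.mk _ (X v.1)
    have hφ : Function.Surjective φ := by
      intro z
      obtain ⟨p, rfl⟩ := Ideal.Quotient.mk_surjective z
      induction p using MvPolynomial.induction_on with
      | C a => exact ⟨C a, by simp [φ]; rfl⟩
      | add p q hp hq =>
        obtain ⟨a, ha⟩ := hp
        obtain ⟨b, hb⟩ := hq
        exact ⟨a + b, by rw [map_add, ha, hb, map_add]⟩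
      | mul_X p v hp =>
        obtain ⟨a, ha⟩ := hp
        by_cases hv : v ∈ F
        · exact ⟨a * X ⟨v, hv⟩, by rw [map_mul, ha, map_mul, aeval_X]⟩
        · refine ⟨0, ?_⟩
          rw [map_zero, eq_comm, Ideal.Quotient.eq_zero_iff_mem]
          exact Ideal.mul_mem_left _ _ (Ideal.subset_span ⟨v, by simpa using hv, rfl⟩)
    have h := ringKrullDim_le_of_surjective φ.toRingHom hφ
    rw [MvPolynomial.ringKrullDim_of_isNoetherianRing, ringKrullDim_eq_zero_of_field] at h
    simpa using h
  · obtain ⟨rs, hlen, -, hreg⟩ := exists_isRegular_quotient_faceP (K := K) F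
    rw [← hlen, ← Module.supportDim_quotient_eq_ringKrullDim]
    exact length_le_supportDim_of_isRegular hreg

lemma monomial_mul_mem_faceP_iff {F : Finset (Fin n)} {p : MvPolynomial (Fin n) K}
    {U : Finset (Fin n)} (hU : U ⊆ F) :
    p * ∏ v ∈ U, X v ∈ faceP (X : Fin n → MvPolynomial (Fin n) K) F ↔ p ∈ faceP X F := by
  refine ⟨fun h => ?_, fun h => Ideal.mul_mem_right _ _ h⟩
  induction U using Finset.induction with
  | empty => simpa using h
  | insert v U hv ih =>
    refine ih ((Finset.subset_insert _ _).trans hU) ?_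
    rw [Finset.prod_insert hv, mul_left_comm] at h
    have hreg := isSMulRegular_X (K := K) (hU (Finset.mem_insert_self v U))
    rw [isSMulRegular_iff_right_eq_zero_of_smul] at hreg
    exact Ideal.Quotient.eq_zero_iff_mem.mp (hreg (Ideal.Quotient.mk _ _)
      (Ideal.Quotient.eq_zero_iff_mem.mpr h))

lemma annihilator_faceCycles_le {d : ℕ} {F : Finset (Fin n)} (hF : F ∈ Δ) (hFd : F.card = d) :
    Module.annihilator (MvPolynomial (Fin n) K)
      (faceCycles (X : Fin n → MvPolynomial (Fin n) K) Δ d) ≤ faceP X F := by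
  classical
  intro r hr
  let y : Finset (Fin n) → MvPolynomial (Fin n) K := Pi.single F (∏ v ∈ F, X v)
  have hyF : y F = ∏ v ∈ F, X v := Pi.single_eq_same _ _
  have hyG : ∀ G, G ≠ F → y G = 0 := fun G hG => Pi.single_eq_of_ne hG _
  have hy : toFaceProd X y ∈ faceCycles X Δ d := by
    refine ⟨fun G hG => ?_, ?_⟩
    · have hGF : G ≠ F := fun h => hG (h ▸ ⟨hF, hFd⟩)
      rw [toFaceProd_apply, hyG G hGF, map_zero]
    · rw [SetLike.mem_coe, LinearMap.mem_ker, faceBd_toFaceProd]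
      refine funext fun B => toFaceProd_apply_eq_zero.mpr (Submodule.sum_mem _ fun v hv => ?_)
      refine zsmul_mem ?_ _
      by_cases h : insert v B = F
      · rw [h, hyF]
        exact Ideal.mem_of_dvd _ (Finset.dvd_prod_of_mem _ (h ▸ Finset.mem_insert_self v B))
          (Ideal.subset_span ⟨v, hv, rfl⟩)
      · rw [hyG _ h]
        exact zero_mem _
  have h0 := congrArg Subtype.val (Module.mem_annihilator.mp hr ⟨_, hy⟩)
  have h1 : toFaceProd X (r • y) F = 0 := by
    rw [map_smul]
    exact congrFun h0 F
  rw [toFaceProd_apply_eq_zero, Pi.smul_apply, hyF, smul_eq_mul] at h1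
  exact (monomial_mul_mem_faceP_iff subset_rfl).mp h1

lemma prod_faceP_le_annihilator (d : ℕ) :
    ∏ F ∈ Δ with F.card = d, faceP (X : Fin n → MvPolynomial (Fin n) K) F ≤
      Module.annihilator (MvPolynomial (Fin n) K)
        (faceCycles (X : Fin n → MvPolynomial (Fin n) K) Δ d) := by
  intro r hr
  refine Module.mem_annihilator.mpr fun z => Subtype.ext (funext fun F => ?_)
  by_cases hF : F ∈ Δ ∧ F.card = d
  · obtain ⟨q, hq⟩ := Ideal.Quotient.mk_surjective (z.1 F)
    have hrF : r ∈ faceP X F := Ideal.prod_le_inf.trans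
      (Finset.inf_le (Finset.mem_filter.mpr hF)) hr
    have h : r • z.1 F = 0 := by
      rw [← hq]
      exact Ideal.Quotient.eq_zero_iff_mem.mpr (Ideal.mul_mem_right _ _ hrF)
    exact h
  · have h : r • z.1 F = 0 := by rw [z.2.1 F hF, smul_zero]
    exact h

lemma moduleDim_faceCycles {d : ℕ} (hd : ∃ F ∈ Δ, F.card = d) :
    moduleDim (MvPolynomial (Fin n) K) (faceCycles (X : Fin n → MvPolynomial (Fin n) K) Δ d) =
      ((d : WithTop ℕ) : WithBot (WithTop ℕ)) := by
  refine le_antisymm ?_ ?_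
  · change ringKrullDim _ ≤ _
    rw [ringKrullDim_quotient]
    refine iSup_le fun c => ?_
    have hc := c.head.2
    rw [PrimeSpectrum.mem_zeroLocus, SetLike.coe_subset_coe] at hc
    obtain ⟨F, hF, hFc⟩ := (Ideal.IsPrime.prod_le c.head.1.2).mp
      ((prod_faceP_le_annihilator d).trans hc)
    have hle : ∀ i, c i ∈ {p : PrimeSpectrum.zeroLocus _ | faceP X F ≤ p.1.asIdeal} := fun i =>
      hFc.trans (c.monotone (Fin.zero_le i))
    let c' : LTSeries (PrimeSpectrum.zeroLocus
        (faceP (X : Fin n → MvPolynomial (Fin n) K) F : Set (MvPolynomial (Fin n) K))) :=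
      { length := c.length
        toFun := fun i => ⟨(c i).1, hle i⟩
        step := fun i => c.step i }
    have h := (Order.le_krullDim_iff (α := PrimeSpectrum.zeroLocus
        (faceP (X : Fin n → MvPolynomial (Fin n) K) F : Set (MvPolynomial (Fin n) K)))).mpr
      ⟨c', rfl⟩
    rw [← ringKrullDim_quotient, ringKrullDim_quotient_faceP, (Finset.mem_filter.mp hF).2] at h
    exact h
  · obtain ⟨F, hF, rfl⟩ := hd
    refine (ringKrullDim_quotient_faceP (K := K) F).ge.trans ?_
    exact ringKrullDim_le_of_surjective (Ideal.Quotient.factor (annihilator_faceCycles_le hF rfl))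
      (Ideal.Quotient.factor_surjective _)

lemma maxIdeal_ne_top : maxIdeal K n ≠ ⊤ := fun h => by
  refine smul_quotient_faceP_ne_top (K := K) (n := n) ∅ ?_
  rw [h, Submodule.top_smul]

lemma isCMMod_faceCycles_iff {d : ℕ} (hd : ∃ F ∈ Δ, F.card = d) :
    IsCMMod (maxIdeal K n) (faceCycles (X : Fin n → MvPolynomial (Fin n) K) Δ d) ↔
      ResidueExtVanishes K n d (faceCycles (X : Fin n → MvPolynomial (Fin n) K) Δ d) := by
  have hlt : maxIdeal K n • (⊤ : Submodule (MvPolynomial (Fin n) K)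
      (faceCycles (X : Fin n → MvPolynomial (Fin n) K) Δ d)) < ⊤ := by
    obtain ⟨F, hF, hFd⟩ := hd
    exact smul_top_lt_top_of_annihilator_le maxIdeal_ne_top
      ((annihilator_faceCycles_le hF hFd).trans (Ideal.span_mono (Set.image_subset_range _ _)))
  have : Nontrivial (faceCycles (X : Fin n → MvPolynomial (Fin n) K) Δ d) :=
    (Submodule.nontrivial_iff _).mp (nontrivial_of_lt _ _ hlt)
  rw [isCMMod_iff_exists_isRegular _ (moduleDim_faceCycles hd)]
  exact (extVanishes_iff_exists_isRegular _ d hlt).symm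

end Dimension

end StanleyReisner

open StanleyReisner

/-- Let `Δ` be a `(d−1)`-dimensional Buchsbaum simplicial complex over a field `K`
(Buchsbaum here meaning that the local cohomology `H^i_𝔪(K[Δ])` has finite length for
all `i < d`).  Then `K[Δ]` is canonically Cohen–Macaulay iff the reduced simplicial
homology `H_i(Δ; K)` vanishes for all `1 ≤ i < d−1`. -/
theorem buchsbaum_ccm_iff_homology_vanishing
    (K : Type) [Field K] (n d : ℕ) (Δ : Finset (Finset (Fin n)))
    (hΔ : IsSimplicialComplex Δ)
    (hdim : (∀ s ∈ Δ, s.card ≤ d) ∧ ∃ s ∈ Δ, s.card = d)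
    (hBuchsbaum : ∀ i < d, IsFiniteLength (MvPolynomial (Fin n) K)
      ((localCohomology (maxIdeal K n) i).obj
        (ModuleCat.of (MvPolynomial (Fin n) K)
          (MvPolynomial (Fin n) K ⧸ stanleyReisnerIdeal K Δ)))) :
    IsCMMod (maxIdeal K n)
      (extMod (MvPolynomial (Fin n) K) (n - d)
        (MvPolynomial (Fin n) K ⧸ stanleyReisnerIdeal K Δ) (MvPolynomial (Fin n) K)) ↔
    ∀ i, 1 ≤ i → i < d - 1 → Subsingleton (simpHomologySucc K Δ (i - 1)) := by
  obtain ⟨hd, hd'⟩ := hdim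
  have hdn : d ≤ n := by
    obtain ⟨s, -, rfl⟩ := hd'
    exact card_finset_fin_le s
  have hX : IsStronglyRegular (X : Fin n → MvPolynomial (Fin n) K) := by
    simpa only [pow_one] using isStronglyRegular_X_pow K (n := n) (t := 1)
  obtain ⟨e⟩ := nonempty_ext_equiv_faceCycles hX hΔ hd hdn
  have hlink : ∀ j < d, ∀ G : Finset (Fin n), G.Nonempty → LinkExact K Δ G j :=
    fun j hj G hG => (linkCoexact_of_isFiniteLength hΔ (hBuchsbaum j hj) hG).linkExact
  refine (isCMMod_congr (maxIdeal K n) e).trans ((isCMMod_faceCycles_iff hd').trans ?_)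
  constructor
  · intro h i hi hid
    rw [subsingleton_simpHomologySucc_iff hΔ]
    exact linkExact_empty_of_extVanishes_faceCycles hΔ hlink h (by omega)
  · intro h
    refine extVanishes_faceCycles_of_linkExact hΔ hlink (fun j hj hjd => ?_) le_rfl
    obtain ⟨k, rfl⟩ := Nat.exists_eq_add_of_le' hj
    exact (subsingleton_simpHomologySucc_iff hΔ k).mp (h (k + 1) (by omega) (by omega))
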